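/- arXiv:1802.05617 — 9 statements merged into one kernel-verified Lean document; each statement's English description precedes it below -/
import Mathlib

section
/- Let 0 < β₂ ≤ β₁ be real parameters and λ > 0. Then there exist R ∈ (0, +∞] and a unique maximal solution (u, v) ∈ C¹([0, R), ℝ²) of the system u'(r) + u(r)/r = v(r)(2β₂ u(r)² + β₁ v(r)²), v'(r) = −u(r)(β₁ u(r)² + 2β₂ v(r)²) for r ∈ (0, R), with initial data u(0) = 0, v(0) = λ. Moreover the solution depends continuously on λ, uniformly on every compact interval [0, R'] with 0 < R' < R. -/
open scoped ENNReal

/-- `(u, v)` is a `C¹` solution of the radial system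
`u' + u/r = v(2β₂u² + β₁v²)`, `v' = −u(β₁u² + 2β₂v²)` on `[0, R)` (where
`R ∈ (0, +∞]`) with initial data `u(0) = 0`, `v(0) = λ`. -/
def IsRadialSol (β₁ β₂ lam : ℝ) (u v : ℝ → ℝ) (R : ℝ≥0∞) : Prop :=
  u 0 = 0 ∧ v 0 = lam ∧
  ContDiffOn ℝ 1 u {r : ℝ | 0 ≤ r ∧ ENNReal.ofReal r < R} ∧
  ContDiffOn ℝ 1 v {r : ℝ | 0 ≤ r ∧ ENNReal.ofReal r < R} ∧
  ∀ r : ℝ, 0 < r → ENNReal.ofReal r < R →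
    HasDerivAt u (v r * (2 * β₂ * (u r) ^ 2 + β₁ * (v r) ^ 2) - u r / r) r ∧
    HasDerivAt v (-(u r * (β₁ * (u r) ^ 2 + 2 * β₂ * (v r) ^ 2))) r

lemma exG (β₁ β₂ M : ℝ) (hM : 0 < M) : ∃ χ : ℝ × ℝ → ℝ, ∃ C : NNReal, ∃ B : ℝ,
    ∃ g₁ g₂ : ℝ × ℝ → ℝ,
    (∀ p, g₁ p = χ p * (p.2 * (2 * β₂ * p.1 ^ 2 + β₁ * p.2 ^ 2))) ∧
    (∀ p, g₂ p = χ p * (-(p.1 * (β₁ * p.1 ^ 2 + 2 * β₂ * p.2 ^ 2)))) ∧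
    (∀ p : ℝ × ℝ, |p.1| ≤ M → |p.2| ≤ M → χ p = 1) ∧
    LipschitzWith C g₁ ∧ LipschitzWith C g₂ ∧ (∀ p, |g₁ p| ≤ B) ∧ (∀ p, |g₂ p| ≤ B) := by
  let f : ContDiffBump (0 : ℝ × ℝ) := ⟨M, M + 1, hM, by linarith⟩
  let g₁ : ℝ × ℝ → ℝ := fun p => f p * (p.2 * (2 * β₂ * p.1 ^ 2 + β₁ * p.2 ^ 2))
  let g₂ : ℝ × ℝ → ℝ := fun p => f p * (-(p.1 * (β₁ * p.1 ^ 2 + 2 * β₂ * p.2 ^ 2)))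
  have c₁ : ContDiff ℝ 1 g₁ := f.contDiff.mul (by fun_prop)
  have c₂ : ContDiff ℝ 1 g₂ := f.contDiff.mul (by fun_prop)
  have s₁ : HasCompactSupport g₁ := f.hasCompactSupport.mul_right
  have s₂ : HasCompactSupport g₂ := f.hasCompactSupport.mul_right
  obtain ⟨C₁, hC₁⟩ := c₁.lipschitzWith_of_hasCompactSupport s₁ (by norm_num)
  obtain ⟨C₂, hC₂⟩ := c₂.lipschitzWith_of_hasCompactSupport s₂ (by norm_num)
  obtain ⟨B₁, hB₁⟩ := s₁.exists_bound_of_continuous c₁.continuous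
  obtain ⟨B₂, hB₂⟩ := s₂.exists_bound_of_continuous c₂.continuous
  refine ⟨f, max C₁ C₂, max B₁ B₂, g₁, g₂, fun _ => rfl, fun _ => rfl, ?_,
    hC₁.weaken (le_max_left _ _), hC₂.weaken (le_max_right _ _),
    fun p => (hB₁ p).trans (le_max_left _ _), fun p => (hB₂ p).trans (le_max_right _ _)⟩
  intro p h1 h2
  apply f.one_of_mem_closedBall
  rw [mem_closedBall_zero_iff, Prod.norm_def]
  exact max_le h1 h2

/-- energy bound -/
lemma energy (β₁ β₂ : ℝ) (hβ₂ : 0 < β₂) (hββ : β₂ ≤ β₁) (lam : ℝ) (hlam : 0 < lam)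
    (u v c : ℝ → ℝ) (T : ℝ) (hT : 0 ≤ T) (hu0 : u 0 = 0) (hv0 : v 0 = lam)
    (hu : ContinuousOn u (Set.Icc 0 T)) (hv : ContinuousOn v (Set.Icc 0 T))
    (hd : ∀ r, 0 < r → r < T →
      HasDerivAt u (c r * (v r * (2 * β₂ * (u r) ^ 2 + β₁ * (v r) ^ 2)) - u r / r) r ∧
      HasDerivAt v (c r * (-(u r * (β₁ * (u r) ^ 2 + 2 * β₂ * (v r) ^ 2)))) r) :
    |u T| ≤ lam ∧ |v T| ≤ lam := by
  let H : ℝ → ℝ := fun r => β₁ / 4 * (u r ^ 4 + v r ^ 4) + β₂ * (u r ^ 2 * v r ^ 2)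
  have hanti : AntitoneOn H (Set.Icc 0 T) := by
    have hder : ∀ r ∈ interior (Set.Icc 0 T), HasDerivAt H
        (-(u r ^ 2 * (β₁ * u r ^ 2 + 2 * β₂ * v r ^ 2)) / r) r := by
      intro r hr
      rw [interior_Icc] at hr
      obtain ⟨h1, h2⟩ := hd r hr.1 hr.2
      have := (((h1.pow 4).add (h2.pow 4)).const_mul (β₁ / 4)).add
        (((h1.pow 2).mul (h2.pow 2)).const_mul β₂)
      refine this.congr_deriv ?_
      have : r ≠ 0 := hr.1.ne'
      simp
      field_simp
      ring
    apply antitoneOn_of_hasDerivWithinAt_nonpos (convex_Icc 0 T)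
      (f' := fun r => (-(u r ^ 2 * (β₁ * u r ^ 2 + 2 * β₂ * v r ^ 2)) / r))
    · fun_prop
    · exact fun r hr => (hder r hr).hasDerivWithinAt
    · intro r hr
      rw [interior_Icc] at hr
      have := hr.1
      have hb : 0 < β₁ := by linarith
      rw [neg_div]
      apply neg_nonpos.2
      positivity
  have h := hanti ⟨le_rfl, hT⟩ ⟨hT, le_rfl⟩ hT
  simp only [H, hu0, hv0] at h
  have hb : 0 < β₁ := by linarith
  have h3 : 0 ≤ β₂ * (u T ^ 2 * v T ^ 2) := by positivity
  have h4 : u T ^ 4 + v T ^ 4 ≤ lam ^ 4 := by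
    have : β₁ * (u T ^ 4 + v T ^ 4) ≤ β₁ * lam ^ 4 := by nlinarith
    exact le_of_mul_le_mul_left this hb
  have h5 : 0 ≤ u T ^ 4 := by positivity
  have h6 : 0 ≤ v T ^ 4 := by positivity
  constructor
  · refine abs_le_of_sq_le_sq (abs_le_of_sq_le_sq' ?_ (by positivity)).2 hlam.le
    nlinarith
  · refine abs_le_of_sq_le_sq (abs_le_of_sq_le_sq' ?_ (by positivity)).2 hlam.le
    nlinarith

lemma radial_cont {β₁ β₂ lam : ℝ} {u v : ℝ → ℝ} {R : ℝ≥0∞} (h : IsRadialSol β₁ β₂ lam u v R)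
    (T : ℝ) (hTR : ENNReal.ofReal T < R) :
    ContinuousOn u (Set.Icc 0 T) ∧ ContinuousOn v (Set.Icc 0 T) := by
  have hs : Set.Icc 0 T ⊆ {r : ℝ | 0 ≤ r ∧ ENNReal.ofReal r < R} := fun r hr =>
    ⟨hr.1, (ENNReal.ofReal_le_ofReal hr.2).trans_lt hTR⟩
  exact ⟨h.2.2.1.continuousOn.mono hs, h.2.2.2.1.continuousOn.mono hs⟩

lemma radial_bound {β₁ β₂ : ℝ} (hβ₂ : 0 < β₂) (hββ : β₂ ≤ β₁) {lam : ℝ} (hlam : 0 < lam)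
    {u v : ℝ → ℝ} {R : ℝ≥0∞} (h : IsRadialSol β₁ β₂ lam u v R)
    (T : ℝ) (hT : 0 ≤ T) (hTR : ENNReal.ofReal T < R) : |u T| ≤ lam ∧ |v T| ≤ lam := by
  obtain ⟨cu, cv⟩ := radial_cont h T hTR
  refine energy β₁ β₂ hβ₂ hββ lam hlam u v (fun _ => 1) T hT h.1 h.2.1 cu cv ?_
  intro r h0 hr
  simpa using h.2.2.2.2 r h0 ((ENNReal.ofReal_le_ofReal hr.le).trans_lt hTR)

set_option maxHeartbeats 1000000 in
lemma radial_compare {β₁ β₂ : ℝ} (hβ₂ : 0 < β₂) (hββ : β₂ ≤ β₁) {M : ℝ} (hM : 0 < M) :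
    ∃ K : ℝ, 0 ≤ K ∧ ∀ (lam mu : ℝ) (u v u' v' : ℝ → ℝ) (R R' : ℝ≥0∞), 0 < lam → 0 < mu →
      lam ≤ M → mu ≤ M → IsRadialSol β₁ β₂ lam u v R → IsRadialSol β₁ β₂ mu u' v' R' →
      ∀ T : ℝ, 0 ≤ T → ENNReal.ofReal T < R → ENNReal.ofReal T < R' →
        (u T - u' T) ^ 2 + (v T - v' T) ^ 2 ≤ (lam - mu) ^ 2 * Real.exp (K * T) := by
  obtain ⟨χ, C, B, g₁, g₂, e₁, e₂, hχ, l₁, l₂, -, -⟩ := exG β₁ β₂ M hM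
  refine ⟨4 * C, by positivity, ?_⟩
  intro lam mu u v u' v' R R' hlam hmu hlM hmM h h' T hT hTR hTR'
  obtain ⟨cu, cv⟩ := radial_cont h T hTR
  obtain ⟨cu', cv'⟩ := radial_cont h' T hTR'
  let E : ℝ → ℝ := fun r => ((u r - u' r) ^ 2 + (v r - v' r) ^ 2) * Real.exp (-(4 * C * r))
  have hd : ∀ r, 0 < r → r < T → ∃ d ≤ 0, HasDerivAt E d r := by
    intro r h0 hr
    have hrR := (ENNReal.ofReal_le_ofReal hr.le).trans_lt hTR
    have hrR' := (ENNReal.ofReal_le_ofReal hr.le).trans_lt hTR'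
    obtain ⟨d1, d2⟩ := h.2.2.2.2 r h0 hrR
    obtain ⟨d1', d2'⟩ := h'.2.2.2.2 r h0 hrR'
    obtain ⟨b1, b2⟩ := radial_bound hβ₂ hββ hlam h r h0.le hrR
    obtain ⟨b1', b2'⟩ := radial_bound hβ₂ hββ hmu h' r h0.le hrR'
    have k1 := hχ (u r, v r) (b1.trans hlM) (b2.trans hlM)
    have k2 := hχ (u' r, v' r) (b1'.trans hmM) (b2'.trans hmM)
    have q1 := e₁ (u r, v r)
    have q2 := e₂ (u r, v r)
    have q1' := e₁ (u' r, v' r)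
    have q2' := e₂ (u' r, v' r)
    simp only [k1, k2, one_mul] at q1 q2 q1' q2'
    rw [← q1] at d1
    rw [← q2] at d2
    rw [← q1'] at d1'
    rw [← q2'] at d2'
    have n1 := l₁.dist_le_mul (u r, v r) (u' r, v' r)
    have n2 := l₂.dist_le_mul (u r, v r) (u' r, v' r)
    rw [Prod.dist_eq, Real.dist_eq, Real.dist_eq, Real.dist_eq] at n1 n2
    simp only at n1 n2
    have D := (((d1.sub d1').pow 2).add ((d2.sub d2').pow 2)).mul
      ((((hasDerivAt_id r).const_mul (4 * (C : ℝ))).neg).exp)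
    refine ⟨_, ?_, D⟩
    generalize g₁ (u r, v r) = G1 at *
    generalize g₂ (u r, v r) = G2 at *
    generalize g₁ (u' r, v' r) = G1' at *
    generalize g₂ (u' r, v' r) = G2' at *
    simp only [Pi.sub_apply, Pi.pow_apply, Pi.add_apply, Pi.neg_apply, id]
    have hC : (0 : ℝ) ≤ C := C.2
    obtain ⟨a, ha⟩ : ∃ a, a = u r - u' r := ⟨_, rfl⟩
    obtain ⟨b, hb⟩ : ∃ b, b = v r - v' r := ⟨_, rfl⟩
    have main : 2 * a * (G1 - G1' - a / r) + 2 * b * (G2 - G2')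
        ≤ 4 * C * (a ^ 2 + b ^ 2) := by
      rw [← ha, ← hb] at n1 n2
      have m : max |a| |b| ≤ |a| + |b| := max_le (by simp) (by simp)
      have n1' : |G1 - G1'| ≤ C * (|a| + |b|) := n1.trans (by gcongr)
      have n2' : |G2 - G2'| ≤ C * (|a| + |b|) := n2.trans (by gcongr)
      have p1 : a * (G1 - G1') ≤ |a| * (C * (|a| + |b|)) := by
        calc _ ≤ |a * (G1 - G1')| := le_abs_self _
          _ = |a| * |G1 - G1'| := abs_mul _ _
          _ ≤ _ := by gcongr
      have p2 : b * (G2 - G2') ≤ |b| * (C * (|a| + |b|)) := by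
        calc _ ≤ |b * (G2 - G2')| := le_abs_self _
          _ = |b| * |G2 - G2'| := abs_mul _ _
          _ ≤ _ := by gcongr
      have p3 : 0 ≤ a * (a / r) := by rw [← mul_div_assoc]; have := mul_self_nonneg a; positivity
      have p4 : (C : ℝ) * (|a| + |b|) ^ 2 ≤ C * (2 * (a ^ 2 + b ^ 2)) := by
        gcongr
        nlinarith [sq_nonneg (|a| - |b|), sq_abs a, sq_abs b]
      calc _ = 2 * (a * (G1 - G1')) + 2 * (b * (G2 - G2')) - 2 * (a * (a / r)) := by ring
        _ ≤ 2 * (|a| * (C * (|a| + |b|))) + 2 * (|b| * (C * (|a| + |b|))) := by linarith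
        _ = 2 * (C * (|a| + |b|) ^ 2) := by ring
        _ ≤ 2 * (C * (2 * (a ^ 2 + b ^ 2))) := by linarith
        _ = _ := by ring
    have hexp := Real.exp_pos (-(4 * (C : ℝ) * r))
    have : (2 * a * (G1 - G1' - a / r) + 2 * b * (G2 - G2') - 4 * C * (a ^ 2 + b ^ 2))
        * Real.exp (-(4 * (C : ℝ) * r)) ≤ 0 := mul_nonpos_of_nonpos_of_nonneg (by linarith) hexp.le
    refine le_of_eq_of_le ?_ this
    rw [ha, hb]
    simp
    ring
  have hanti : AntitoneOn E (Set.Icc 0 T) := by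
    apply antitoneOn_of_deriv_nonpos (convex_Icc 0 T)
    · fun_prop
    · intro r hr
      rw [interior_Icc] at hr
      obtain ⟨d, _, hd⟩ := hd r hr.1 hr.2
      exact hd.differentiableAt.differentiableWithinAt
    · intro r hr
      rw [interior_Icc] at hr
      obtain ⟨d, hd0, hd⟩ := hd r hr.1 hr.2
      rw [hd.deriv]; exact hd0
  have := hanti ⟨le_rfl, hT⟩ ⟨hT, le_rfl⟩ hT
  simp only [E, h.1, h'.1, h.2.1, h'.2.1] at this
  rw [Real.exp_neg, ← div_eq_mul_inv, div_le_iff₀ (Real.exp_pos _)] at this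
  simpa using this

lemma int_bound (κ D r : ℝ) (hκ : 0 < κ) (hD : 0 ≤ D) (h : ℝ → ℝ)
    (hb : ∀ t ∈ Set.Icc (0 : ℝ) 1, |h t| ≤ D * Real.exp (κ * |r| * t)) :
    |r * ∫ t in (0 : ℝ)..1, h t| ≤ D / κ * Real.exp (κ * |r|) := by
  have h1 : |∫ t in (0 : ℝ)..1, h t| ≤ ∫ t in (0 : ℝ)..1, D * Real.exp (κ * |r| * t) := by
    rw [← Real.norm_eq_abs]
    apply intervalIntegral.norm_integral_le_of_norm_le zero_le_one
    · exact Filter.Eventually.of_forall fun t ht => hb t ⟨ht.1.le, ht.2⟩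
    · exact Continuous.intervalIntegrable (by fun_prop) _ _
  have h2 : ∫ t in (0 : ℝ)..1, (D / κ * (Real.exp (κ * |r| * t) * (κ * |r|)))
      = D / κ * Real.exp (κ * |r| * 1) - D / κ * Real.exp (κ * |r| * 0) := by
    apply intervalIntegral.integral_eq_sub_of_hasDerivAt
      (f := fun t => D / κ * Real.exp (κ * |r| * t))
    · intro t _
      have := (((hasDerivAt_id t).const_mul (κ * |r|)).exp).const_mul (D / κ)
      simpa using this
    · exact Continuous.intervalIntegrable (by fun_prop) _ _
  rw [abs_mul]
  calc _ ≤ |r| * ∫ t in (0 : ℝ)..1, D * Real.exp (κ * |r| * t) := by gcongr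
    _ = ∫ t in (0 : ℝ)..1, (D / κ * (Real.exp (κ * |r| * t) * (κ * |r|))) := by
      rw [← intervalIntegral.integral_const_mul]
      congr 1; ext t; field_simp
    _ ≤ _ := by
      rw [h2]; simp; positivity

lemma cont_aux (k : ℝ → ℝ → ℝ) (hk : Continuous (Function.uncurry k)) :
    Continuous fun r => ∫ t in (0 : ℝ)..1, k r t :=
  intervalIntegral.continuous_parametric_intervalIntegral_of_continuous' hk 0 1

lemma fixpt (C : NNReal) (B : ℝ) (g₁ g₂ : ℝ × ℝ → ℝ) (l₁ : LipschitzWith C g₁)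
    (l₂ : LipschitzWith C g₂) (b₁ : ∀ p, |g₁ p| ≤ B) (b₂ : ∀ p, |g₂ p| ≤ B) (lam : ℝ) :
    ∃ u v : ℝ → ℝ, Continuous u ∧ Continuous v ∧
      (∀ r, u r = r * ∫ t in (0 : ℝ)..1, t * g₁ (u (r * t), v (r * t))) ∧
      (∀ r, v r = lam + r * ∫ t in (0 : ℝ)..1, g₂ (u (r * t), v (r * t))) := by
  let κ : ℝ := 2 * C + 1
  have hC : (0 : ℝ) ≤ C := C.2
  have hκ : 0 < κ := by positivity
  have hB : 0 ≤ B := (abs_nonneg _).trans (b₁ 0)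
  have cg₁ := l₁.continuous
  have cg₂ := l₂.continuous
  let Y : (BoundedContinuousFunction ℝ (ℝ × ℝ)) → ℝ → ℝ × ℝ :=
    fun w r => Real.exp (κ * |r|) • w r
  have cY : ∀ w, Continuous (Y w) := fun w => by
    have := w.continuous
    fun_prop
  let A₁ : (BoundedContinuousFunction ℝ (ℝ × ℝ)) → ℝ → ℝ :=
    fun w r => r * ∫ t in (0 : ℝ)..1, t * g₁ (Y w (r * t))
  let A₂ : (BoundedContinuousFunction ℝ (ℝ × ℝ)) → ℝ → ℝ :=
    fun w r => lam + r * ∫ t in (0 : ℝ)..1, g₂ (Y w (r * t))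
  have cA₁ : ∀ w, Continuous (A₁ w) := fun w => by
    have := cY w
    exact continuous_id.mul (cont_aux (fun r t => t * g₁ (Y w (r * t)))
      (by unfold Function.uncurry; fun_prop))
  have cA₂ : ∀ w, Continuous (A₂ w) := fun w => by
    have := cY w
    exact continuous_const.add (continuous_id.mul (cont_aux (fun r t => g₂ (Y w (r * t)))
      (by unfold Function.uncurry; fun_prop)))
  have bd : ∀ w r, ‖Real.exp (-(κ * |r|)) • ((A₁ w r, A₂ w r) : ℝ × ℝ)‖ ≤ |lam| + B / κ := by
    intro w r
    have hE : Real.exp (-(κ * |r|)) * Real.exp (κ * |r|) = 1 := by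
      rw [← Real.exp_add]; simp
    have hE1 : 1 ≤ Real.exp (κ * |r|) := Real.one_le_exp (by positivity)
    have hone : ∀ t ∈ Set.Icc (0 : ℝ) 1, 1 ≤ Real.exp (κ * |r| * t) := fun t ht =>
      Real.one_le_exp (mul_nonneg (by positivity) ht.1)
    have a1 : |A₁ w r| ≤ B / κ * Real.exp (κ * |r|) := by
      apply int_bound κ B r hκ hB
      intro t ht
      rw [abs_mul, abs_of_nonneg ht.1]
      have := b₁ (Y w (r * t))
      have := hone t ht
      calc _ ≤ 1 * |g₁ (Y w (r * t))| := by gcongr; exact ht.2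
        _ ≤ B * 1 := by linarith
        _ ≤ _ := by gcongr
    have a2 : |A₂ w r - lam| ≤ B / κ * Real.exp (κ * |r|) := by
      simp only [A₂, add_sub_cancel_left]
      apply int_bound κ B r hκ hB
      intro t ht
      have := hone t ht
      calc _ ≤ B * 1 := by linarith [b₂ (Y w (r * t))]
        _ ≤ _ := by gcongr
    have a2' : |A₂ w r| ≤ (|lam| + B / κ) * Real.exp (κ * |r|) := by
      have := abs_add_le (A₂ w r - lam) lam
      rw [sub_add_cancel] at this
      nlinarith [abs_nonneg lam]
    have a1' : |A₁ w r| ≤ (|lam| + B / κ) * Real.exp (κ * |r|) := by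
      nlinarith [abs_nonneg lam]
    rw [norm_smul, Real.norm_of_nonneg (Real.exp_pos _).le, Prod.norm_def]
    calc _ ≤ Real.exp (-(κ * |r|)) * ((|lam| + B / κ) * Real.exp (κ * |r|)) := by
          gcongr; exact max_le a1' a2'
      _ = (|lam| + B / κ) * (Real.exp (-(κ * |r|)) * Real.exp (κ * |r|)) := by ring
      _ = _ := by rw [hE, mul_one]
  let Φ : (BoundedContinuousFunction ℝ (ℝ × ℝ)) → (BoundedContinuousFunction ℝ (ℝ × ℝ)) :=
    fun w => BoundedContinuousFunction.ofNormedAddCommGroup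
      (fun r => Real.exp (-(κ * |r|)) • ((A₁ w r, A₂ w r) : ℝ × ℝ))
      (by have := cA₁ w; have := cA₂ w; fun_prop) (|lam| + B / κ) (bd w)
  have hΦ : ∀ w r, Φ w r = Real.exp (-(κ * |r|)) • ((A₁ w r, A₂ w r) : ℝ × ℝ) := fun w r => rfl
  have contr : ContractingWith (1 / 2) Φ := by
    refine ⟨by rw [← NNReal.coe_lt_coe]; norm_num, ?_⟩
    apply LipschitzWith.of_dist_le_mul
    intro w w'
    rw [BoundedContinuousFunction.dist_le (by positivity)]
    intro r
    have hE : Real.exp (-(κ * |r|)) * Real.exp (κ * |r|) = 1 := by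
      rw [← Real.exp_add]; simp
    have hY : ∀ t ∈ Set.Icc (0 : ℝ) 1, C * dist (Y w (r * t)) (Y w' (r * t)) ≤
        C * dist w w' * Real.exp (κ * |r| * t) := by
      intro t ht
      have : dist (Y w (r * t)) (Y w' (r * t)) =
          Real.exp (κ * |r| * t) * dist (w (r * t)) (w' (r * t)) := by
        simp only [Y]
        rw [dist_smul₀, Real.norm_of_nonneg (Real.exp_pos _).le, abs_mul, abs_of_nonneg ht.1,
          mul_assoc]
      rw [this]
      have := BoundedContinuousFunction.dist_coe_le_dist (f := w) (g := w') (r * t)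
      calc _ ≤ (C : ℝ) * (Real.exp (κ * |r| * t) * dist w w') := by gcongr
        _ = _ := by ring
    have a1 : |A₁ w r - A₁ w' r| ≤ C * dist w w' / κ * Real.exp (κ * |r|) := by
      have c1 := cY w
      have c2 := cY w'
      simp only [A₁]
      rw [← mul_sub, ← intervalIntegral.integral_sub
        (Continuous.intervalIntegrable (by fun_prop) _ _)
        (Continuous.intervalIntegrable (by fun_prop) _ _)]
      apply int_bound κ _ r hκ (by positivity)
      intro t ht
      rw [← mul_sub, abs_mul, abs_of_nonneg ht.1]
      have := l₁.dist_le_mul (Y w (r * t)) (Y w' (r * t))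
      rw [Real.dist_eq] at this
      calc _ ≤ 1 * |g₁ (Y w (r * t)) - g₁ (Y w' (r * t))| := by gcongr; exact ht.2
        _ ≤ _ := by rw [one_mul]; exact this.trans (hY t ht)
    have a2 : |A₂ w r - A₂ w' r| ≤ C * dist w w' / κ * Real.exp (κ * |r|) := by
      have c1 := cY w
      have c2 := cY w'
      simp only [A₂]
      rw [add_sub_add_left_eq_sub, ← mul_sub, ← intervalIntegral.integral_sub
        (Continuous.intervalIntegrable (by fun_prop) _ _)
        (Continuous.intervalIntegrable (by fun_prop) _ _)]
      apply int_bound κ _ r hκ (by positivity)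
      intro t ht
      have := l₂.dist_le_mul (Y w (r * t)) (Y w' (r * t))
      rw [Real.dist_eq] at this
      exact this.trans (hY t ht)
    rw [hΦ, hΦ, dist_smul₀, Real.norm_of_nonneg (Real.exp_pos _).le, Prod.dist_eq]
    calc _ ≤ Real.exp (-(κ * |r|)) * (C * dist w w' / κ * Real.exp (κ * |r|)) := by
          gcongr; exact max_le a1 a2
      _ = C / κ * dist w w' * (Real.exp (-(κ * |r|)) * Real.exp (κ * |r|)) := by ring
      _ = C / κ * dist w w' := by rw [hE, mul_one]
      _ ≤ _ := by
        gcongr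
        rw [div_le_iff₀ hκ]
        simp [κ]
        linarith
  obtain ⟨w, hw⟩ : ∃ w, Φ w = w := ⟨_, contr.fixedPoint_isFixedPt⟩
  have hYw : ∀ r, Y w r = (A₁ w r, A₂ w r) := by
    intro r
    have : w r = Real.exp (-(κ * |r|)) • ((A₁ w r, A₂ w r) : ℝ × ℝ) := by
      rw [← hΦ, hw]
    simp only [Y]
    rw [this, smul_smul, ← Real.exp_add]
    simp
  refine ⟨A₁ w, A₂ w, cA₁ w, cA₂ w, fun r => ?_, fun r => ?_⟩
  · simp only [← hYw]; rfl
  · simp only [← hYw]; rfl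

/-- derivative of `r ↦ r ∫₀¹ t g(rt) dt` -/
lemma deriv_u (g u : ℝ → ℝ) (hg : Continuous g)
    (hu : ∀ r, u r = r * ∫ t in (0 : ℝ)..1, t * g (r * t)) (r : ℝ) :
    HasDerivAt u (g r - ∫ t in (0 : ℝ)..1, t * g (r * t)) r := by
  have hA : Continuous fun r => ∫ t in (0 : ℝ)..1, t * g (r * t) :=
    cont_aux (fun r t => t * g (r * t)) (by unfold Function.uncurry; fun_prop)
  by_cases hr : r = 0
  · subst hr
    have h0 : g 0 - ∫ t in (0 : ℝ)..1, t * g (0 * t) = ∫ t in (0 : ℝ)..1, t * g (0 * t) := by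
      simp
      ring
    rw [h0, hasDerivAt_iff_tendsto_slope]
    have : Filter.Tendsto (fun r => ∫ t in (0 : ℝ)..1, t * g (r * t)) (nhdsWithin 0 {0}ᶜ)
      (nhds (∫ t in (0 : ℝ)..1, t * g (0 * t))) := (hA.tendsto 0).mono_left nhdsWithin_le_nhds
    refine this.congr' ?_
    filter_upwards [self_mem_nhdsWithin] with x hx
    have hx : x ≠ 0 := hx
    rw [slope_def_field, hu x, hu 0, zero_mul, sub_zero, sub_zero, mul_div_cancel_left₀ _ hx]
  · have e : ∀ x, x ≠ 0 → u x = (∫ s in (0 : ℝ)..x, s * g s) / x := by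
      intro x hx
      have := intervalIntegral.mul_integral_comp_mul_left (a := 0) (b := 1)
        (f := fun s => s * g s) x
      simp only [mul_zero, mul_one] at this
      rw [← this, hu x, mul_div_assoc, ← intervalIntegral.integral_div]
      congr 2
      ext t
      field_simp
    have h1 : HasDerivAt (fun x => ∫ s in (0 : ℝ)..x, s * g s) (r * g r) r := by
      have hc : Continuous fun s => s * g s := by fun_prop
      exact intervalIntegral.integral_hasDerivAt_right (hc.intervalIntegrable _ _)
          (hc.stronglyMeasurableAtFilter _ _) hc.continuousAt
    have h2 := (h1.div (hasDerivAt_id r) hr).congr_of_eventuallyEq (f₁ := u)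
      (by filter_upwards [isOpen_ne.mem_nhds hr] with x hx using e x hx)
    refine h2.congr_deriv ?_
    have h3 : (∫ s in (0 : ℝ)..r, s * g s) = r * (r * ∫ t in (0 : ℝ)..1, t * g (r * t)) := by
      rw [← hu r, e r hr]; field_simp
    simp only [id]
    rw [h3]
    field_simp

lemma deriv_v (g v : ℝ → ℝ) (hg : Continuous g) (lam : ℝ)
    (hv : ∀ r, v r = lam + r * ∫ t in (0 : ℝ)..1, g (r * t)) (r : ℝ) :
    HasDerivAt v (g r) r := by
  have e : v = fun x => lam + ∫ s in (0 : ℝ)..x, g s := by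
    ext x
    have := intervalIntegral.mul_integral_comp_mul_left (a := 0) (b := 1) (f := g) x
    simp only [mul_zero, mul_one] at this
    rw [hv x, this]
  rw [e]
  exact ((intervalIntegral.integral_hasDerivAt_right (hg.intervalIntegrable _ _)
          (hg.stronglyMeasurableAtFilter _ _) hg.continuousAt)).const_add lam

lemma global_sol (β₁ β₂ : ℝ) (hβ₂ : 0 < β₂) (hββ : β₂ ≤ β₁)
    (lam : ℝ) (hlam : 0 < lam) : ∃ u v : ℝ → ℝ, IsRadialSol β₁ β₂ lam u v ⊤ := by
  obtain ⟨χ, C, B, g₁, g₂, e₁, e₂, hχ, l₁, l₂, b₁, b₂⟩ := exG β₁ β₂ lam hlam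
  obtain ⟨u, v, cu, cv, hu, hv⟩ := fixpt C B g₁ g₂ l₁ l₂ b₁ b₂ lam
  have cg₁ : Continuous fun r => g₁ (u r, v r) := l₁.continuous.comp (cu.prodMk cv)
  have cg₂ : Continuous fun r => g₂ (u r, v r) := l₂.continuous.comp (cu.prodMk cv)
  have du := deriv_u _ u cg₁ hu
  have dv := deriv_v _ v cg₂ lam hv
  have cdu : ContDiff ℝ 1 u := by
    rw [contDiff_one_iff_deriv]
    refine ⟨fun r => (du r).differentiableAt, ?_⟩
    rw [show deriv u = _ from funext fun r => (du r).deriv]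
    exact cg₁.sub (cont_aux (fun r t => t * g₁ (u (r * t), v (r * t)))
      (by
        have : Continuous fun p : ℝ × ℝ => g₁ (u (p.1 * p.2), v (p.1 * p.2)) :=
          cg₁.comp (continuous_fst.mul continuous_snd)
        exact continuous_snd.mul this))
  have cdv : ContDiff ℝ 1 v := by
    rw [contDiff_one_iff_deriv]
    refine ⟨fun r => (dv r).differentiableAt, ?_⟩
    rw [show deriv v = _ from funext fun r => (dv r).deriv]
    exact cg₂
  have hu0 : u 0 = 0 := by rw [hu]; simp
  have hv0 : v 0 = lam := by rw [hv]; simp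
  have du' : ∀ r, 0 < r → HasDerivAt u (g₁ (u r, v r) - u r / r) r := by
    intro r hr
    refine (du r).congr_deriv ?_
    congr 1
    rw [eq_div_iff hr.ne', mul_comm, ← hu r]
  refine ⟨u, v, hu0, hv0, cdu.contDiffOn, cdv.contDiffOn, ?_⟩
  intro r hr _
  have hb := energy β₁ β₂ hβ₂ hββ lam hlam u v (fun r => χ (u r, v r)) r hr.le hu0 hv0
    cu.continuousOn cv.continuousOn (by
      intro s hs _
      have h1 := du' s hs
      have h2 := dv s
      rw [e₁] at h1
      rw [e₂] at h2
      exact ⟨h1, h2⟩)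
  have hc := hχ (u r, v r) hb.1 hb.2
  have h1 := du' r hr
  have h2 := dv r
  rw [e₁, hc, one_mul] at h1
  rw [e₂, hc, one_mul] at h2
  exact ⟨h1, h2⟩


/-- for `0 < β₂ ≤ β₁` and `λ > 0` there exist `R ∈ (0, +∞]` and a unique
maximal `C¹` solution `(u,v)` of the radial Cauchy problem on `[0, R)`; moreover the
solution depends continuously on `λ`, uniformly on every compact interval `[0, R']`
with `R' < R`. -/
theorem exists_unique_maximal_solution (β₁ β₂ : ℝ) (hβ₂ : 0 < β₂) (hββ : β₂ ≤ β₁)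
    (lam : ℝ) (hlam : 0 < lam) :
    ∃ R : ℝ≥0∞, 0 < R ∧ ∃ u v : ℝ → ℝ,
      IsRadialSol β₁ β₂ lam u v R ∧
      -- maximality (hence uniqueness): any solution is a restriction of `(u, v)`
      (∀ (R' : ℝ≥0∞) (u' v' : ℝ → ℝ), IsRadialSol β₁ β₂ lam u' v' R' →
        R' ≤ R ∧ ∀ r : ℝ, 0 ≤ r → ENNReal.ofReal r < R' → u' r = u r ∧ v' r = v r) ∧
      -- continuous dependence on `λ`, uniformly on every compact `[0, R'] ⊆ [0, R)`
      (∀ R' : ℝ, 0 < R' → ENNReal.ofReal R' < R → ∀ ε : ℝ, 0 < ε → ∃ δ : ℝ, 0 < δ ∧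
        ∀ μ : ℝ, 0 < μ → |μ - lam| < δ →
          ∃ (Rμ : ℝ≥0∞) (uμ vμ : ℝ → ℝ), IsRadialSol β₁ β₂ μ uμ vμ Rμ ∧
            ENNReal.ofReal R' < Rμ ∧
            ∀ r ∈ Set.Icc (0 : ℝ) R', |uμ r - u r| < ε ∧ |vμ r - v r| < ε) := by
  obtain ⟨u, v, h⟩ := global_sol β₁ β₂ hβ₂ hββ lam hlam
  refine ⟨⊤, by simp, u, v, h, ?_, ?_⟩
  · intro R' u' v' h'
    refine ⟨le_top, fun r hr hrR => ?_⟩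
    obtain ⟨K, -, hK⟩ := radial_compare hβ₂ hββ hlam
    have := hK lam lam u' v' u v R' ⊤ hlam hlam le_rfl le_rfl h' h r hr hrR (by simp)
    simp only [sub_self] at this
    have h1 := sq_nonneg (u' r - u r)
    have h2 := sq_nonneg (v' r - v r)
    constructor
    · have : (u' r - u r) ^ 2 = 0 := by linarith
      exact sub_eq_zero.1 (pow_eq_zero_iff (by norm_num) |>.1 this)
    · have : (v' r - v r) ^ 2 = 0 := by linarith
      exact sub_eq_zero.1 (pow_eq_zero_iff (by norm_num) |>.1 this)
  · intro R' hR' _ ε hε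
    obtain ⟨K, hK0, hK⟩ := radial_compare hβ₂ hββ (M := lam + 1) (by linarith)
    have hX : 0 < Real.exp (K * R') := Real.exp_pos _
    have hX1 : 1 ≤ Real.exp (K * R') := Real.one_le_exp (by positivity)
    refine ⟨min 1 (ε / Real.exp (K * R')), by positivity, ?_⟩
    intro μ hμ hμl
    obtain ⟨hμ1, hμ2⟩ := lt_min_iff.1 hμl
    obtain ⟨u', v', h'⟩ := global_sol β₁ β₂ hβ₂ hββ μ hμ
    refine ⟨⊤, u', v', h', by simp, ?_⟩
    intro r hr
    have := hK μ lam u' v' u v ⊤ ⊤ hμ hlam (by linarith [(abs_lt.1 hμ1).2]) (by linarith) h' h r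
      hr.1 (by simp) (by simp)
    have hle : Real.exp (K * r) ≤ Real.exp (K * R') :=
      Real.exp_le_exp.2 (mul_le_mul_of_nonneg_left hr.2 hK0)
    have hlt : (μ - lam) ^ 2 * Real.exp (K * r) < ε ^ 2 := by
      rw [lt_div_iff₀ hX] at hμ2
      calc (μ - lam) ^ 2 * Real.exp (K * r) ≤ (μ - lam) ^ 2 * (Real.exp (K * R')) ^ 2 := by
            gcongr
            nlinarith
        _ = (|μ - lam| * Real.exp (K * R')) ^ 2 := by rw [mul_pow, sq_abs]
        _ < ε ^ 2 := by gcongr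
    have h1 := sq_nonneg (u' r - u r)
    have h2 := sq_nonneg (v' r - v r)
    exact ⟨abs_lt_of_sq_lt_sq (by linarith) hε.le, abs_lt_of_sq_lt_sq (by linarith) hε.le⟩
end

section
/- Let 0 < β₂ ≤ β₁ and λ > 0. Then there exists a unique global solution (u, v) ∈ C^∞([0, +∞), ℝ²) of the Cauchy problem u'(r) + u(r)/r = v(r)(2β₂ u² + β₁ v²), v'(r) = −u(r)(β₁ u² + 2β₂ v²), u(0) = 0, v(0) = λ. Moreover u(r) > 0 and v(r) > 0 for all r > 0, and there exist positive constants c₁, C₁, c₂, C₂ and R > 0 such that c₁/r ≤ u(r) ≤ C₁/r and c₂/r² ≤ v(r) ≤ C₂/r² for all r ≥ R. -/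
theorem aux_uniq (β₁ β₂ : ℝ) (u v U V : ℝ → ℝ) (h0 : U 0 = u 0) (h0' : V 0 = v 0)
    (hu : ContinuousOn u (Set.Ici 0)) (hv : ContinuousOn v (Set.Ici 0))
    (hU : ContinuousOn U (Set.Ici 0)) (hV : ContinuousOn V (Set.Ici 0))
    (h : ∀ r : ℝ, 0 < r →
          HasDerivAt u (v r * (2 * β₂ * (u r) ^ 2 + β₁ * (v r) ^ 2) - u r / r) r ∧
          HasDerivAt v (-(u r * (β₁ * (u r) ^ 2 + 2 * β₂ * (v r) ^ 2))) r)
    (H : ∀ r : ℝ, 0 < r →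
          HasDerivAt U (V r * (2 * β₂ * (U r) ^ 2 + β₁ * (V r) ^ 2) - U r / r) r ∧
          HasDerivAt V (-(U r * (β₁ * (U r) ^ 2 + 2 * β₂ * (V r) ^ 2))) r)
    (R : ℝ) (hR : 0 ≤ R) : U R = u R ∧ V R = v R := by
  have hsub : Set.Icc 0 R ⊆ Set.Ici (0:ℝ) := Set.Icc_subset_Ici_self
  replace hu := hu.mono hsub
  replace hv := hv.mono hsub
  replace hU := hU.mono hsub
  replace hV := hV.mono hsub
  have hk : ContinuousOn (fun r => 2 * |2 * β₂ * (v r * (U r + u r))|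
      + |2 * β₂ * (U r)^2 + β₁ * ((V r)^2 + V r * v r + (v r)^2)|
      + |β₁ * ((U r)^2 + U r * u r + (u r)^2) + 2 * β₂ * (V r)^2|
      + 2 * |2 * β₂ * (u r * (V r + v r))|) (Set.Icc 0 R) := by fun_prop
  obtain ⟨K, hK⟩ := isCompact_Icc.exists_bound_of_continuousOn hk
  have hanti : AntitoneOn (fun r => Real.exp (-(K * r)) * ((U r - u r)^2 + (V r - v r)^2))
      (Set.Icc 0 R) := by
    have hd : ∀ r ∈ interior (Set.Icc 0 R), HasDerivAt
        (fun r => Real.exp (-(K * r)) * ((U r - u r)^2 + (V r - v r)^2))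
        (Real.exp (-(K * r)) * (-K * ((U r - u r)^2 + (V r - v r)^2)
          + (2 * (U r - u r) * ((V r * (2 * β₂ * (U r) ^ 2 + β₁ * (V r) ^ 2) - U r / r)
              - (v r * (2 * β₂ * (u r) ^ 2 + β₁ * (v r) ^ 2) - u r / r))
            + 2 * (V r - v r) * ((-(U r * (β₁ * (U r) ^ 2 + 2 * β₂ * (V r) ^ 2)))
              - (-(u r * (β₁ * (u r) ^ 2 + 2 * β₂ * (v r) ^ 2))))))) r := by
      intro r hr
      rw [interior_Icc] at hr
      obtain ⟨a, b⟩ := h r hr.1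
      obtain ⟨A, B⟩ := H r hr.1
      have e : HasDerivAt (fun r => Real.exp (-(K * r))) (Real.exp (-(K * r)) * (-(K * 1))) r :=
        (((hasDerivAt_id r).const_mul K).neg).exp
      refine (e.mul (((A.sub a).pow 2).add ((B.sub b).pow 2))).congr_deriv ?_
      simp
      ring
    apply antitoneOn_of_hasDerivWithinAt_nonpos (convex_Icc 0 R)
      (by fun_prop) (fun r hr => (hd r hr).hasDerivWithinAt)
    intro r hr
    rw [interior_Icc] at hr
    have hb := (le_abs_self _).trans (hK r ⟨hr.1.le, hr.2.le⟩)
    have hr0 := hr.1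
    apply mul_nonpos_of_nonneg_of_nonpos (Real.exp_pos _).le
    generalize U r = x at *
    generalize V r = y at *
    generalize u r = z at *
    generalize v r = w at *
    have key : 2 * (x - z) * ((y * (2 * β₂ * x ^ 2 + β₁ * y ^ 2) - x / r)
              - (w * (2 * β₂ * z ^ 2 + β₁ * w ^ 2) - z / r))
            + 2 * (y - w) * ((-(x * (β₁ * x ^ 2 + 2 * β₂ * y ^ 2)))
              - (-(z * (β₁ * z ^ 2 + 2 * β₂ * w ^ 2)))) =
        2 * (x - z) * ((2 * β₂ * (w * (x + z))) * (x - z)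
            + (2 * β₂ * x^2 + β₁ * (y^2 + y * w + w^2)) * (y - w))
          - 2 * (y - w) * ((β₁ * (x^2 + x * z + z^2) + 2 * β₂ * y^2) * (x - z)
            + (2 * β₂ * (z * (y + w))) * (y - w)) - 2 * ((x - z)^2 / r) := by ring
    rw [key]
    have hn : 0 ≤ (x - z)^2 / r := by positivity
    generalize (x - z)^2 / r = n at *
    generalize 2 * β₂ * (w * (x + z)) = p at *
    generalize 2 * β₂ * x^2 + β₁ * (y^2 + y * w + w^2) = q at *
    generalize β₁ * (x^2 + x * z + z^2) + 2 * β₂ * y^2 = s at *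
    generalize 2 * β₂ * (z * (y + w)) = t at *
    generalize x - z = a at *
    generalize y - w = b at *
    have h1 : p * a^2 ≤ |p| * a^2 := mul_le_mul_of_nonneg_right (le_abs_self p) (sq_nonneg a)
    have h4 : -t * b^2 ≤ |t| * b^2 := mul_le_mul_of_nonneg_right (neg_le_abs t) (sq_nonneg b)
    have hab : |2 * a * b| ≤ a^2 + b^2 := by
      rw [abs_le]; constructor <;> nlinarith [sq_nonneg (a+b), sq_nonneg (a-b)]
    have h2 : q * (2 * a * b) ≤ |q| * (a^2 + b^2) :=
      (le_abs_self _).trans (by rw [abs_mul]; exact mul_le_mul_of_nonneg_left hab (abs_nonneg _))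
    have h3 : -(s * (2 * a * b)) ≤ |s| * (a^2 + b^2) :=
      (neg_le_abs _).trans (by rw [abs_mul]; exact mul_le_mul_of_nonneg_left hab (abs_nonneg _))
    have h5 := mul_le_mul_of_nonneg_right hb (add_nonneg (sq_nonneg a) (sq_nonneg b))
    have h6 := mul_nonneg (abs_nonneg p) (sq_nonneg b)
    have h7 := mul_nonneg (abs_nonneg t) (sq_nonneg a)
    linarith
  have := hanti (Set.left_mem_Icc.2 hR) (Set.right_mem_Icc.2 hR) hR
  simp only [h0, h0', sub_self] at this
  have h2 : (U R - u R)^2 + (V R - v R)^2 ≤ 0 := by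
    by_contra hc
    push Not at hc
    have := mul_pos (Real.exp_pos (-(K * R))) hc
    norm_num at *
    linarith
  constructor <;> nlinarith [sq_nonneg (U R - u R), sq_nonneg (V R - v R)]

/-- for `0 < β₂ ≤ β₁`, `λ > 0`, there exists a unique global smooth
solution `(u,v) ∈ C^∞([0,∞), ℝ²)` of the radial Cauchy problem
`u' + u/r = v(2β₂u² + β₁v²)`, `v' = −u(β₁u² + 2β₂v²)`, `u(0) = 0`, `v(0) = λ`;
moreover `u, v > 0` on `(0,∞)` and `u(r) ≍ 1/r`, `v(r) ≍ 1/r²` as `r → +∞`. -/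
theorem global_solution_asymptotics (β₁ β₂ lam : ℝ) (hβ₂ : 0 < β₂) (hββ : β₂ ≤ β₁)
    (hlam : 0 < lam) :
    ∃ u v : ℝ → ℝ,
      (u 0 = 0 ∧ v 0 = lam ∧
        ContDiffOn ℝ (⊤ : ℕ∞) u (Set.Ici 0) ∧ ContDiffOn ℝ (⊤ : ℕ∞) v (Set.Ici 0) ∧
        ∀ r : ℝ, 0 < r →
          HasDerivAt u (v r * (2 * β₂ * (u r) ^ 2 + β₁ * (v r) ^ 2) - u r / r) r ∧
          HasDerivAt v (-(u r * (β₁ * (u r) ^ 2 + 2 * β₂ * (v r) ^ 2))) r) ∧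
      (∀ r : ℝ, 0 < r → 0 < u r ∧ 0 < v r) ∧
      (∃ c₁ C₁ c₂ C₂ R : ℝ, 0 < c₁ ∧ 0 < C₁ ∧ 0 < c₂ ∧ 0 < C₂ ∧ 0 < R ∧
        ∀ r : ℝ, R ≤ r →
          c₁ / r ≤ u r ∧ u r ≤ C₁ / r ∧ c₂ / r ^ 2 ≤ v r ∧ v r ≤ C₂ / r ^ 2) ∧
      -- uniqueness: any other smooth global solution agrees with `(u, v)` on `[0, ∞)`
      (∀ u' v' : ℝ → ℝ,
        (u' 0 = 0 ∧ v' 0 = lam ∧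
          ContDiffOn ℝ (⊤ : ℕ∞) u' (Set.Ici 0) ∧ ContDiffOn ℝ (⊤ : ℕ∞) v' (Set.Ici 0) ∧
          ∀ r : ℝ, 0 < r →
            HasDerivAt u' (v' r * (2 * β₂ * (u' r) ^ 2 + β₁ * (v' r) ^ 2) - u' r / r) r ∧
            HasDerivAt v' (-(u' r * (β₁ * (u' r) ^ 2 + 2 * β₂ * (v' r) ^ 2))) r) →
        ∀ r : ℝ, 0 ≤ r → u' r = u r ∧ v' r = v r) := by
  have hβ₁ : 0 < β₁ := hβ₂.trans_le hββ
  obtain ⟨C, hC⟩ : ∃ C, C = 2 / (β₁ * lam ^ 2) := ⟨_, rfl⟩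
  have hC0 : 0 < C := by rw [hC]; positivity
  obtain ⟨D, hD⟩ : ∃ D : ℝ → ℝ, D = fun r => β₁ * (r ^ 4 + C ^ 4) + 4 * β₂ * C ^ 2 * r ^ 2 :=
    ⟨_, rfl⟩
  have hDpos : ∀ r, 0 < D r := by intro r; rw [hD]; positivity
  obtain ⟨v, hv⟩ : ∃ v : ℝ → ℝ, v = fun r => √(2 * C ^ 3 / D r) := ⟨_, rfl⟩
  have hvpos : ∀ r, 0 < v r := by
    intro r; have := hDpos r; rw [hv]; exact Real.sqrt_pos.2 (by positivity)
  have hvsq : ∀ r, v r ^ 2 = 2 * C ^ 3 / D r := by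
    intro r; have := hDpos r; rw [hv]; exact Real.sq_sqrt (by positivity)
  have hDs : ContDiff ℝ (⊤ : ℕ∞) D := by rw [hD]; fun_prop
  have hvs : ContDiff ℝ (⊤ : ℕ∞) v := by
    rw [hv]
    refine ContDiff.sqrt (contDiff_const.div hDs fun r => (hDpos r).ne') fun r => ?_
    have := hDpos r
    positivity
  have hv' : ∀ r, HasDerivAt v (-(r * v r / C * (β₁ * (r * v r / C) ^ 2 + 2 * β₂ * (v r) ^ 2))) r := by
    intro r
    have hDd : HasDerivAt D (4 * β₁ * r ^ 3 + 8 * β₂ * C ^ 2 * r) r := by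
      rw [hD]
      refine (((((hasDerivAt_id r).pow 4).add_const (C ^ 4)).const_mul β₁).add
        (((hasDerivAt_id r).pow 2).const_mul (4 * β₂ * C ^ 2))).congr_deriv ?_
      simp
      ring
    have hp := hDpos r
    have hq : HasDerivAt (fun y => √(2 * C ^ 3 / D y)) _ r :=
      ((hasDerivAt_const r (2 * C ^ 3)).div hDd hp.ne').sqrt
      (by simp only [Pi.div_apply]; positivity)
    have hvr := hvpos r
    have hvr2 := hvsq r
    have e2 : √(((fun _ => 2 * C ^ 3 : ℝ → ℝ) / D) r) = v r := by rw [hv]; rfl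
    rw [e2] at hq
    have e : v = fun y => √(2 * C ^ 3 / D y) := hv
    rw [← e] at hq
    refine hq.congr_deriv (Eq.symm ?_)
    rw [eq_div_iff (by positivity)]
    have : -(r * v r / C * (β₁ * (r * v r / C) ^ 2 + 2 * β₂ * v r ^ 2)) * (2 * v r)
       = - (2 * r / C ^ 3) * (β₁ * r ^ 2 + 2 * β₂ * C ^ 2) * (v r ^ 2) ^ 2 := by
      field_simp
    rw [this, hvr2]
    field_simp
    ring
  refine ⟨fun r => r * v r / C, v, ⟨by simp, ?_, ?_, hvs.contDiffOn, ?_⟩, ?_, ?_, ?_⟩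
  · rw [hv, hD]
    simp only
    rw [Real.sqrt_eq_iff_mul_self_eq (by positivity) hlam.le, hC]
    field_simp
    ring
  · exact ((contDiff_id.mul hvs).div_const C).contDiffOn
  · intro r hr
    refine ⟨?_, hv' r⟩
    refine (((hasDerivAt_id r).mul (hv' r)).div_const C).congr_deriv ?_
    have hp := hDpos r
    have h1 : v r ^ 2 * D r = 2 * C ^ 3 := by rw [hvsq]; field_simp
    rw [hD] at h1
    simp only [id]
    field_simp
    linear_combination (-v r) * h1
  · intro r hr
    have := hvpos r
    exact ⟨by positivity, this⟩
  · have hmain : ∀ r : ℝ, 1 ≤ r → √(2 * C ^ 3 / D 1) / r ^ 2 ≤ v r ∧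
        v r ≤ √(2 * C ^ 3 / β₁) / r ^ 2 := by
      intro r hr
      have hr0 : 0 < r := by linarith
      have hp := hDpos r
      have hp1 := hDpos 1
      have e : √(r ^ 4) = r ^ 2 := by
        rw [show r ^ 4 = (r ^ 2) ^ 2 by ring]; exact Real.sqrt_sq (by positivity)
      rw [← e, ← Real.sqrt_div (by positivity), ← Real.sqrt_div (by positivity), hv, div_div,
        div_div]
      have hr2 : 1 ≤ r ^ 2 := one_le_pow₀ hr
      have hr4 : r ^ 2 ≤ r ^ 4 := pow_le_pow_right₀ hr (by norm_num)
      constructor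
      · apply Real.sqrt_le_sqrt
        apply div_le_div_of_nonneg_left (by positivity) hp
        rw [hD]
        simp only
        have a1 : 0 ≤ β₁ * C ^ 4 * (r ^ 4 - 1) := mul_nonneg (by positivity) (by linarith)
        have a2 : 0 ≤ 4 * β₂ * C ^ 2 * (r ^ 4 - r ^ 2) := mul_nonneg (by positivity) (by linarith)
        linarith
      · apply Real.sqrt_le_sqrt
        apply div_le_div_of_nonneg_left (by positivity) (by positivity)
        rw [hD]
        simp only
        have a1 : 0 ≤ β₁ * C ^ 4 := by positivity
        have a2 : 0 ≤ 4 * β₂ * C ^ 2 * r ^ 2 := by positivity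
        linarith
    have hp1 := hDpos 1
    have k1 : 0 < √(2 * C ^ 3 / D 1) := Real.sqrt_pos.2 (by positivity)
    have k2 : 0 < √(2 * C ^ 3 / β₁) := Real.sqrt_pos.2 (by positivity)
    refine ⟨√(2 * C ^ 3 / D 1) / C, √(2 * C ^ 3 / β₁) / C, √(2 * C ^ 3 / D 1), √(2 * C ^ 3 / β₁), 1,
      by positivity, by positivity, k1, k2, one_pos, ?_⟩
    intro r hr
    have hr0 : 0 < r := by linarith
    obtain ⟨m1, m2⟩ := hmain r hr
    refine ⟨?_, ?_, m1, m2⟩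
    · calc _ = r * (√(2 * C ^ 3 / D 1) / r ^ 2) / C := by field_simp
        _ ≤ r * v r / C := by gcongr
    · calc r * v r / C ≤ r * (√(2 * C ^ 3 / β₁) / r ^ 2) / C := by gcongr
        _ = _ := by field_simp
  · rintro U V ⟨hU0, hV0, hUs, hVs, hder⟩ r hr
    have hv0 : v 0 = lam := by
      rw [hv, hD]
      simp only
      rw [Real.sqrt_eq_iff_mul_self_eq (by positivity) hlam.le, hC]
      field_simp
      ring
    refine aux_uniq β₁ β₂ (fun r => r * v r / C) v U V (by simp [hU0]) (by rw [hV0, hv0])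
      ((contDiff_id.mul hvs).div_const C).continuous.continuousOn hvs.continuous.continuousOn
      hUs.continuousOn hVs.continuousOn ?_ hder r hr
    intro r hr
    refine ⟨?_, hv' r⟩
    refine (((hasDerivAt_id r).mul (hv' r)).div_const C).congr_deriv ?_
    have hp := hDpos r
    have h1 : v r ^ 2 * D r = 2 * C ^ 3 := by rw [hvsq]; field_simp
    rw [hD] at h1
    simp only [id]
    field_simp
    linear_combination (-v r) * h1
end

section
/- Let 0 < β₂ ≤ β₁ and let (u, v) be a solution on (0, ∞) of the system u'(r) + u(r)/r = v(r)(2β₂ u² + β₁ v²), v'(r) = −u(r)(β₁ u² + 2β₂ v²), and let H(r) := (β₁/4)(u(r)⁴ + v(r)⁴) + β₂ u(r)² v(r)². Then for all r > 0, (d/dr)(r² H(r)) = (β₁/2) r (v(r)⁴ − u(r)⁴). -/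
/-- Along any solution of the radial system, with
`H(r) = (β₁/4)(u(r)⁴ + v(r)⁴) + β₂ u(r)² v(r)²`, there holds
`(d/dr)(r² H(r)) = (β₁/2) r (v(r)⁴ − u(r)⁴)` for all `r > 0`. -/
theorem deriv_r_sq_H (β₁ β₂ : ℝ) (hβ₂ : 0 < β₂) (hββ : β₂ ≤ β₁)
    (u v : ℝ → ℝ)
    (hode : ∀ r : ℝ, 0 < r →
      HasDerivAt u (v r * (2 * β₂ * (u r) ^ 2 + β₁ * (v r) ^ 2) - u r / r) r ∧
      HasDerivAt v (-(u r * (β₁ * (u r) ^ 2 + 2 * β₂ * (v r) ^ 2))) r) :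
    ∀ r : ℝ, 0 < r →
      HasDerivAt
        (fun r => r ^ 2 * (β₁ / 4 * ((u r) ^ 4 + (v r) ^ 4) + β₂ * (u r) ^ 2 * (v r) ^ 2))
        (β₁ / 2 * r * ((v r) ^ 4 - (u r) ^ 4)) r := by
  intro r hr
  obtain ⟨hu, hv⟩ := hode r hr
  have hr0 : r ≠ 0 := hr.ne'
  have h := ((hasDerivAt_id r).fun_pow 2).fun_mul
    ((((hu.fun_pow 4).fun_add (hv.fun_pow 4)).const_mul (β₁ / 4)).fun_add
      (((hu.fun_pow 2).const_mul β₂).fun_mul (hv.fun_pow 2)))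
  refine h.congr_deriv ?_
  simp only [id]
  push_cast
  field_simp
  ring
end

section
/- Let 0 < β₂ ≤ β₁, λ > 0, and let (u, v) ∈ C¹([0,∞), ℝ²) solve u'(r) + u(r)/r = v(r)(2β₂ u² + β₁ v²), v'(r) = −u(r)(β₁ u² + 2β₂ v²) on (0,∞) with u(0) = 0, v(0) = λ. Then for all r ≥ 0 the identity u(r)·v(r) = 2r·H(u(r), v(r)) holds, where H(u,v) = (β₁/4)(u⁴ + v⁴) + β₂ u² v². -/
/-- along the solution of the radial Cauchy problem with
`u(0) = 0`, `v(0) = λ > 0`, the identity `u(r)·v(r) = 2r·H(u(r), v(r))` holds for all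
`r ≥ 0`, where `H(u,v) = (β₁/4)(u⁴ + v⁴) + β₂ u² v²`. -/
theorem uv_eq_two_r_H (β₁ β₂ lam : ℝ) (hβ₂ : 0 < β₂) (hββ : β₂ ≤ β₁) (hlam : 0 < lam)
    (u v : ℝ → ℝ)
    (hu0 : u 0 = 0) (hv0 : v 0 = lam)
    (hureg : ContDiffOn ℝ 1 u (Set.Ici 0)) (hvreg : ContDiffOn ℝ 1 v (Set.Ici 0))
    (hode : ∀ r : ℝ, 0 < r →
      HasDerivAt u (v r * (2 * β₂ * (u r) ^ 2 + β₁ * (v r) ^ 2) - u r / r) r ∧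
      HasDerivAt v (-(u r * (β₁ * (u r) ^ 2 + 2 * β₂ * (v r) ^ 2))) r) :
    ∀ r : ℝ, 0 ≤ r →
      u r * v r = 2 * r * (β₁ / 4 * ((u r) ^ 4 + (v r) ^ 4) + β₂ * (u r) ^ 2 * (v r) ^ 2) := by
  intro r hr
  rcases hr.eq_or_lt with h0 | hpos
  · subst h0
    simp [hu0]
  have hcu : ContinuousOn u (Set.Icc 0 r) := hureg.continuousOn.mono Set.Icc_subset_Ici_self
  have hcv : ContinuousOn v (Set.Icc 0 r) := hvreg.continuousOn.mono Set.Icc_subset_Ici_self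
  obtain ⟨c, hc, hslope⟩ := exists_hasDerivAt_eq_slope
    (fun s => s * (u s * v s) - 2 * s ^ 2 *
      (β₁ / 4 * ((u s) ^ 4 + (v s) ^ 4) + β₂ * ((u s) ^ 2 * (v s) ^ 2)))
    (fun _ => 0) hpos (by fun_prop) (by
      intro x hx
      have hx0 : x ≠ 0 := hx.1.ne'
      obtain ⟨h1, h2⟩ := hode x hx.1
      have hid := hasDerivAt_id' x
      have h := (hid.mul (h1.mul h2)).sub (((hid.pow 2).const_mul 2).mul
        ((((h1.pow 4).add (h2.pow 4)).const_mul (β₁ / 4)).add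
          (((h1.pow 2).mul (h2.pow 2)).const_mul β₂)))
      refine h.congr_deriv ?_
      simp only [Pi.mul_apply, Pi.pow_apply, Pi.add_apply]
      push_cast
      field_simp
      ring)
  have h3 := (eq_div_iff (by simpa using hpos.ne')).mp hslope
  have h4 : r * (u r * v r - 2 * r *
      (β₁ / 4 * ((u r) ^ 4 + (v r) ^ 4) + β₂ * (u r) ^ 2 * (v r) ^ 2)) = 0 := by
    simp only [hu0] at h3
    linarith
  have h5 := (mul_eq_zero.mp h4).resolve_left hpos.ne'
  linarith
end

section
/- Let 0 < β₂ ≤ β₁, λ > 0, and let (u, v) ∈ C¹([0,∞), ℝ²) solve u'(r) + u(r)/r = v(r)(2β₂ u² + β₁ v²), v'(r) = −u(r)(β₁ u² + 2β₂ v²) on (0,∞) with u(0) = 0, v(0) = λ. Then u(r) > 0 and v(r) > 0 for all r > 0. -/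
/-- along the solution of the radial Cauchy problem with
`u(0) = 0`, `v(0) = λ > 0`, both components are strictly positive for `r > 0`. -/
theorem components_positive (β₁ β₂ lam : ℝ) (hβ₂ : 0 < β₂) (hββ : β₂ ≤ β₁) (hlam : 0 < lam)
    (u v : ℝ → ℝ)
    (hu0 : u 0 = 0) (hv0 : v 0 = lam)
    (hureg : ContDiffOn ℝ 1 u (Set.Ici 0)) (hvreg : ContDiffOn ℝ 1 v (Set.Ici 0))
    (hode : ∀ r : ℝ, 0 < r →
      HasDerivAt u (v r * (2 * β₂ * (u r) ^ 2 + β₁ * (v r) ^ 2) - u r / r) r ∧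
      HasDerivAt v (-(u r * (β₁ * (u r) ^ 2 + 2 * β₂ * (v r) ^ 2))) r) :
    ∀ r : ℝ, 0 < r → 0 < u r ∧ 0 < v r := by
  have hβ₁ : 0 < β₁ := lt_of_lt_of_le hβ₂ hββ
  have hsub : ∀ R : ℝ, Set.Icc 0 R ⊆ Set.Ici (0:ℝ) := fun R x hx => hx.1
  have hcu : ∀ R : ℝ, ContinuousOn u (Set.Icc 0 R) := fun R => hureg.continuousOn.mono (hsub R)
  have hcv : ∀ R : ℝ, ContinuousOn v (Set.Icc 0 R) := fun R => hvreg.continuousOn.mono (hsub R)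
  -- conserved quantity
  have hE : ∀ R : ℝ, 0 < R →
      R ^ 2 * (β₁ * (u R ^ 4 + v R ^ 4) + 4 * β₂ * (u R ^ 2 * v R ^ 2)) - 2 * (R * (u R * v R))
        = 0 := by
    intro R hR
    have h := exists_hasDerivAt_eq_slope
      (fun r => r ^ 2 * (β₁ * (u r ^ 4 + v r ^ 4) + 4 * β₂ * (u r ^ 2 * v r ^ 2))
        - 2 * (r * (u r * v r))) (fun _ => 0) hR
      (by have := hcu R; have := hcv R; fun_prop)
      (by
        intro x hx
        obtain ⟨h1, h2⟩ := hode x hx.1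
        have hx0 : x ≠ 0 := hx.1.ne'
        have h3 := (((hasDerivAt_id x).pow 2).mul ((((h1.pow 4).add (h2.pow 4)).const_mul β₁).add
          (((h1.pow 2).mul (h2.pow 2)).const_mul (4 * β₂)))).sub
          (((hasDerivAt_id x).mul (h1.mul h2)).const_mul 2)
        refine h3.congr_deriv ?_
        simp
        field_simp
        ring)
    obtain ⟨c, hc, h⟩ := h
    rw [eq_div_iff (by linarith)] at h
    simp at h
    linarith
  have hU : ∀ R : ℝ, 0 < R → (∀ x, 0 < x → x < R → 0 < v x) → 0 < u R := by
    intro R hR hv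
    obtain ⟨c, hc, h⟩ := exists_hasDerivAt_eq_slope
      (fun r => r * u r) (fun r => r * (v r * (2 * β₂ * (u r) ^ 2 + β₁ * (v r) ^ 2))) hR
      (by have := hcu R; fun_prop)
      (by
        intro x hx
        obtain ⟨h1, h2⟩ := hode x hx.1
        have hx0 : x ≠ 0 := hx.1.ne'
        refine ((hasDerivAt_id x).mul h1).congr_deriv ?_
        simp
        field_simp
        ring)
    have hvc := hv c hc.1 hc.2
    have hc0 := hc.1
    have hp : 0 < c * (v c * (2 * β₂ * (u c) ^ 2 + β₁ * (v c) ^ 2)) := by positivity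
    have h' : c * (v c * (2 * β₂ * (u c) ^ 2 + β₁ * (v c) ^ 2)) = u R := by
      rw [h, zero_mul, sub_zero, sub_zero, mul_div_cancel_left₀ _ hR.ne']
    linarith
  have hV : ∀ r : ℝ, 0 < r → 0 < v r := by
    intro r hr
    by_contra hneg
    push Not at hneg
    have hcl : IsClosed (Set.Icc 0 r ∩ v ⁻¹' Set.Iic 0) :=
      (hcv r).preimage_isClosed_of_isClosed isClosed_Icc isClosed_Iic
    have hcomp : IsCompact (Set.Icc 0 r ∩ v ⁻¹' Set.Iic 0) :=
      isCompact_Icc.of_isClosed_subset hcl Set.inter_subset_left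
    obtain ⟨R, ⟨hRm, hRv⟩, hmin⟩ := hcomp.exists_isLeast ⟨r, ⟨hr.le, le_rfl⟩, hneg⟩
    have hRv : v R ≤ 0 := hRv
    have hR : 0 < R := by
      rcases hRm.1.eq_or_lt with h | h
      · rw [← h, hv0] at hRv; linarith
      · exact h
    have huR := hU R hR (fun x hx hxR => by
      by_contra hn
      push Not at hn
      have := hmin ⟨⟨hx.le, hxR.le.trans hRm.2⟩, hn⟩
      linarith)
    have h := hE R hR
    have h1 : 0 < R ^ 2 * (β₁ * (u R ^ 4 + v R ^ 4) + 4 * β₂ * (u R ^ 2 * v R ^ 2)) := by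
      positivity
    have h2 : R * (u R * v R) ≤ 0 :=
      mul_nonpos_of_nonneg_of_nonpos hR.le (mul_nonpos_of_nonneg_of_nonpos huR.le hRv)
    linarith
  exact fun r hr => ⟨hU r hr (fun x hx _ => hV x hx), hV r hr⟩
end

section
/- Let 0 < β₂ ≤ β₁, λ > 0, and let (u, v) ∈ C¹([0,∞), ℝ²) solve u'(r) + u(r)/r = v(r)(2β₂ u² + β₁ v²), v'(r) = −u(r)(β₁ u² + 2β₂ v²) on (0,∞) with u(0) = 0, v(0) = λ. Then (u(r), v(r)) → (0, 0) as r → +∞. -/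
/-- along the solution of the radial Cauchy problem with
`u(0) = 0`, `v(0) = λ > 0`, one has `(u(r), v(r)) → (0,0)` as `r → +∞`. -/
theorem tends_to_zero (β₁ β₂ lam : ℝ) (hβ₂ : 0 < β₂) (hββ : β₂ ≤ β₁) (hlam : 0 < lam)
    (u v : ℝ → ℝ)
    (hu0 : u 0 = 0) (hv0 : v 0 = lam)
    (hureg : ContDiffOn ℝ 1 u (Set.Ici 0)) (hvreg : ContDiffOn ℝ 1 v (Set.Ici 0))
    (hode : ∀ r : ℝ, 0 < r →
      HasDerivAt u (v r * (2 * β₂ * (u r) ^ 2 + β₁ * (v r) ^ 2) - u r / r) r ∧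
      HasDerivAt v (-(u r * (β₁ * (u r) ^ 2 + 2 * β₂ * (v r) ^ 2))) r) :
    Filter.Tendsto (fun r => (u r, v r)) Filter.atTop (nhds ((0 : ℝ), (0 : ℝ))) := by
  have hβ₁ : 0 < β₁ := lt_of_lt_of_le hβ₂ hββ
  have key : ∀ r : ℝ, 0 < r →
      r ^ 2 * (β₁ / 4 * (u r ^ 4 + v r ^ 4) + β₂ * (u r ^ 2 * v r ^ 2))
        - r * (u r * v r) / 2 = 0 := by
    intro r hr
    have hsub : Set.Icc 0 r ⊆ Set.Ici (0 : ℝ) := fun x hx => hx.1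
    have cu : ContinuousOn u (Set.Icc 0 r) := hureg.continuousOn.mono hsub
    have cv : ContinuousOn v (Set.Icc 0 r) := hvreg.continuousOn.mono hsub
    obtain ⟨c, hc, h⟩ := exists_hasDerivAt_eq_slope
      (fun r => r ^ 2 * (β₁ / 4 * (u r ^ 4 + v r ^ 4) + β₂ * (u r ^ 2 * v r ^ 2))
        - r * (u r * v r) / 2) (fun _ => 0) hr (by fun_prop) (by
        intro x hx
        have hx0 : x ≠ 0 := hx.1.ne'
        obtain ⟨h1, h2⟩ := hode x hx.1
        have hid := hasDerivAt_id' x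
        have hd := ((hid.pow 2).mul ((((h1.pow 4).add (h2.pow 4)).const_mul (β₁ / 4)).add
          (((h1.pow 2).mul (h2.pow 2)).const_mul β₂))).sub ((hid.mul (h1.mul h2)).div_const 2)
        refine hd.congr_deriv ?_
        simp only [Pi.pow_apply, Pi.mul_apply, Pi.add_apply]
        push_cast
        field_simp
        ring)
    have h' := h.symm
    rw [div_eq_zero_iff] at h'
    rcases h' with h' | h'
    · simpa using h'
    · linarith
  have bound : ∀ r : ℝ, 0 < r → u r ^ 2 + v r ^ 2 ≤ 2 / β₁ * r⁻¹ := by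
    intro r hr
    have hk := key r hr
    have hk2 : r * (β₁ / 4 * (u r ^ 4 + v r ^ 4) + β₂ * (u r ^ 2 * v r ^ 2))
        = u r * v r / 2 := by
      apply mul_left_cancel₀ hr.ne'
      linarith
    by_contra hcon
    push Not at hcon
    have hs : 2 < (u r ^ 2 + v r ^ 2) * (β₁ * r) := by
      have h3 : 2 / β₁ * r⁻¹ = 2 / (β₁ * r) := by field_simp
      rw [h3, div_lt_iff₀ (by positivity)] at hcon
      exact hcon
    have hspos : 0 < u r ^ 2 + v r ^ 2 := lt_trans (by positivity) hcon
    have h4 := mul_lt_mul_of_pos_right hs hspos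
    have h5 : 0 ≤ r * (β₂ * (u r ^ 2 * v r ^ 2)) := by positivity
    have h6 : 0 ≤ (r * β₁) * (u r ^ 2 - v r ^ 2) ^ 2 := by positivity
    nlinarith [sq_nonneg (u r - v r)]
  have hlim : Filter.Tendsto (fun r : ℝ => Real.sqrt (2 / β₁ * r⁻¹)) Filter.atTop (nhds 0) := by
    have := (tendsto_inv_atTop_zero (𝕜 := ℝ)).const_mul (2 / β₁)
    rw [mul_zero] at this
    simpa using this.sqrt
  refine Filter.Tendsto.prodMk_nhds ?_ ?_
  · refine squeeze_zero_norm' ?_ hlim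
    filter_upwards [Filter.eventually_gt_atTop 0] with r hr
    exact Real.abs_le_sqrt (by nlinarith [bound r hr, sq_nonneg (v r)])
  · refine squeeze_zero_norm' ?_ hlim
    filter_upwards [Filter.eventually_gt_atTop 0] with r hr
    exact Real.abs_le_sqrt (by nlinarith [bound r hr, sq_nonneg (u r)])
end

section
/- Let 0 < β₂ ≤ β₁, λ > 0, and let (u, v) ∈ C¹([0,∞), ℝ²) solve u'(r) + u(r)/r = v(r)(2β₂ u² + β₁ v²), v'(r) = −u(r)(β₁ u² + 2β₂ v²) on (0,∞) with u(0) = 0, v(0) = λ. Then there exist constants C₁, C₂ > 0 and R > 0 such that for all r ≥ R: C₁/r² ≤ u(r)² + v(r)² ≤ C₂/r. -/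
/-- along the solution of the radial Cauchy problem with
`u(0) = 0`, `v(0) = λ > 0`, for large `r` one has `C₁/r² ≤ u(r)² + v(r)² ≤ C₂/r`. -/
theorem squared_norm_bounds (β₁ β₂ lam : ℝ) (hβ₂ : 0 < β₂) (hββ : β₂ ≤ β₁) (hlam : 0 < lam)
    (u v : ℝ → ℝ)
    (hu0 : u 0 = 0) (hv0 : v 0 = lam)
    (hureg : ContDiffOn ℝ 1 u (Set.Ici 0)) (hvreg : ContDiffOn ℝ 1 v (Set.Ici 0))
    (hode : ∀ r : ℝ, 0 < r →
      HasDerivAt u (v r * (2 * β₂ * (u r) ^ 2 + β₁ * (v r) ^ 2) - u r / r) r ∧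
      HasDerivAt v (-(u r * (β₁ * (u r) ^ 2 + 2 * β₂ * (v r) ^ 2))) r) :
    ∃ C₁ C₂ R : ℝ, 0 < C₁ ∧ 0 < C₂ ∧ 0 < R ∧
      ∀ r : ℝ, R ≤ r →
        C₁ / r ^ 2 ≤ (u r) ^ 2 + (v r) ^ 2 ∧ (u r) ^ 2 + (v r) ^ 2 ≤ C₂ / r := by
  have hβ₁ : 0 < β₁ := lt_of_lt_of_le hβ₂ hββ
  have huc : ContinuousOn u (Set.Ici 0) := hureg.continuousOn
  have hvc : ContinuousOn v (Set.Ici 0) := hvreg.continuousOn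
  -- the identity
  have hid : ∀ r : ℝ, 0 < r → u r * v r =
      2 * r * (β₁ / 4 * (u r ^ 4 + v r ^ 4) + β₂ * u r ^ 2 * v r ^ 2) := by
    intro r hr
    have hu' : ContinuousOn u (Set.Icc 0 r) := huc.mono Set.Icc_subset_Ici_self
    have hv' : ContinuousOn v (Set.Icc 0 r) := hvc.mono Set.Icc_subset_Ici_self
    obtain ⟨c, hc, hs⟩ := exists_hasDerivAt_eq_slope
      (fun x => x * (u x * v x) -
        2 * x ^ 2 * (β₁ / 4 * (u x ^ 4 + v x ^ 4) + β₂ * (u x ^ 2 * v x ^ 2)))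
      (fun _ => 0) hr (by fun_prop) (by
        intro x hx
        obtain ⟨h1, h2⟩ := hode x hx.1
        have hx0 : x ≠ 0 := ne_of_gt hx.1
        have := ((hasDerivAt_id x).mul (h1.mul h2)).sub ((((hasDerivAt_id x).pow 2).const_mul 2).mul
          ((((h1.pow 4).add (h2.pow 4)).const_mul (β₁ / 4)).add
            (((h1.pow 2).mul (h2.pow 2)).const_mul β₂)))
        refine HasDerivAt.congr_deriv this ?_
        simp
        field_simp
        ring)
    have h0 : (0:ℝ) = r * (u r * v r) -
        2 * r ^ 2 * (β₁ / 4 * (u r ^ 4 + v r ^ 4) + β₂ * (u r ^ 2 * v r ^ 2)) := by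
      have hr' : r - 0 ≠ 0 := by simpa using hr.ne'
      rw [eq_div_iff hr'] at hs
      simp only [hu0] at hs
      linarith
    apply mul_left_cancel₀ hr.ne'
    linarith
  obtain ⟨R, hR, hvR⟩ : ∃ R : ℝ, 0 < R ∧ 0 < v R := by
    have h1 : ∀ᶠ x in nhdsWithin (0:ℝ) (Set.Ici 0), 0 < v x :=
      (hvc 0 (by simp)).eventually (lt_mem_nhds (by rw [hv0]; exact hlam))
    have h2 : ∀ᶠ x in nhdsWithin (0:ℝ) (Set.Ioi 0), 0 < v x :=
      h1.filter_mono (nhdsWithin_mono _ Set.Ioi_subset_Ici_self)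
    obtain ⟨x, hx, hx'⟩ := (h2.and self_mem_nhdsWithin).exists
    exact ⟨x, hx', hx⟩
  set K : ℝ := R ^ 4 * (β₁ / 4 * (u R ^ 4 + v R ^ 4) + β₂ * (u R ^ 2 * v R ^ 2)) with hK
  have hKpos : 0 < K := by positivity
  have hmono : ∀ r : ℝ, R ≤ r →
      K ≤ r ^ 4 * (β₁ / 4 * (u r ^ 4 + v r ^ 4) + β₂ * (u r ^ 2 * v r ^ 2)) := by
    intro r hr
    rcases hr.eq_or_lt with rfl | hr
    · exact le_rfl
    have hsub : Set.Icc R r ⊆ Set.Ici 0 := fun x hx => hR.le.trans hx.1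
    have hu' : ContinuousOn u (Set.Icc R r) := huc.mono hsub
    have hv' : ContinuousOn v (Set.Icc R r) := hvc.mono hsub
    obtain ⟨c, hc, hs⟩ := exists_hasDerivAt_eq_slope
      (fun x => x ^ 4 * (β₁ / 4 * (u x ^ 4 + v x ^ 4) + β₂ * (u x ^ 2 * v x ^ 2)))
      (fun x => x ^ 3 * (β₁ * v x ^ 4 + 2 * β₂ * (u x ^ 2 * v x ^ 2))) hr (by fun_prop) (by
        intro x hx
        have hxp : 0 < x := hR.trans hx.1
        obtain ⟨h1, h2⟩ := hode x hxp
        have hx0 : x ≠ 0 := ne_of_gt hxp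
        have := ((hasDerivAt_id x).pow 4).mul
          ((((h1.pow 4).add (h2.pow 4)).const_mul (β₁ / 4)).add
            (((h1.pow 2).mul (h2.pow 2)).const_mul β₂))
        refine HasDerivAt.congr_deriv this ?_
        simp
        field_simp
        ring)
    have hcp : 0 < c := hR.trans hc.1
    have hrR : 0 < r - R := sub_pos.2 hr
    rw [eq_div_iff hrR.ne'] at hs
    have : 0 ≤ c ^ 3 * (β₁ * v c ^ 4 + 2 * β₂ * (u c ^ 2 * v c ^ 2)) * (r - R) := by positivity
    linarith
  refine ⟨√(2 * K / β₁), 1 / β₂, R, by positivity, by positivity, hR, fun r hr => ⟨?_, ?_⟩⟩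
  · have hrp : 0 < r := hR.trans_le hr
    rw [div_le_iff₀ (by positivity), Real.sqrt_le_iff]
    refine ⟨by positivity, ?_⟩
    rw [div_le_iff₀ hβ₁]
    have h1 := hmono r hr
    have h2 : β₁ / 4 * (u r ^ 4 + v r ^ 4) + β₂ * (u r ^ 2 * v r ^ 2)
        ≤ β₁ / 2 * (u r ^ 2 + v r ^ 2) ^ 2 := by
      have : β₂ * (u r ^ 2 * v r ^ 2) ≤ β₁ * (u r ^ 2 * v r ^ 2) := by gcongr
      have : 0 ≤ β₁ * (u r ^ 4 + v r ^ 4) := by positivity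
      nlinarith
    have h3 := mul_le_mul_of_nonneg_left h2 (by positivity : 0 ≤ r ^ 4)
    nlinarith
  · have hrp : 0 < r := hR.trans_le hr
    have h := hid r hrp
    have h2 : β₂ / 4 * (u r ^ 2 + v r ^ 2) ^ 2 ≤
        β₁ / 4 * (u r ^ 4 + v r ^ 4) + β₂ * u r ^ 2 * v r ^ 2 := by
      have : β₂ * (u r ^ 4 + v r ^ 4) ≤ β₁ * (u r ^ 4 + v r ^ 4) := by gcongr
      have : 0 ≤ β₂ * (u r ^ 2 * v r ^ 2) := by positivity
      nlinarith
    have h3 := mul_le_mul_of_nonneg_left h2 (by positivity : 0 ≤ 2 * r)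
    have h4 : u r * v r ≤ (u r ^ 2 + v r ^ 2) / 2 := by nlinarith [sq_nonneg (u r - v r)]
    rw [div_div, le_div_iff₀ (by positivity)]
    rcases (by positivity : 0 ≤ u r ^ 2 + v r ^ 2).eq_or_lt with h0 | h0
    · rw [← h0]; simp
    · refine le_of_mul_le_mul_left ?_ h0
      nlinarith
end

section
/- Let 0 < β₂ ≤ β₁, λ > 0, and let (u, v) ∈ C¹([0,∞), ℝ²) solve u'(r) + u(r)/r = v(r)(2β₂ u² + β₁ v²), v'(r) = −u(r)(β₁ u² + 2β₂ v²) on (0,∞) with u(0) = 0, v(0) = λ. Then the function f(r) := r·u(r) is strictly increasing on (0, ∞) and converges to a finite positive limit l ∈ (0, +∞) as r → +∞; in particular r·u(r) → l, so u(r) is asymptotic to l/r as r → +∞. -/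
lemma mono_aux (f f' : ℝ → ℝ) (hc : ContinuousOn f (Set.Ici 0))
    (hd : ∀ r : ℝ, 0 < r → HasDerivAt f (f' r) r) (hn : ∀ r : ℝ, 0 < r → 0 ≤ f' r) :
    MonotoneOn f (Set.Ici 0) := by
  apply monotoneOn_of_deriv_nonneg (convex_Ici 0) hc
  · intro x hx
    rw [interior_Ici] at hx
    exact (hd x hx).differentiableAt.differentiableWithinAt
  · intro x hx
    rw [interior_Ici] at hx
    rw [(hd x hx).deriv]
    exact hn x hx

lemma limit_aux (a b k : ℝ) (ha : 0 < a) (hk : 0 < k) :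
    Filter.Tendsto (fun r : ℝ => k ^ 3 * r ^ 4 / (a * (1 + k ^ 4 * r ^ 4) + b * r ^ 2))
      Filter.atTop (nhds (1 / (a * k))) := by
  have h1 : Filter.Tendsto (fun r : ℝ => r⁻¹) Filter.atTop (nhds 0) := tendsto_inv_atTop_zero
  have h2 : Filter.Tendsto (fun r : ℝ => k ^ 3 /
      (a * ((r⁻¹) ^ 4 + k ^ 4) + b * (r⁻¹) ^ 2)) Filter.atTop
      (nhds (k ^ 3 / (a * (0 ^ 4 + k ^ 4) + b * 0 ^ 2))) := by
    apply Filter.Tendsto.div tendsto_const_nhds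
    · exact (((h1.pow 4).add_const _).const_mul a).add ((h1.pow 2).const_mul b)
    · have : 0 < a * k ^ 4 := by positivity
      simp
      exact ⟨ha.ne', hk.ne'⟩
  have h3 : k ^ 3 / (a * (0 ^ 4 + k ^ 4) + b * 0 ^ 2) = 1 / (a * k) := by
    have : (a * (0 ^ 4 + k ^ 4) + b * 0 ^ 2) = a * k ^ 4 := by ring
    rw [this]
    field_simp
  rw [h3] at h2
  refine h2.congr' ?_
  filter_upwards [Filter.eventually_gt_atTop 0] with r hr
  have e : (a * (1 + k ^ 4 * r ^ 4) + b * r ^ 2)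
      = r ^ 4 * (a * ((r⁻¹) ^ 4 + k ^ 4) + b * (r⁻¹) ^ 2) := by
    field_simp
  rw [e, mul_comm (k ^ 3), mul_div_mul_left]
  positivity

/-- along the solution of the radial Cauchy problem with
`u(0) = 0`, `v(0) = λ > 0`, the function `f(r) = r·u(r)` is strictly increasing on
`(0,∞)` and converges to a finite positive limit `l` as `r → +∞`; in particular
`u(r)` is asymptotic to `l/r`. -/
theorem r_u_strict_mono_limit (β₁ β₂ lam : ℝ) (hβ₂ : 0 < β₂) (hββ : β₂ ≤ β₁) (hlam : 0 < lam)
    (u v : ℝ → ℝ)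
    (hu0 : u 0 = 0) (hv0 : v 0 = lam)
    (hureg : ContDiffOn ℝ 1 u (Set.Ici 0)) (hvreg : ContDiffOn ℝ 1 v (Set.Ici 0))
    (hode : ∀ r : ℝ, 0 < r →
      HasDerivAt u (v r * (2 * β₂ * (u r) ^ 2 + β₁ * (v r) ^ 2) - u r / r) r ∧
      HasDerivAt v (-(u r * (β₁ * (u r) ^ 2 + 2 * β₂ * (v r) ^ 2))) r) :
    StrictMonoOn (fun r => r * u r) (Set.Ioi (0 : ℝ)) ∧
    ∃ l : ℝ, 0 < l ∧ Filter.Tendsto (fun r => r * u r) Filter.atTop (nhds l) := by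
  have hβ₁ : 0 < β₁ := lt_of_lt_of_le hβ₂ hββ
  have cu := hureg.continuousOn
  have cv := hvreg.continuousOn
  obtain ⟨H, hH⟩ : ∃ H : ℝ → ℝ, H = fun r =>
      β₁ / 4 * (u r ^ 4 + v r ^ 4) + β₂ * (u r ^ 2 * v r ^ 2) := ⟨_, rfl⟩
  have cH : ContinuousOn H (Set.Ici 0) := by
    rw [hH]; fun_prop
  have dH : ∀ r : ℝ, 0 < r → HasDerivAt H
      (-(u r / r * (u r * (β₁ * u r ^ 2 + 2 * β₂ * v r ^ 2)))) r := by
    intro r hr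
    obtain ⟨h1, h2⟩ := hode r hr
    rw [hH]
    refine ((((h1.pow 4).add (h2.pow 4)).const_mul (β₁ / 4)).add
      (((h1.pow 2).mul (h2.pow 2)).const_mul β₂)).congr_deriv ?_
    simp only [Pi.pow_apply]
    push_cast
    ring
  have m4 : MonotoneOn (fun r => r ^ 4 * H r) (Set.Ici 0) := by
    refine mono_aux _ (fun r => r ^ 3 * (β₁ * v r ^ 4 + 2 * β₂ * (u r ^ 2 * v r ^ 2))) ?_ ?_ ?_
    · fun_prop
    · intro r hr
      refine ((hasDerivAt_pow 4 r).mul (dH r hr)).congr_deriv ?_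
      simp only [hH]
      push_cast
      field_simp
      ring
    · intro r hr
      positivity
  have Hnn : ∀ r, 0 ≤ H r := by
    intro r; rw [hH]; positivity
  have H0 : 0 < H 0 := by
    rw [hH]; simp only [hu0, hv0]; positivity
  have Hpos : ∀ r : ℝ, 0 < r → 0 < H r := by
    intro r hr
    have hev : ∀ᶠ s in nhdsWithin (0:ℝ) (Set.Ici 0), 0 < H s :=
      (cH 0 (Set.mem_Ici.2 le_rfl)).eventually (lt_mem_nhds H0)
    have hev2 : ∀ᶠ s in nhdsWithin (0:ℝ) (Set.Ioi 0), 0 < H s :=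
      hev.filter_mono (nhdsWithin_mono _ Set.Ioi_subset_Ici_self)
    have hev3 : ∀ᶠ s in nhdsWithin (0:ℝ) (Set.Ioi 0), s ∈ Set.Ioo (0:ℝ) r :=
      Ioo_mem_nhdsGT hr
    obtain ⟨s, hs, hs2⟩ := (hev2.and hev3).exists
    have h := m4 (Set.mem_Ici.2 hs2.1.le) (Set.mem_Ici.2 hr.le) hs2.2.le
    have hs0 : 0 < s := hs2.1
    simp only at h
    have : 0 < s ^ 4 * H s := by positivity
    have h5 : 0 < r ^ 4 * H r := lt_of_lt_of_le this h
    exact (pos_iff_pos_of_mul_pos h5).1 (by positivity)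
  have dg : ∀ r : ℝ, 0 < r → HasDerivAt (fun r => 2 * (r ^ 2 * H r) - r * (u r * v r)) 0 r := by
    intro r hr
    obtain ⟨h1, h2⟩ := hode r hr
    refine ((((hasDerivAt_pow 2 r).mul (dH r hr)).const_mul 2).sub
      ((hasDerivAt_id r).mul (h1.mul h2))).congr_deriv ?_
    simp only [hH, id, Pi.mul_apply]
    push_cast
    field_simp
    ring
  have cg : ContinuousOn (fun r => 2 * (r ^ 2 * H r) - r * (u r * v r)) (Set.Ici 0) := by
    fun_prop
  have key : ∀ r : ℝ, 0 < r → u r * v r = 2 * r * H r := by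
    intro r hr
    have a1 := mono_aux _ (fun _ => 0) cg dg (fun _ _ => le_rfl)
      (Set.mem_Ici.2 le_rfl) (Set.mem_Ici.2 hr.le) hr.le
    have a2 := mono_aux _ (fun _ => 0) cg.neg
      (fun r hr => ((dg r hr).neg).congr_deriv neg_zero) (fun _ _ => le_rfl)
      (Set.mem_Ici.2 le_rfl) (Set.mem_Ici.2 hr.le) hr.le
    simp only [Pi.neg_apply] at a1 a2
    have e : r * (u r * v r) = r * (2 * r * H r) := by linarith
    exact mul_left_cancel₀ hr.ne' e
  have uvpos : ∀ r : ℝ, 0 < r → 0 < u r * v r := by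
    intro r hr
    rw [key r hr]
    have := Hpos r hr
    positivity
  have vpos : ∀ r : ℝ, 0 < r → 0 < v r := by
    intro r hr
    by_contra hneg
    push Not at hneg
    have hsub : ContinuousOn v (Set.Icc 0 r) := cv.mono Set.Icc_subset_Ici_self
    obtain ⟨s, hs, hs0⟩ := intermediate_value_Icc' hr.le hsub
      (show (0:ℝ) ∈ Set.Icc (v r) (v 0) from ⟨hneg, by rw [hv0]; exact hlam.le⟩)
    rcases hs.1.eq_or_lt with h | h
    · rw [← h, hv0] at hs0; exact hlam.ne' hs0
    · have := uvpos s h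
      rw [hs0, mul_zero] at this
      exact lt_irrefl _ this
  have upos : ∀ r : ℝ, 0 < r → 0 < u r := fun r hr =>
    (pos_iff_pos_of_mul_pos (uvpos r hr)).2 (vpos r hr)
  have df : ∀ r : ℝ, 0 < r → HasDerivAt (fun r => r * u r)
      (r * (v r * (2 * β₂ * u r ^ 2 + β₁ * v r ^ 2))) r := by
    intro r hr
    refine ((hasDerivAt_id r).mul (hode r hr).1).congr_deriv ?_
    simp only [id]
    field_simp
    ring
  constructor
  · apply strictMonoOn_of_deriv_pos (convex_Ioi 0)
    · intro r hr
      exact (df r hr).continuousAt.continuousWithinAt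
    · intro r hr
      rw [interior_Ioi] at hr
      have hr' : 0 < r := hr
      rw [(df r hr').deriv]
      have := vpos r hr'
      positivity
  · have dq : ∀ r : ℝ, 0 < r → HasDerivAt (fun r => u r / (r * v r)) 0 r := by
      intro r hr
      obtain ⟨h1, h2⟩ := hode r hr
      have hv := vpos r hr
      refine (h1.div ((hasDerivAt_id r).mul h2) (by simp only [Pi.mul_apply, id]; positivity)).congr_deriv ?_
      simp only [id, Pi.mul_apply]
      have k1 := key r hr
      simp only [hH] at k1
      rw [div_eq_zero_iff]
      left
      field_simp
      linear_combination (-2) * k1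
    obtain ⟨k, hk⟩ : ∃ k, k = u 1 / (1 * v 1) := ⟨_, rfl⟩
    have kpos : 0 < k := by
      have := upos 1 one_pos
      have := vpos 1 one_pos
      rw [hk]; positivity
    have hq : ∀ r : ℝ, 0 < r → u r = k * (r * v r) := by
      intro r hr
      have := vpos r hr
      have e : u r / (r * v r) = k := by
        rw [hk]
        exact isOpen_Ioi.is_const_of_deriv_eq_zero (isPreconnected_Ioi (a := (0:ℝ)))
          (fun x hx => (dq x hx).differentiableAt.differentiableWithinAt)
          (fun x hx => (dq x hx).deriv) (Set.mem_Ioi.2 hr) (Set.mem_Ioi.2 one_pos)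
      rw [← e]
      field_simp
    have hlim := limit_aux (β₁ / 2) (2 * β₂ * k ^ 2) k (by positivity) kpos
    refine ⟨√(1 / (β₁ / 2 * k)), by positivity, ?_⟩
    refine ((Real.continuous_sqrt.tendsto _).comp hlim).congr' ?_
    filter_upwards [Filter.eventually_gt_atTop 0] with r hr
    have hv := vpos r hr
    have hu := upos r hr
    simp only [Function.comp]
    rw [← Real.sqrt_sq (show 0 ≤ r * u r by positivity)]
    congr 1
    have k1 := key r hr
    simp only [hH] at k1
    rw [hq r hr] at k1 ⊢
    rw [div_eq_iff (by positivity)]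
    have k2 : (r * v r ^ 2) * k = (r * v r ^ 2) * (v r ^ 2 *
        (β₁ / 2 * (1 + k ^ 4 * r ^ 4) + 2 * β₂ * k ^ 2 * r ^ 2)) := by
      linear_combination k1
    have k3 := mul_left_cancel₀ (by positivity) k2
    linear_combination (k ^ 2 * r ^ 4) * k3
end

section
/- Let 0 < β₂ ≤ β₁, m > 0 and ω ∈ (−m, m). Then there exist λ ≠ 0 and a global solution (u, v) ∈ C^∞([0, +∞), ℝ²) of the massive radial system u'(r) + u(r)/r = (2β₂ u² + β₁ v²) v − (m − ω) v, v'(r) = −(β₁ u² + 2β₂ v²) u − (m + ω) u with u(0) = 0 and v(0) = λ, such that (u(r), v(r)) → (0, 0) as r → +∞ and the solution decays exponentially: there exist C > 0 and a > 0 with u(r)² + v(r)² ≤ C e^{−a r} for all r ≥ 0. -/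
namespace Dirac2D

open Set Filter Topology

/-- weighted averaging operator -/
noncomputable def J (j : ℕ) (G : ℝ → ℝ) (r : ℝ) : ℝ := ∫ t in (0:ℝ)..1, t ^ j * G (r * t)

lemma J_cont {j : ℕ} {G : ℝ → ℝ} (hG : Continuous G) : Continuous (J j G) := by
  unfold J
  apply intervalIntegral.continuous_parametric_intervalIntegral_of_continuous'
  simp only [Function.uncurry_def]
  fun_prop

lemma J_int (j : ℕ) (G : ℝ → ℝ) (r : ℝ) :
    r ^ (j + 1) * J j G r = ∫ s in (0:ℝ)..r, s ^ j * G s := by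
  have h := intervalIntegral.mul_integral_comp_mul_left (a := 0) (b := 1)
    (f := fun s => s ^ j * G s) r
  simp only [mul_zero, mul_one] at h
  rw [← h, pow_succ', mul_assoc, J, ← intervalIntegral.integral_const_mul]
  congr 1
  congr 1
  ext t
  ring

lemma J_sub {j : ℕ} {G G' : ℝ → ℝ} (hG : Continuous G) (hG' : Continuous G') (r : ℝ) :
    J j G r - J j G' r = J j (fun s => G s - G' s) r := by
  unfold J
  rw [← intervalIntegral.integral_sub]
  · congr 1
    ext t
    ring
  · apply Continuous.intervalIntegrable; fun_prop
  · apply Continuous.intervalIntegrable; fun_prop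

lemma J_bound {j : ℕ} {G : ℝ → ℝ} {c K : ℝ} (hK : 0 < K)
    (hc : 0 ≤ c) (h : ∀ s, |G s| ≤ c * Real.exp (K * |s|)) (r : ℝ) :
    |r * J j G r| ≤ c / K * Real.exp (K * |r|) := by
  have h1 : |J j G r| ≤ ∫ t in (0:ℝ)..1, c * Real.exp (K * |r| * t) := by
    rw [← Real.norm_eq_abs, J]
    apply intervalIntegral.norm_integral_le_of_norm_le zero_le_one
    · refine Eventually.of_forall fun t ht => ?_
      have h2 := h (r * t)
      rw [abs_mul, abs_of_pos ht.1, ← mul_assoc] at h2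
      rw [Real.norm_eq_abs, abs_mul, abs_of_nonneg (pow_nonneg ht.1.le j)]
      have : t ^ j ≤ 1 := pow_le_one₀ ht.1.le ht.2
      nlinarith [abs_nonneg (G (r * t)), pow_nonneg ht.1.le j]
    · apply Continuous.intervalIntegrable; fun_prop
  have h3 : K * |r| * ∫ t in (0:ℝ)..1, c * Real.exp (K * |r| * t)
      = c * Real.exp (K * |r|) - c := by
    rw [← intervalIntegral.integral_const_mul]
    rw [intervalIntegral.integral_eq_sub_of_hasDerivAt
      (f := fun t => c * Real.exp (K * |r| * t))]
    · simp
    · intro x _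
      have := (((hasDerivAt_id x).const_mul (K * |r|)).exp).const_mul c
      refine this.congr_deriv ?_
      simp only [id]
      ring
    · apply Continuous.intervalIntegrable; fun_prop
  rw [abs_mul, div_mul_eq_mul_div, le_div_iff₀ hK]
  have := mul_le_mul_of_nonneg_left h1 (by positivity : 0 ≤ K * |r|)
  nlinarith

lemma J_hasDeriv {j : ℕ} {G : ℝ → ℝ} (hG : ContDiff ℝ 1 G) (r : ℝ) :
    HasDerivAt (J j G) (J (j + 1) (deriv G) r) r := by
  have hd : Continuous (deriv G) := hG.continuous_deriv le_rfl
  obtain ⟨M, hM⟩ := (isCompact_Icc (a := -(|r| + 1)) (b := |r| + 1)).exists_bound_of_continuousOn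
    hd.continuousOn
  have := intervalIntegral.hasDerivAt_integral_of_dominated_loc_of_deriv_le
    (μ := MeasureTheory.volume) (a := 0) (b := 1) (bound := fun _ => M)
    (F := fun x t => t ^ j * G (x * t)) (F' := fun x t => t ^ (j + 1) * deriv G (x * t))
    (x₀ := r) (s := Metric.ball r 1) (Metric.ball_mem_nhds r one_pos) ?_ ?_ ?_ ?_ ?_ ?_
  · exact this.2
  · refine Eventually.of_forall fun x => ?_
    have := hG.continuous
    exact Continuous.aestronglyMeasurable (by fun_prop)
  · have := hG.continuous
    exact Continuous.intervalIntegrable (by fun_prop) _ _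
  · exact Continuous.aestronglyMeasurable (by fun_prop)
  · refine Eventually.of_forall fun t ht x hx => ?_
    rw [uIoc_of_le zero_le_one] at ht
    have hx' : |x| ≤ |r| + 1 := by
      have : |x - r| < 1 := hx
      have := abs_add_le (x - r) r
      simp only [sub_add_cancel] at this
      linarith
    have hxt : |x * t| ≤ |r| + 1 := by
      rw [abs_mul, abs_of_pos ht.1]
      nlinarith [abs_nonneg x, ht.1, ht.2]
    have h1 := hM (x * t) (abs_le.mp hxt)
    rw [norm_mul, Real.norm_eq_abs, abs_of_nonneg (pow_nonneg ht.1.le (j+1))]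
    have : t ^ (j+1) ≤ 1 := pow_le_one₀ ht.1.le ht.2
    nlinarith [norm_nonneg (deriv G (x * t)), pow_nonneg ht.1.le (j+1)]
  · exact intervalIntegrable_const
  · refine Eventually.of_forall fun t ht x hx => ?_
    have h1 : HasDerivAt G (deriv G (x * t)) (x * t) :=
      (hG.differentiable one_ne_zero _).hasDerivAt
    have h2 := (h1.comp x ((hasDerivAt_id x).mul_const t)).const_mul (t ^ j)
    refine h2.congr_deriv ?_
    ring

lemma J_contDiff (n : ℕ) : ∀ (j : ℕ) (G : ℝ → ℝ), ContDiff ℝ n G → ContDiff ℝ n (J j G) := by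
  induction n with
  | zero =>
    intro j G hG
    rw [Nat.cast_zero, contDiff_zero] at *
    exact J_cont hG
  | succ n ih =>
    intro j G hG
    have h1 : ContDiff ℝ 1 G := hG.of_le (by exact_mod_cast Nat.succ_le_succ (Nat.zero_le n))
    have hd : deriv (J j G) = J (j + 1) (deriv G) := by
      ext r; exact (J_hasDeriv h1 r).deriv
    push_cast at hG ⊢
    rw [contDiff_succ_iff_deriv] at hG ⊢
    refine ⟨fun r => (J_hasDeriv h1 r).differentiableAt, by simp, ?_⟩
    rw [hd]
    exact ih _ _ hG.2.2

end Dirac2D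

namespace Dirac2D

open Set Filter Topology

noncomputable def T (f g : ℝ × ℝ → ℝ) (v0 : ℝ) (y : ℝ → ℝ × ℝ) (r : ℝ) : ℝ × ℝ :=
  (r * J 1 (fun s => f (y s)) r, v0 + r * J 0 (fun s => g (y s)) r)

lemma T_cont {f g : ℝ × ℝ → ℝ} {v0 : ℝ} {y : ℝ → ℝ × ℝ} (hf : Continuous f) (hg : Continuous g)
    (hy : Continuous y) : Continuous (T f g v0 y) := by
  unfold T
  have h1 : Continuous (J 1 (fun s => f (y s))) := J_cont (hf.comp hy)
  have h2 : Continuous (J 0 (fun s => g (y s))) := J_cont (hg.comp hy)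
  fun_prop

lemma T_dist {f g f' g' : ℝ × ℝ → ℝ} {v0 c K : ℝ} {y y' : ℝ → ℝ × ℝ}
    (hf : Continuous f) (hg : Continuous g) (hf' : Continuous f') (hg' : Continuous g')
    (hy : Continuous y) (hy' : Continuous y') (hK : 0 < K) (hc : 0 ≤ c)
    (h1 : ∀ s, |f (y s) - f' (y' s)| ≤ c * Real.exp (K * |s|))
    (h2 : ∀ s, |g (y s) - g' (y' s)| ≤ c * Real.exp (K * |s|)) (r : ℝ) :
    dist (T f g v0 y r) (T f' g' v0 y' r) ≤ c / K * Real.exp (K * |r|) := by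
  rw [Prod.dist_eq, max_le_iff, Real.dist_eq, Real.dist_eq]
  constructor
  · simp only [T]
    rw [← mul_sub, J_sub (by fun_prop) (by fun_prop)]
    exact J_bound hK hc h1 r
  · simp only [T]
    rw [add_sub_add_left_eq_sub, ← mul_sub, J_sub (by fun_prop) (by fun_prop)]
    exact J_bound hK hc h2 r

lemma T_bound {f g : ℝ × ℝ → ℝ} {v0 M K : ℝ} {y : ℝ → ℝ × ℝ}
    (hK : 0 < K) (hM : 0 ≤ M) (h1 : ∀ x, |f x| ≤ M) (h2 : ∀ x, |g x| ≤ M) (r : ℝ) :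
    ‖T f g v0 y r‖ ≤ (|v0| + M / K) * Real.exp (K * |r|) := by
  have he : 1 ≤ Real.exp (K * |r|) := Real.one_le_exp (by positivity)
  have h3 : ∀ s, M ≤ M * Real.exp (K * |s|) := fun s =>
    le_mul_of_one_le_right hM (Real.one_le_exp (by positivity))
  have hv : |v0| ≤ |v0| * Real.exp (K * |r|) := le_mul_of_one_le_right (abs_nonneg _) he
  rw [Prod.norm_def, max_le_iff, Real.norm_eq_abs, Real.norm_eq_abs]
  constructor
  · have := J_bound (j := 1) (G := fun s => f (y s)) hK hM (fun s => (h1 _).trans (h3 s)) r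
    simp only [T]
    linarith [abs_nonneg v0]
  · have := J_bound (j := 0) (G := fun s => g (y s)) hK hM (fun s => (h2 _).trans (h3 s)) r
    simp only [T]
    have := abs_add_le v0 (r * J 0 (fun s => g (y s)) r)
    linarith

/-- field admissible for the fixed point argument -/
structure Adm (f g : ℝ × ℝ → ℝ) (L M : ℝ) : Prop where
  L0 : 0 < L
  M0 : 0 ≤ M
  f1 : ∀ x y, |f x - f y| ≤ L * dist x y
  g1 : ∀ x y, |g x - g y| ≤ L * dist x y
  f2 : ∀ x, |f x| ≤ M
  g2 : ∀ x, |g x| ≤ M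

lemma cont_of_lip {f : ℝ × ℝ → ℝ} {L : ℝ} (hf : ∀ x y, |f x - f y| ≤ L * dist x y) :
    Continuous f :=
  (LipschitzWith.of_dist_le' (K := L) hf).continuous

noncomputable def W (K : ℝ) (z : BoundedContinuousFunction ℝ (ℝ × ℝ)) (s : ℝ) : ℝ × ℝ :=
  Real.exp (K * |s|) • z s

lemma W_cont (K : ℝ) (z : BoundedContinuousFunction ℝ (ℝ × ℝ)) : Continuous (W K z) := by
  unfold W; fun_prop

lemma W_dist (K : ℝ) (z z' : BoundedContinuousFunction ℝ (ℝ × ℝ)) (s : ℝ) :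
    dist (W K z s) (W K z' s) ≤ dist z z' * Real.exp (K * |s|) := by
  unfold W
  rw [dist_smul₀, Real.norm_eq_abs, abs_of_pos (Real.exp_pos _), mul_comm]
  exact mul_le_mul_of_nonneg_right (BoundedContinuousFunction.dist_coe_le_dist s)
    (Real.exp_pos _).le

noncomputable def Phi {f g : ℝ × ℝ → ℝ} {L M : ℝ} (v0 : ℝ) (h : Adm f g L M)
    (z : BoundedContinuousFunction ℝ (ℝ × ℝ)) : BoundedContinuousFunction ℝ (ℝ × ℝ) :=
  BoundedContinuousFunction.ofNormedAddCommGroup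
    (fun r => Real.exp (-(2 * L * |r|)) • T f g v0 (W (2 * L) z) r)
    (by
      have := T_cont (v0 := v0) (cont_of_lip h.f1) (cont_of_lip h.g1) (W_cont (2 * L) z)
      fun_prop)
    (|v0| + M / (2 * L))
    (by
      intro r
      have hL := h.L0
      have := T_bound (v0 := v0) (y := W (2 * L) z) (by positivity : 0 < 2 * L) h.M0 h.f2 h.g2 r
      rw [norm_smul, Real.norm_eq_abs, abs_of_pos (Real.exp_pos _), Real.exp_neg,
        inv_mul_le_iff₀ (Real.exp_pos _), mul_comm (Real.exp _)]
      exact this)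

lemma Phi_apply {f g : ℝ × ℝ → ℝ} {L M : ℝ} (v0 : ℝ) (h : Adm f g L M)
    (z : BoundedContinuousFunction ℝ (ℝ × ℝ)) (r : ℝ) :
    Phi v0 h z r = Real.exp (-(2 * L * |r|)) • T f g v0 (W (2 * L) z) r := rfl

lemma Phi_dist {f g f' g' : ℝ × ℝ → ℝ} {L M : ℝ} (v0 : ℝ) (h : Adm f g L M) (h' : Adm f' g' L M)
    (z z' : BoundedContinuousFunction ℝ (ℝ × ℝ)) {c : ℝ} (hc : 0 ≤ c)
    (h1 : ∀ s, |f (W (2 * L) z s) - f' (W (2 * L) z' s)| ≤ c * Real.exp (2 * L * |s|))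
    (h2 : ∀ s, |g (W (2 * L) z s) - g' (W (2 * L) z' s)| ≤ c * Real.exp (2 * L * |s|)) :
    dist (Phi v0 h z) (Phi v0 h' z') ≤ c / (2 * L) := by
  have hL := h.L0
  rw [BoundedContinuousFunction.dist_le (by positivity)]
  intro r
  have := T_dist (v0 := v0) (cont_of_lip h.f1) (cont_of_lip h.g1) (cont_of_lip h'.f1)
    (cont_of_lip h'.g1) (W_cont (2 * L) z) (W_cont (2 * L) z') (by positivity : 0 < 2 * L)
    hc h1 h2 r
  rw [Phi_apply, Phi_apply, dist_smul₀, Real.norm_eq_abs, abs_of_pos (Real.exp_pos _), Real.exp_neg,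
        inv_mul_le_iff₀ (Real.exp_pos _), mul_comm (Real.exp _)]
  exact this

lemma Phi_contr {f g : ℝ × ℝ → ℝ} {L M : ℝ} (v0 : ℝ) (h : Adm f g L M) :
    ContractingWith (1 / 2) (Phi v0 h) := by
  have hL := h.L0
  refine ⟨by norm_num, LipschitzWith.of_dist_le_mul fun z z' => ?_⟩
  have := Phi_dist v0 h h z z' (c := L * dist z z') (by positivity) ?_ ?_
  · refine this.trans (le_of_eq ?_)
    push_cast
    field_simp
  · intro s
    refine (h.f1 _ _).trans ?_
    rw [mul_assoc]
    exact mul_le_mul_of_nonneg_left (W_dist _ _ _ _) hL.le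
  · intro s
    refine (h.g1 _ _).trans ?_
    rw [mul_assoc]
    exact mul_le_mul_of_nonneg_left (W_dist _ _ _ _) hL.le

theorem ode_family (f g : ℝ → ℝ × ℝ → ℝ) (I : Set ℝ) (L M v0 : ℝ)
    (h : ∀ e ∈ I, Adm (f e) (g e) L M)
    (hf : ∀ e ∈ I, ∀ e' ∈ I, ∀ x, |f e x - f e' x| ≤ M * |e - e'|)
    (hg : ∀ e ∈ I, ∀ e' ∈ I, ∀ x, |g e x - g e' x| ≤ M * |e - e'|) :
    ∃ Y : ℝ → ℝ → ℝ × ℝ, ∃ C K : ℝ,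
      (∀ e ∈ I, Continuous (Y e) ∧ ∀ r, Y e r = T (f e) (g e) v0 (Y e) r) ∧
      (∀ e ∈ I, ∀ e' ∈ I, ∀ r, dist (Y e r) (Y e' r) ≤ C * |e - e'| * Real.exp (K * |r|)) ∧
      (∀ e ∈ I, ∀ y : ℝ → ℝ × ℝ, Continuous y → (∀ r, y r = T (f e) (g e) v0 y r) → y = Y e) := by
  classical
  have hex : ∀ e, ∃ z : BoundedContinuousFunction ℝ (ℝ × ℝ), ∀ he : e ∈ I,
      Function.IsFixedPt (Phi v0 (h e he)) z := by
    intro e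
    by_cases he : e ∈ I
    · exact ⟨_, fun _ => (Phi_contr v0 (h e he)).fixedPoint_isFixedPt⟩
    · exact ⟨0, fun h => absurd h he⟩
  choose z hz using hex
  refine ⟨fun e => W (2 * L) (z e), M / (2 * L) / (1 - (1 / 2 : NNReal)), 2 * L, ?_, ?_, ?_⟩
  · intro e he
    refine ⟨W_cont _ _, fun r => ?_⟩
    have h1 := congrArg (fun w : BoundedContinuousFunction ℝ (ℝ × ℝ) => w r) (hz e he)
    simp only [Phi_apply] at h1
    show Real.exp (2 * L * |r|) • z e r = _
    rw [← h1, smul_smul, ← Real.exp_add, add_neg_cancel, Real.exp_zero, one_smul]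
  · intro e he e' he' r
    have hL := (h e he).L0
    have hM := (h e he).M0
    have h1 := (Phi_contr v0 (h e he)).dist_fixedPoint_fixedPoint_of_dist_le' (Phi v0 (h e' he'))
      (hz e he) (hz e' he') (C := M * |e - e'| / (2 * L)) ?_
    · refine (W_dist _ _ _ _).trans (mul_le_mul_of_nonneg_right (h1.trans (le_of_eq ?_))
        (Real.exp_pos _).le)
      ring
    · intro w
      have h3 : ∀ s, M * |e - e'| ≤ M * |e - e'| * Real.exp (2 * L * |s|) := fun s =>
        le_mul_of_one_le_right (by positivity) (Real.one_le_exp (by positivity))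
      exact Phi_dist v0 _ _ w w (by positivity) (fun s => (hf e he e' he' _).trans (h3 s))
        (fun s => (hg e he e' he' _).trans (h3 s))
  · intro e he y hy hT
    have hL := (h e he).L0
    let w : BoundedContinuousFunction ℝ (ℝ × ℝ) :=
      BoundedContinuousFunction.ofNormedAddCommGroup
        (fun r => Real.exp (-(2 * L * |r|)) • y r) (by fun_prop) (|v0| + M / (2 * L)) (by
          intro r
          have := T_bound (v0 := v0) (y := y) (by positivity : 0 < 2 * L) (h e he).M0
            (h e he).f2 (h e he).g2 r
          rw [norm_smul, Real.norm_eq_abs, abs_of_pos (Real.exp_pos _), Real.exp_neg,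
            inv_mul_le_iff₀ (Real.exp_pos _), mul_comm (Real.exp _), hT r]
          exact this)
    have hw : W (2 * L) w = y := by
      ext1 r
      show Real.exp (2 * L * |r|) • Real.exp (-(2 * L * |r|)) • y r = y r
      rw [smul_smul, ← Real.exp_add, add_neg_cancel, Real.exp_zero, one_smul]
    have hfix : Function.IsFixedPt (Phi v0 (h e he)) w := by
      ext1 r
      rw [Phi_apply, hw, ← hT r]
      rfl
    rw [← hw, (Phi_contr v0 (h e he)).fixedPoint_unique' hfix (hz e he)]

end Dirac2D

namespace Dirac2D

open Set Filter Topology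

lemma first_hit {φ : ℝ → ℝ} (hc : Continuous φ) {s t : ℝ} (hst : s ≤ t) (hs : 0 < φ s)
    (ht : φ t ≤ 0) : ∃ T, s < T ∧ T ≤ t ∧ φ T = 0 ∧ ∀ r, s ≤ r → r < T → 0 < φ r := by
  let A : Set ℝ := Icc s t ∩ φ ⁻¹' {0}
  have hA : IsCompact A := isCompact_Icc.inter_right (isClosed_singleton.preimage hc)
  have hne : A.Nonempty := by
    obtain ⟨x, hx, hx0⟩ := intermediate_value_Icc' hst hc.continuousOn (show (0:ℝ) ∈ Icc (φ t) (φ s) from ⟨ht, hs.le⟩)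
    exact ⟨x, hx, hx0⟩
  obtain ⟨T, hT, hmin⟩ := hA.exists_isLeast hne
  have hT0 : φ T = 0 := hT.2
  refine ⟨T, lt_of_le_of_ne hT.1.1 ?_, hT.1.2, hT0, fun r h1 h2 => ?_⟩
  · rintro rfl; linarith
  · by_contra hr
    push Not at hr
    obtain ⟨x, hx, hx0⟩ := intermediate_value_Icc' h1 hc.continuousOn (show (0:ℝ) ∈ Icc (φ r) (φ s) from ⟨hr, hs.le⟩)
    have : T ≤ x := hmin ⟨⟨hx.1, by linarith [hx.2, hT.1.2]⟩, hx0⟩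
    linarith [hx.2]

lemma deriv_nonpos_of_hit {φ : ℝ → ℝ} {s T d : ℝ} (hsT : s < T) (hT : φ T = 0)
    (h : ∀ r, s ≤ r → r < T → 0 < φ r) (hd : HasDerivAt φ d T) : d ≤ 0 := by
  have h1 := hd.hasDerivWithinAt (s := Iio T)
  rw [hasDerivWithinAt_iff_tendsto_slope' (by simp)] at h1
  refine le_of_tendsto h1 ?_
  have : Ioo s T ∈ 𝓝[<] T := Ioo_mem_nhdsLT hsT
  filter_upwards [this] with r hr
  rw [slope_def_field, hT]
  exact div_nonpos_of_nonneg_of_nonpos (by have := h r hr.1.le hr.2; linarith) (by linarith [hr.2])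

/-- Hamiltonian -/
noncomputable def Ham (p q a b x y : ℝ) : ℝ :=
  p / 4 * (x ^ 4 + y ^ 4) + q * x ^ 2 * y ^ 2 + a / 2 * x ^ 2 - b / 2 * y ^ 2

lemma Ham_deriv {p q a b r : ℝ} {u v : ℝ → ℝ}
    (hu : HasDerivAt u ((2 * q * u r ^ 2 + p * v r ^ 2) * v r - b * v r - u r / r) r)
    (hv : HasDerivAt v (-((p * u r ^ 2 + 2 * q * v r ^ 2) * u r) - a * u r) r) :
    HasDerivAt (fun r => Ham p q a b (u r) (v r))
      (-(u r ^ 2 / r * (p * u r ^ 2 + 2 * q * v r ^ 2 + a))) r := by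
  unfold Ham
  have h := (((((hu.pow 4).add (hv.pow 4)).const_mul (p / 4)).add
    (((hu.pow 2).const_mul q).mul (hv.pow 2))).add ((hu.pow 2).const_mul (a / 2))).sub
    ((hv.pow 2).const_mul (b / 2))
  refine h.congr_deriv ?_
  simp only [Pi.pow_apply]
  push_cast
  ring

lemma anti_of_deriv {φ φ' : ℝ → ℝ} {s t : ℝ} (hst : s ≤ t) (hc : Continuous φ)
    (h : ∀ r, s < r → r < t → HasDerivAt φ (φ' r) r) (h0 : ∀ r, s < r → r < t → φ' r ≤ 0) :
    φ t ≤ φ s := by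
  have := antitoneOn_of_deriv_nonpos (convex_Icc s t) hc.continuousOn
    (fun x hx => by
      rw [interior_Icc] at hx
      exact (h x hx.1 hx.2).differentiableAt.differentiableWithinAt)
    (fun x hx => by
      rw [interior_Icc] at hx
      rw [(h x hx.1 hx.2).deriv]
      exact h0 x hx.1 hx.2)
  exact this (left_mem_Icc.mpr hst) (right_mem_Icc.mpr hst) hst

/-- Solutions of the radial system. -/
structure Sol (p q a b : ℝ) (u v : ℝ → ℝ) : Prop where
  cu : Continuous u
  cv : Continuous v
  u0 : u 0 = 0
  du : ∀ r, 0 < r → HasDerivAt u ((2 * q * u r ^ 2 + p * v r ^ 2) * v r - b * v r - u r / r) r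
  dv : ∀ r, 0 < r → HasDerivAt v (-((p * u r ^ 2 + 2 * q * v r ^ 2) * u r) - a * u r) r

lemma Sol.cH {p q a b : ℝ} {u v : ℝ → ℝ} (h : Sol p q a b u v) :
    Continuous (fun r => Ham p q a b (u r) (v r)) := by
  unfold Ham
  have := h.cu
  have := h.cv
  fun_prop

lemma Sol.anti {p q a b : ℝ} {u v : ℝ → ℝ} (h : Sol p q a b u v) (hp : 0 < p) (hq : 0 < q)
    (ha : 0 ≤ a) {s t : ℝ} (hs : 0 ≤ s) (hst : s ≤ t) :
    Ham p q a b (u t) (v t) ≤ Ham p q a b (u s) (v s) := by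
  refine anti_of_deriv (φ := fun r => Ham p q a b (u r) (v r)) hst h.cH
    (fun r h1 _ => Ham_deriv (h.du r (by linarith)) (h.dv r (by linarith))) ?_
  intro r h1 _
  have : 0 < r := by linarith
  have : 0 ≤ u r ^ 2 / r * (p * u r ^ 2 + 2 * q * v r ^ 2 + a) := by positivity
  linarith

/-- clamp -/
noncomputable def cl (B x : ℝ) : ℝ := max (-B) (min B x)

lemma cl_abs {B : ℝ} (hB : 0 ≤ B) (x : ℝ) : |cl B x| ≤ B := by
  unfold cl
  rw [abs_le]
  exact ⟨le_max_left _ _, max_le (by linarith) (min_le_left _ _)⟩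

lemma cl_lip (B x y : ℝ) : |cl B x - cl B y| ≤ |x - y| := by
  unfold cl
  refine (abs_max_sub_max_le_max _ _ _ _).trans ?_
  simp only [sub_self, abs_zero]
  refine max_le (abs_nonneg _) ((abs_min_sub_min_le_max _ _ _ _).trans ?_)
  simp

lemma cl_id {B x : ℝ} (h : |x| ≤ B) : cl B x = x := by
  unfold cl
  rw [abs_le] at h
  rw [min_eq_right h.2, max_eq_right h.1]

lemma cl_neg (B x : ℝ) (hB : 0 ≤ B) : cl B (-x) = - cl B x := by
  unfold cl
  rcases le_total B x with h | h <;> rcases le_total (-B) x with h' | h' <;>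
  simp only [max_def, min_def] <;> split_ifs <;> linarith

noncomputable def ff (p q b B e : ℝ) (x : ℝ × ℝ) : ℝ :=
  (2 * q * cl B x.1 ^ 2 + p * cl B x.2 ^ 2) * cl B x.2 - e * b * cl B x.2

noncomputable def gg (p q a B e : ℝ) (x : ℝ × ℝ) : ℝ :=
  -((p * cl B x.1 ^ 2 + 2 * q * cl B x.2 ^ 2) * cl B x.1) - e * a * cl B x.1

lemma cubic_lip {B x y x' y' d : ℝ} (hx : |x| ≤ B) (hx' : |x'| ≤ B)
    (hy' : |y'| ≤ B) (h1 : |x - x'| ≤ d) (h2 : |y - y'| ≤ d) :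
    |x ^ 2 * y - x' ^ 2 * y'| ≤ 3 * B ^ 2 * d := by
  have hB : 0 ≤ B := (abs_nonneg x).trans hx
  have hd : 0 ≤ d := (abs_nonneg _).trans h1
  have e : x ^ 2 * y - x' ^ 2 * y' = x ^ 2 * (y - y') + (x + x') * (x - x') * y' := by ring
  rw [e]
  have a1 : |x ^ 2 * (y - y')| ≤ B ^ 2 * d := by
    rw [abs_mul, abs_pow]
    gcongr
  have a2 : |(x + x') * (x - x') * y'| ≤ (2 * B) * d * B := by
    rw [abs_mul, abs_mul]
    have : |x + x'| ≤ 2 * B := (abs_add_le _ _).trans (by linarith)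
    gcongr
  have := abs_add_le (x ^ 2 * (y - y')) ((x + x') * (x - x') * y')
  nlinarith

lemma cubic_bd {B x y : ℝ} (hx : |x| ≤ B) (hy : |y| ≤ B) : |x ^ 2 * y| ≤ B ^ 3 := by
  have hB : 0 ≤ B := (abs_nonneg x).trans hx
  rw [abs_mul, abs_pow, pow_succ B 2]
  gcongr

lemma lin3 {c1 c2 c3 x y z X Y Z : ℝ} (h1 : 0 ≤ c1) (h2 : 0 ≤ c2) (h3 : 0 ≤ c3)
    (hx : |x| ≤ X) (hy : |y| ≤ Y) (hz : |z| ≤ Z) :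
    |c1 * x + c2 * y - c3 * z| ≤ c1 * X + c2 * Y + c3 * Z := by
  rw [abs_le] at *
  constructor <;> nlinarith

lemma adm {p q a b B E e : ℝ} (hp : 0 < p) (hq : 0 < q) (ha : 0 < a) (hb : 0 < b) (hB : 0 ≤ B)
    (hE : 0 ≤ E) (he : e ∈ Icc 0 E) :
    Adm (ff p q b B e) (gg p q a B e) ((2 * q + p) * (3 * B ^ 2) + E * (a + b) + 1)
      ((2 * q + p) * B ^ 3 + (E + 1) * (a + b) * B) := by
  obtain ⟨he0, he1⟩ := he
  have d1 : ∀ x y : ℝ × ℝ, |cl B x.1 - cl B y.1| ≤ dist x y := fun x y =>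
    (cl_lip _ _ _).trans (by rw [← Real.dist_eq, Prod.dist_eq]; exact le_max_left _ _)
  have d2 : ∀ x y : ℝ × ℝ, |cl B x.2 - cl B y.2| ≤ dist x y := fun x y =>
    (cl_lip _ _ _).trans (by rw [← Real.dist_eq, Prod.dist_eq]; exact le_max_right _ _)
  have heb : e * b ≤ E * b := by gcongr
  have hea : e * a ≤ E * a := by gcongr
  have hEa : 0 ≤ E * a := by positivity
  have hEb : 0 ≤ E * b := by positivity
  have c : ∀ x, |cl B x| ≤ B := cl_abs hB
  refine ⟨by positivity, by positivity, fun x y => ?_, fun x y => ?_, fun x => ?_, fun x => ?_⟩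
  · have h := lin3 (by positivity : 0 ≤ 2 * q) hp.le (by positivity : 0 ≤ e * b)
      (cubic_lip (c x.1) (c y.1) (c y.2) (d1 x y) (d2 x y))
      (cubic_lip (c x.2) (c y.2) (c y.2) (d2 x y) (d2 x y)) (d2 x y)
    have e1 : ff p q b B e x - ff p q b B e y = 2 * q * (cl B x.1 ^ 2 * cl B x.2 - cl B y.1 ^ 2 * cl B y.2)
      + p * (cl B x.2 ^ 2 * cl B x.2 - cl B y.2 ^ 2 * cl B y.2) - e * b * (cl B x.2 - cl B y.2) := by
      unfold ff; ring
    rw [e1]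
    refine h.trans ?_
    nlinarith [dist_nonneg (x := x) (y := y)]
  · have h := lin3 (by positivity : 0 ≤ 2 * q) hp.le (by positivity : 0 ≤ e * a)
      (cubic_lip (c y.2) (c x.2) (c x.1) (d2 y x) (d1 y x))
      (cubic_lip (c y.1) (c x.1) (c x.1) (d1 y x) (d1 y x)) (d1 x y)
    have e1 : gg p q a B e x - gg p q a B e y = 2 * q * (cl B y.2 ^ 2 * cl B y.1 - cl B x.2 ^ 2 * cl B x.1)
      + p * (cl B y.1 ^ 2 * cl B y.1 - cl B x.1 ^ 2 * cl B x.1) - e * a * (cl B x.1 - cl B y.1) := by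
      unfold gg; ring
    rw [e1]
    refine h.trans ?_
    rw [dist_comm y x]
    nlinarith [dist_nonneg (x := x) (y := y)]
  · have h := lin3 (by positivity : 0 ≤ 2 * q) hp.le (by positivity : 0 ≤ e * b)
      (cubic_bd (c x.1) (c x.2)) (cubic_bd (c x.2) (c x.2)) (c x.2)
    have e1 : ff p q b B e x = 2 * q * (cl B x.1 ^ 2 * cl B x.2)
      + p * (cl B x.2 ^ 2 * cl B x.2) - e * b * (cl B x.2) := by
      unfold ff; ring
    rw [e1]
    refine h.trans ?_
    nlinarith
  · have h := lin3 (by positivity : 0 ≤ 2 * q) hp.le (by positivity : 0 ≤ e * a)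
      (cubic_bd (c x.2) (c x.1)) (cubic_bd (c x.1) (c x.1)) (c x.1)
    have e1 : gg p q a B e x = -(2 * q * (cl B x.2 ^ 2 * cl B x.1)
      + p * (cl B x.1 ^ 2 * cl B x.1) - e * a * (-cl B x.1)) := by
      unfold gg; ring
    have h := lin3 (by positivity : 0 ≤ 2 * q) hp.le (by positivity : 0 ≤ e * a)
      (cubic_bd (c x.2) (c x.1)) (cubic_bd (c x.1) (c x.1)) ((abs_neg (cl B x.1)).le.trans (c x.1))
    rw [e1, abs_neg]
    refine h.trans ?_
    nlinarith

lemma ff_e {p q a b B E e e' : ℝ} (hp : 0 < p) (hq : 0 < q) (ha : 0 < a) (hb : 0 < b) (hB : 0 ≤ B)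
    (hE : 0 ≤ E) (x : ℝ × ℝ) : |ff p q b B e x - ff p q b B e' x| ≤
      ((2 * q + p) * B ^ 3 + (E + 1) * (a + b) * B) * |e - e'| := by
  have : ff p q b B e x - ff p q b B e' x = - (b * cl B x.2) * (e - e') := by unfold ff; ring
  rw [this, abs_mul, abs_neg, abs_mul, abs_of_pos hb]
  refine mul_le_mul_of_nonneg_right ?_ (abs_nonneg _)
  have h1 : b * |cl B x.2| ≤ b * B := by gcongr; exact cl_abs hB _
  have h2 : 0 ≤ (2 * q + p) * B ^ 3 + E * (a + b) * B + a * B := by positivity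
  linarith

lemma gg_e {p q a b B E e e' : ℝ} (hp : 0 < p) (hq : 0 < q) (ha : 0 < a) (hb : 0 < b) (hB : 0 ≤ B)
    (hE : 0 ≤ E) (x : ℝ × ℝ) : |gg p q a B e x - gg p q a B e' x| ≤
      ((2 * q + p) * B ^ 3 + (E + 1) * (a + b) * B) * |e - e'| := by
  have : gg p q a B e x - gg p q a B e' x = - (a * cl B x.1) * (e - e') := by unfold gg; ring
  rw [this, abs_mul, abs_neg, abs_mul, abs_of_pos ha]
  refine mul_le_mul_of_nonneg_right ?_ (abs_nonneg _)
  have h1 : a * |cl B x.1| ≤ a * B := by gcongr; exact cl_abs hB _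
  have h2 : 0 ≤ (2 * q + p) * B ^ 3 + E * (a + b) * B + b * B := by positivity
  linarith

end Dirac2D

namespace Dirac2D

open Set Filter Topology

lemma abs_le_of_sq {p B x : ℝ} (hp : 0 < p) (hB : 0 ≤ B) (hpB : p * B ^ 2 = 6)
    (h : p * x ^ 2 ≤ 6) : |x| ≤ B := by
  apply abs_le_of_sq_le_sq _ hB
  nlinarith

lemma apriori {p q a b B e : ℝ} {u v : ℝ → ℝ} (hp : 0 < p) (hq : 0 < q) (ha : 0 < a)
    (hb : 0 < b) (hB : 0 ≤ B) (hpB : p * B ^ 2 = 6) (he : e ∈ Icc 0 (2 / b))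
    (cu : Continuous u) (cv : Continuous v) (u0 : u 0 = 0) (v0 : p * v 0 ^ 2 = 2)
    (du : ∀ r, 0 < r → HasDerivAt u (ff p q b B e (u r, v r) - u r / r) r)
    (dv : ∀ r, 0 < r → HasDerivAt v (gg p q a B e (u r, v r)) r) :
    ∀ r, 0 ≤ r → p * u r ^ 2 ≤ 6 ∧ p * v r ^ 2 ≤ 6 := by
  intro r hr
  by_contra hcon
  have heb0 : 0 ≤ e * b := mul_nonneg he.1 hb.le
  have hea0 : 0 ≤ e * a := mul_nonneg he.1 ha.le
  have heb : e * b ≤ 2 := by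
    have := he.2
    rwa [le_div_iff₀ hb] at this
  obtain ⟨T, hT0, -, hT, hbef⟩ := first_hit (φ := fun r => min (6 - p * u r ^ 2) (6 - p * v r ^ 2))
    (by fun_prop) hr (by rw [u0, v0]; norm_num) (by
      by_contra h
      push Not at h
      rw [lt_min_iff] at h
      exact hcon ⟨by linarith [h.1], by linarith [h.2]⟩)
  have hH : Ham p q (e * a) (e * b) (u T) (v T) ≤ Ham p q (e * a) (e * b) (u 0) (v 0) := by
    refine anti_of_deriv (φ := fun r => Ham p q (e * a) (e * b) (u r) (v r)) (s := 0) (t := T)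
      (φ' := fun r => (-(u r ^ 2 / r * (p * u r ^ 2 + 2 * q * v r ^ 2 + e * a)))) hT0.le
      (by unfold Ham; fun_prop) ?_ ?_
    · intro s hs hsT
      have h1 := hbef s hs.le hsT
      rw [lt_min_iff] at h1
      have hu : cl B (u s) = u s := cl_id (abs_le_of_sq hp hB hpB (by linarith [h1.1]))
      have hv : cl B (v s) = v s := cl_id (abs_le_of_sq hp hB hpB (by linarith [h1.2]))
      have h2 := du s hs
      have h3 := dv s hs
      simp only [ff, gg, hu, hv] at h2 h3
      exact Ham_deriv h2 h3
    · intro s hs hsT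
      have : 0 ≤ u s ^ 2 / s * (p * u s ^ 2 + 2 * q * v s ^ 2 + e * a) := by positivity
      linarith
  have hH' := mul_le_mul_of_nonneg_left hH hp.le
  have e1 : p * Ham p q (e * a) (e * b) (u T) (v T) = ((p * u T ^ 2) ^ 2 + (p * v T ^ 2) ^ 2) / 4
    + p * q * u T ^ 2 * v T ^ 2 + p * (e * a) / 2 * u T ^ 2 - (e * b) / 2 * (p * v T ^ 2) := by
    unfold Ham; ring
  have e2 : p * Ham p q (e * a) (e * b) (u 0) (v 0) = (p * v 0 ^ 2) ^ 2 / 4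
     - (e * b) / 2 * (p * v 0 ^ 2) := by
    rw [u0]; unfold Ham; ring
  rw [e1, e2, v0] at hH'
  have p1 : 0 ≤ p * q * u T ^ 2 * v T ^ 2 := by positivity
  have p2 : 0 ≤ p * (e * a) / 2 * u T ^ 2 := by positivity
  have hy0 : 0 ≤ p * v T ^ 2 := by positivity
  have hT : min (6 - p * u T ^ 2) (6 - p * v T ^ 2) = 0 := hT
  generalize p * u T ^ 2 = x at *
  generalize p * v T ^ 2 = y at *
  rcases min_choice (6 - x) (6 - y) with h | h
  · have hx : x = 6 := by linarith
    have hy : y ≤ 6 := by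
      have := min_le_right (6 - x) (6 - y); linarith
    subst hx
    nlinarith
  · have hy : y = 6 := by linarith
    subst hy
    nlinarith

lemma T_deriv {f g : ℝ × ℝ → ℝ} {w0 : ℝ} {y : ℝ → ℝ × ℝ} (hf : Continuous f) (hg : Continuous g)
    (hy : Continuous y) (hT : ∀ r, y r = T f g w0 y r) :
    (∀ r, HasDerivAt (fun r => (y r).1) (f (y r) - J 1 (fun s => f (y s)) r) r) ∧
    (∀ r, HasDerivAt (fun r => (y r).2) (g (y r)) r) ∧
    (∀ r, (y r).1 = r * J 1 (fun s => f (y s)) r) ∧ (y 0).2 = w0 := by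
  have e1 : ∀ r, (y r).1 = r * J 1 (fun s => f (y s)) r := fun r => by rw [hT r]; simp only [T]
  have e2 : ∀ r, (y r).2 = w0 + r * J 0 (fun s => g (y s)) r := fun r => by
    rw [hT r]; simp only [T]
  refine ⟨fun r => ?_, fun r => ?_, e1, ?_⟩
  · have hfy : Continuous (fun s => f (y s)) := by fun_prop
    rcases eq_or_ne r 0 with rfl | hr
    · have hJ0 : J 1 (fun s => f (y s)) 0 = f (y 0) / 2 := by
        simp only [J, zero_mul, pow_one, intervalIntegral.integral_mul_const, integral_id]
        ring
      have : f (y 0) - J 1 (fun s => f (y s)) 0 = J 1 (fun s => f (y s)) 0 := by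
        rw [hJ0]; ring
      rw [this, hasDerivAt_iff_tendsto_slope]
      have hc : Tendsto (J 1 (fun s => f (y s))) (𝓝[≠] 0) (𝓝 (J 1 (fun s => f (y s)) 0)) :=
        ((J_cont hfy).tendsto 0).mono_left nhdsWithin_le_nhds
      refine hc.congr' ?_
      filter_upwards [self_mem_nhdsWithin] with s hs
      have hs' : s ≠ 0 := hs
      rw [slope_def_field, e1 s, e1 0]
      field_simp
      ring
    · have hI : HasDerivAt (fun r => ∫ s in (0:ℝ)..r, s ^ 1 * f (y s)) (r ^ 1 * f (y r)) r := by
        have hc : Continuous (fun s => s ^ 1 * f (y s)) := by fun_prop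
        exact intervalIntegral.integral_hasDerivAt_right (hc.intervalIntegrable _ _)
          (hc.stronglyMeasurableAtFilter _ _) hc.continuousAt
      have h2 := hI.div (hasDerivAt_id r) hr
      have h3 : HasDerivAt (fun r => (y r).1) _ r := h2.congr_of_eventuallyEq (by
        filter_upwards [isOpen_ne.mem_nhds hr] with s hs
        have hs' : s ≠ 0 := hs
        rw [Pi.div_apply, ← J_int, e1 s, id]
        field_simp
        ring)
      refine h3.congr_deriv ?_
      rw [← J_int]
      simp only [id]
      field_simp
      ring
  · have hI : HasDerivAt (fun r => ∫ s in (0:ℝ)..r, s ^ 0 * g (y s)) (r ^ 0 * g (y r)) r := by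
      have hc : Continuous (fun s => s ^ 0 * g (y s)) := by fun_prop
      exact intervalIntegral.integral_hasDerivAt_right (hc.intervalIntegrable _ _)
          (hc.stronglyMeasurableAtFilter _ _) hc.continuousAt
    have h2 : (fun r => (y r).2) = fun r => w0 + ∫ s in (0:ℝ)..r, s ^ 0 * g (y s) := by
      ext r
      rw [e2 r, ← J_int]
      ring
    rw [h2]
    refine (hI.const_add w0).congr_deriv ?_
    ring
  · rw [e2 0]; ring

lemma smooth_of {u v : ℝ → ℝ} {P R : ℝ × ℝ → ℝ} (hP : ∀ n : ℕ, ContDiff ℝ n P)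
    (hR : ∀ n : ℕ, ContDiff ℝ n R)
    (cu : Continuous u) (cv : Continuous v)
    (du : ∀ r, HasDerivAt u (P (u r, v r) - J 1 (fun s => P (u s, v s)) r) r)
    (dv : ∀ r, HasDerivAt v (R (u r, v r)) r) (n : ℕ) : ContDiff ℝ n u ∧ ContDiff ℝ n v := by
  induction n with
  | zero =>
    rw [Nat.cast_zero, contDiff_zero, contDiff_zero]
    exact ⟨cu, cv⟩
  | succ n ih =>
    have hPu : ContDiff ℝ n (fun s => P (u s, v s)) := (hP n).comp (ih.1.prodMk ih.2)
    have hRu : ContDiff ℝ n (fun s => R (u s, v s)) := (hR n).comp (ih.1.prodMk ih.2)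
    have d1 : deriv u = fun r => P (u r, v r) - J 1 (fun s => P (u s, v s)) r := by
      ext r; exact (du r).deriv
    have d2 : deriv v = fun r => R (u r, v r) := by
      ext r; exact (dv r).deriv
    push_cast
    rw [contDiff_succ_iff_deriv, contDiff_succ_iff_deriv, d1, d2]
    exact ⟨⟨fun r => (du r).differentiableAt, by simp, hPu.sub (J_contDiff n _ _ hPu)⟩,
      ⟨fun r => (dv r).differentiableAt, by simp, hRu⟩⟩

noncomputable def Dn (p q r : ℝ) : ℝ := p / 2 * (1 + r ^ 4) + 2 * q * r ^ 2

lemma Dn_pos {p q : ℝ} (hp : 0 < p) (hq : 0 < q) (r : ℝ) : 0 < Dn p q r := by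
  unfold Dn; positivity

lemma sqrtDn_deriv {p q : ℝ} (hp : 0 < p) (hq : 0 < q) (r : ℝ) :
    HasDerivAt (fun r => √(Dn p q r)) ((p * r ^ 3 + 2 * q * r) / √(Dn p q r)) r := by
  have h1 : HasDerivAt (Dn p q) (2 * p * r ^ 3 + 4 * q * r) r := by
    unfold Dn
    have := ((((hasDerivAt_id r).pow 4).const_add 1).const_mul (p / 2)).add
      (((hasDerivAt_id r).pow 2).const_mul (2 * q))
    refine this.congr_deriv ?_
    simp only [id]
    push_cast
    ring
  refine (h1.sqrt (Dn_pos hp hq r).ne').congr_deriv ?_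
  have := (Real.sqrt_pos.mpr (Dn_pos hp hq r)).ne'
  field_simp
  ring

lemma massless {p q a b B : ℝ} (hp : 0 < p) (hq : 0 < q)
    (hB : 0 ≤ B) (hpB : p * B ^ 2 = 6) :
    ∀ r, ((r / √(Dn p q r), 1 / √(Dn p q r)) : ℝ × ℝ) = T (ff p q b B 0) (gg p q a B 0) (√(2 / p))
      (fun r => (r / √(Dn p q r), 1 / √(Dn p q r))) r := by
  have hs0 : ∀ r, √(Dn p q r) ≠ 0 := fun r => (Real.sqrt_pos.mpr (Dn_pos hp hq r)).ne'
  have hsq : ∀ r, √(Dn p q r) ^ 2 = Dn p q r := fun r => Real.sq_sqrt (Dn_pos hp hq r).le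
  have c1 : ∀ r, cl B (r / √(Dn p q r)) = r / √(Dn p q r) := fun r => by
    apply cl_id
    apply abs_le_of_sq hp hB hpB
    rw [div_pow, hsq, mul_div_assoc', div_le_iff₀ (Dn_pos hp hq r)]
    unfold Dn
    have : 0 ≤ q * r ^ 2 := by positivity
    nlinarith [sq_nonneg (r ^ 2 - 1), sq_nonneg (r^2)]
  have c2 : ∀ r, cl B (1 / √(Dn p q r)) = 1 / √(Dn p q r) := fun r => by
    apply cl_id
    apply abs_le_of_sq hp hB hpB
    rw [div_pow, hsq, mul_div_assoc', div_le_iff₀ (Dn_pos hp hq r)]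
    unfold Dn
    have : 0 ≤ q * r ^ 2 := by positivity
    have : 0 ≤ p * r ^ 4 := by positivity
    nlinarith
  have hcD : Continuous (fun r => √(Dn p q r)) := by unfold Dn; fun_prop
  intro r
  have I1 := J_int 1 (fun s => ff p q b B 0 (s / √(Dn p q s), 1 / √(Dn p q s))) r
  have I2 := J_int 0 (fun s => gg p q a B 0 (s / √(Dn p q s), 1 / √(Dn p q s))) r
  rw [intervalIntegral.integral_eq_sub_of_hasDerivAt (f := fun s => s ^ 2 / √(Dn p q s))] at I1
  rw [intervalIntegral.integral_eq_sub_of_hasDerivAt (f := fun s => 1 / √(Dn p q s))] at I2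
  · have h0 : 1 / √(Dn p q 0) = √(2 / p) := by
      have : Dn p q 0 = (2 / p)⁻¹ := by unfold Dn; field_simp; ring
      rw [this, Real.sqrt_inv, one_div, inv_inv]
    unfold T
    refine Prod.ext ?_ ?_
    · simp only
      rcases eq_or_ne r 0 with rfl | hr
      · simp
      · have : r * (r * J 1 (fun s => ff p q b B 0 (s / √(Dn p q s), 1 / √(Dn p q s))) r)
          = r * (r / √(Dn p q r)) := by
          simp only [ne_eq, OfNat.ofNat_ne_zero, not_false_eq_true, zero_pow, zero_div, sub_zero] at I1
          rw [← mul_assoc, ← pow_two, I1]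
          ring
        exact (mul_left_cancel₀ hr this).symm
    · simp only
      simp only [zero_add, pow_one] at I2
      rw [I2, h0]
      ring
  · intro s _
    have h := (hasDerivAt_const s (1:ℝ)).div (sqrtDn_deriv hp hq s) (hs0 s)
    refine h.congr_deriv ?_
    simp only [gg, c1, c2]
    have := hs0 s
    field_simp
    ring
  · apply Continuous.intervalIntegrable
    simp only [gg, c1, c2]
    fun_prop (disch := exact hs0 _)
  · intro s _
    have h := ((hasDerivAt_id s).pow 2).div (sqrtDn_deriv hp hq s) (hs0 s)
    refine h.congr_deriv ?_
    simp only [ff, c1, c2, id, Pi.pow_apply]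
    have h1 := hs0 s
    have h2 := hsq s
    push_cast
    field_simp
    rw [h2]
    unfold Dn
    ring
  · apply Continuous.intervalIntegrable
    simp only [ff, c1, c2]
    fun_prop (disch := exact hs0 _)

theorem family {p q a b : ℝ} (hp : 0 < p) (hq : 0 < q) (ha : 0 < a) (hb : 0 < b) :
    ∃ U V : ℝ → ℝ → ℝ, ∃ C K : ℝ,
      (∀ e ∈ Icc 0 (2 / b), Sol p q (e * a) (e * b) (U e) (V e) ∧ V e 0 = √(2 / p) ∧
        ContDiff ℝ (⊤ : ℕ∞) (U e) ∧ ContDiff ℝ (⊤ : ℕ∞) (V e) ∧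
        ∀ r, 0 ≤ r → p * U e r ^ 2 ≤ 6 ∧ p * V e r ^ 2 ≤ 6) ∧
      (∀ e ∈ Icc 0 (2 / b), ∀ e' ∈ Icc 0 (2 / b), ∀ r, 0 ≤ r →
        |U e r - U e' r| ≤ C * |e - e'| * Real.exp (K * r) ∧
        |V e r - V e' r| ≤ C * |e - e'| * Real.exp (K * r)) ∧
      (∀ r, U 0 r = r / √(Dn p q r) ∧ V 0 r = 1 / √(Dn p q r)) := by
  have hE : 0 ≤ 2 / b := by positivity
  let B := √(6 / p)
  have hB : 0 ≤ B := Real.sqrt_nonneg _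
  have hpB : p * B ^ 2 = 6 := by
    rw [Real.sq_sqrt (by positivity)]; field_simp
  obtain ⟨Y, C, K, h1, h2, h3⟩ := ode_family (fun e => ff p q b B e) (fun e => gg p q a B e)
    (Icc 0 (2 / b)) _ _ (√(2 / p)) (fun e he => adm hp hq ha hb hB hE he)
    (fun e _ e' _ x => ff_e hp hq ha hb hB hE x) (fun e _ e' _ x => gg_e hp hq ha hb hB hE x)
  refine ⟨fun e r => (Y e r).1, fun e r => (Y e r).2, C, K, ?_, ?_, ?_⟩
  · intro e he
    obtain ⟨hYc, hYT⟩ := h1 e he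
    have had := adm hp hq ha hb hB hE he
    obtain ⟨d1, d2, e1, e2⟩ := T_deriv (cont_of_lip had.f1) (cont_of_lip had.g1) hYc hYT
    have u0 : (Y e 0).1 = 0 := by rw [e1]; ring
    have v0 : p * (Y e 0).2 ^ 2 = 2 := by
      rw [e2, Real.sq_sqrt (by positivity)]; field_simp
    have d1' : ∀ r, r ≠ 0 → HasDerivAt (fun r => (Y e r).1)
        (ff p q b B e ((Y e r).1, (Y e r).2) - (Y e r).1 / r) r := by
      intro r hr
      refine (d1 r).congr_deriv ?_
      have : (Y e r).1 / r = J 1 (fun s => ff p q b B e (Y e s)) r := by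
        rw [e1 r]
        field_simp
      rw [this]
    have cu : Continuous (fun r => (Y e r).1) := by fun_prop
    have cv : Continuous (fun r => (Y e r).2) := by fun_prop
    have A1 := apriori hp hq ha hb hB hpB he cu cv u0 v0 (fun r hr => d1' r hr.ne')
      (fun r _ => d2 r)
    have A2 := apriori (u := fun r => -(Y e (-r)).1) (v := fun r => (Y e (-r)).2)
      hp hq ha hb hB hpB he (by fun_prop) (by fun_prop)
      (by simp [u0]) (by simpa using v0) (fun r hr => by
        have := ((d1' (-r) (by linarith)).comp r (hasDerivAt_neg r)).neg
        refine this.congr_deriv ?_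
        simp only [ff, cl_neg _ _ hB]
        field_simp) (fun r hr => by
        have := ((d2 (-r)).comp r (hasDerivAt_neg r))
        refine this.congr_deriv ?_
        simp only [gg, cl_neg _ _ hB]
        ring)
    have A : ∀ r, p * (Y e r).1 ^ 2 ≤ 6 ∧ p * (Y e r).2 ^ 2 ≤ 6 := by
      intro r
      rcases le_total 0 r with h | h
      · exact A1 r h
      · simpa using A2 (-r) (by linarith)
    have k1 : ∀ r, cl B (Y e r).1 = (Y e r).1 := fun r => cl_id (abs_le_of_sq hp hB hpB (A r).1)
    have k2 : ∀ r, cl B (Y e r).2 = (Y e r).2 := fun r => cl_id (abs_le_of_sq hp hB hpB (A r).2)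
    have S := smooth_of (u := fun r => (Y e r).1) (v := fun r => (Y e r).2)
      (P := fun x => (2 * q * x.1 ^ 2 + p * x.2 ^ 2) * x.2 - e * b * x.2)
      (R := fun x => -((p * x.1 ^ 2 + 2 * q * x.2 ^ 2) * x.1) - e * a * x.1)
      (fun n => by fun_prop) (fun n => by fun_prop) cu cv
      (fun r => by
        have := d1 r
        simp only [ff, k1, k2] at this
        exact this)
      (fun r => by
        have := d2 r
        simp only [gg, k1, k2] at this
        exact this)
    refine ⟨⟨cu, cv, u0, fun r hr => ?_, fun r hr => ?_⟩, e2, ?_, ?_, fun r _ => A r⟩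
    · have := d1' r hr.ne'
      simp only [ff, k1, k2] at this
      exact this
    · have := d2 r
      simp only [gg, k1, k2] at this
      exact this
    · exact contDiff_infty.mpr fun n => (S n).1
    · exact contDiff_infty.mpr fun n => (S n).2
  · intro e he e' he' r hr
    have := h2 e he e' he' r
    rw [abs_of_nonneg hr, Prod.dist_eq, max_le_iff, Real.dist_eq, Real.dist_eq] at this
    exact this
  · have hs0 : ∀ r, √(Dn p q r) ≠ 0 := fun r => (Real.sqrt_pos.mpr (Dn_pos hp hq r)).ne'
    have hcD : Continuous (fun r => √(Dn p q r)) := by unfold Dn; fun_prop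
    have := h3 0 ⟨le_rfl, hE⟩ (fun r => (r / √(Dn p q r), 1 / √(Dn p q r)))
      (by fun_prop (disch := exact hs0 _)) (massless hp hq hB hpB)
    intro r
    simp only [← this]
    exact ⟨trivial, trivial⟩

end Dirac2D

namespace Dirac2D

open Set Filter Topology

lemma anti_of_deriv' {φ φ' : ℝ → ℝ} {s t : ℝ} (hst : s ≤ t) (hc : ContinuousOn φ (Icc s t))
    (h : ∀ r, s < r → r < t → HasDerivAt φ (φ' r) r) (h0 : ∀ r, s < r → r < t → φ' r ≤ 0) :
    φ t ≤ φ s := by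
  have := antitoneOn_of_deriv_nonpos (convex_Icc s t) hc
    (fun x hx => by
      rw [interior_Icc] at hx
      exact (h x hx.1 hx.2).differentiableAt.differentiableWithinAt)
    (fun x hx => by
      rw [interior_Icc] at hx
      rw [(h x hx.1 hx.2).deriv]
      exact h0 x hx.1 hx.2)
  exact this (left_mem_Icc.mpr hst) (right_mem_Icc.mpr hst) hst

lemma Sol.dz {p q a b : ℝ} {u v : ℝ → ℝ} (h : Sol p q a b u v) (r : ℝ) (hr : 0 < r) :
    HasDerivAt (fun r => r * u r) (r * (v r * (2 * q * u r ^ 2 + p * v r ^ 2 - b))) r := by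
  refine ((hasDerivAt_id r).mul (h.du r hr)).congr_deriv ?_
  simp only [id]
  field_simp
  ring

lemma Ham_pos_aux {p q a b v : ℝ} (hv : 0 < v) (h : 0 ≤ Ham p q a b 0 v) :
    2 * b ≤ p * v ^ 2 := by
  unfold Ham at h
  have e : p / 4 * (0 ^ 4 + v ^ 4) + q * 0 ^ 2 * v ^ 2 + a / 2 * 0 ^ 2 - b / 2 * v ^ 2
    = v ^ 2 * (p * v ^ 2 - 2 * b) / 4 := by ring
  rw [e] at h
  by_contra hc
  push Not at hc
  have : 0 < v ^ 2 := by positivity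
  nlinarith

lemma Sol.u_pos {p q a b : ℝ} {u v : ℝ → ℝ} (h : Sol p q a b u v) (hq : 0 < q) (hb : 0 < b)
    (hv : ∀ r, 0 ≤ r → 0 < v r) (hH : ∀ r, 0 ≤ r → 0 ≤ Ham p q a b (u r) (v r)) :
    ∀ r, 0 < r → 0 < u r := by
  have h0 : b < p * v 0 ^ 2 := by
    have h1 := hH 0 le_rfl
    rw [h.u0] at h1
    have := Ham_pos_aux (hv 0 le_rfl) h1
    linarith
  have hcv := h.cv
  have hev : ∀ᶠ r in 𝓝 (0:ℝ), b < p * v r ^ 2 :=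
    (by fun_prop : Continuous fun r => p * v r ^ 2).continuousAt.eventually_const_lt h0
  obtain ⟨δ, hδ, hball⟩ := Metric.eventually_nhds_iff.mp hev
  have hnear : ∀ r, 0 < r → r < δ → 0 < u r := by
    intro r hr hrd
    have hmono : StrictMonoOn (fun r => r * u r) (Icc 0 r) := by
      have hcu := h.cu
      refine strictMonoOn_of_deriv_pos (convex_Icc 0 r) (by fun_prop) ?_
      intro x hx
      rw [interior_Icc] at hx
      rw [(h.dz x hx.1).deriv]
      have h1 : b < p * v x ^ 2 := hball (by rw [Real.dist_eq, sub_zero, abs_of_pos hx.1]; linarith [hx.2])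
      have h2 := hv x hx.1.le
      have h3 : 0 < 2 * q * u x ^ 2 + p * v x ^ 2 - b := by
        have : 0 ≤ 2 * q * u x ^ 2 := by positivity
        linarith
      exact mul_pos hx.1 (mul_pos h2 h3)
    have := hmono (left_mem_Icc.mpr hr.le) (right_mem_Icc.mpr hr.le) hr
    simp only [zero_mul] at this
    exact pos_of_mul_pos_right this hr.le
  intro r hr
  by_contra hc
  push Not at hc
  have hrd : δ / 2 ≤ r := by
    by_contra hlt
    push Not at hlt
    exact absurd (hnear r hr (by linarith)) (not_lt.mpr hc)
  obtain ⟨T, hT1, -, hT, hbef⟩ := first_hit h.cu hrd (hnear (δ / 2) (by linarith) (by linarith)) hc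
  have hT0 : 0 < T := by linarith
  have hd := deriv_nonpos_of_hit hT1 hT hbef (h.du T hT0)
  have h1 := hH T hT0.le
  rw [hT] at h1 hd
  have h2 := Ham_pos_aux (hv T hT0.le) h1
  have e : (2 * q * 0 ^ 2 + p * v T ^ 2) * v T - b * v T - 0 / T = v T * (p * v T ^ 2 - b) := by ring
  rw [e] at hd
  have := mul_pos (hv T hT0.le) (by linarith : 0 < p * v T ^ 2 - b)
  linarith

lemma Sol.decay {p q a b : ℝ} {u v : ℝ → ℝ} (h : Sol p q a b u v) (hp : 0 < p) (hq : 0 < q)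
    (ha : 0 < a) (hb : 0 < b)
    (hbd : ∀ r, 0 ≤ r → p * u r ^ 2 ≤ 6 ∧ p * v r ^ 2 ≤ 6)
    (hv : ∀ r, 0 ≤ r → 0 < v r) (hH : ∀ r, 0 ≤ r → 0 ≤ Ham p q a b (u r) (v r)) :
    ∃ C κ : ℝ, 0 < C ∧ 0 < κ ∧ ∀ r, 0 ≤ r → u r ^ 2 + v r ^ 2 ≤ C * Real.exp (-κ * r) := by
  have hu := h.u_pos hq hb hv hH
  have hcu := h.cu
  have hcv := h.cv
  have step2 : ∃ R, 1 ≤ R ∧ p * v R ^ 2 ≤ b := by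
    by_contra hcon
    push Not at hcon
    have hc0 := hu 1 one_pos
    have hz : ∀ r, 1 ≤ r → u 1 ≤ r * u r := by
      intro r hr
      have := anti_of_deriv (φ := fun r => -(r * u r)) hr (by fun_prop)
        (fun x hx _ => (h.dz x (by linarith)).neg) (fun x hx _ => by
          have h1 := hcon x hx.le
          have h2 := hv x (by linarith)
          have h3 : 0 ≤ 2 * q * u x ^ 2 + p * v x ^ 2 - b := by
            have : 0 ≤ 2 * q * u x ^ 2 := by positivity
            linarith
          have : 0 ≤ x * (v x * (2 * q * u x ^ 2 + p * v x ^ 2 - b)) :=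
            mul_nonneg (by linarith) (mul_nonneg h2.le h3)
          linarith)
      simp only [one_mul] at this
      linarith
    have hle : ∀ r, 1 ≤ r → v r + a * u 1 * Real.log r ≤ v 1 := by
      intro r hr
      have := anti_of_deriv' (φ := fun r => v r + a * u 1 * Real.log r) hr
        (ContinuousOn.add hcv.continuousOn (continuousOn_const.mul
          (Real.continuousOn_log.mono fun x hx => by
            have := hx.1; simp only [mem_compl_iff, mem_singleton_iff]; linarith)))
        (fun x hx _ => (h.dv x (by linarith)).add
          ((Real.hasDerivAt_log (by linarith)).const_mul (a * u 1))) (fun x hx _ => by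
          have hx0 : 0 < x := by linarith
          have h1 := hz x hx.le
          have h2 : u 1 * x⁻¹ ≤ u x := by
            rw [← div_eq_mul_inv, div_le_iff₀ hx0]; linarith
          have h3 : a * (u 1 * x⁻¹) ≤ a * u x := mul_le_mul_of_nonneg_left h2 ha.le
          have h4 : 0 ≤ (p * u x ^ 2 + 2 * q * v x ^ 2) * u x :=
            mul_nonneg (by positivity) (hu x hx0).le
          linarith)
      simpa using this
    have hv1 := hv 1 zero_le_one
    have hX : 0 ≤ v 1 / (a * u 1) := by positivity
    have h1 := hle (Real.exp (v 1 / (a * u 1))) (Real.one_le_exp hX)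
    have h2 := hv (Real.exp (v 1 / (a * u 1))) (Real.exp_pos _).le
    rw [Real.log_exp, mul_div_cancel₀ _ (by positivity)] at h1
    linarith
  obtain ⟨R, hR1, hR⟩ := step2
  have hvanti : ∀ r, R ≤ r → v r ≤ v R := by
    intro r hr
    refine anti_of_deriv hr hcv (fun x hx _ => h.dv x (by linarith)) (fun x hx _ => ?_)
    have hux := hu x (by linarith)
    have h4 : 0 ≤ (p * u x ^ 2 + 2 * q * v x ^ 2) * u x := by positivity
    have : 0 < a * u x := by positivity
    linarith
  have hvb : ∀ r, R ≤ r → p * v r ^ 2 ≤ b := by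
    intro r hr
    have h1 := hvanti r hr
    have h2 := hv r (by linarith)
    have : v r ^ 2 ≤ v R ^ 2 := by gcongr
    have : p * v r ^ 2 ≤ p * v R ^ 2 := by gcongr
    linarith
  obtain ⟨c, hc, huc⟩ : ∃ c, 0 < c ∧ ∀ r, R ≤ r → c * v r ≤ u r := by
    refine ⟨√(b / (4 * (3 / 2 + 6 * q / p + a / 2))), Real.sqrt_pos.mpr (by positivity), ?_⟩
    intro r hr
    have hr0 : 0 < r := by linarith
    apply le_of_sq_le_sq _ (hu r hr0).le
    rw [mul_pow, Real.sq_sqrt (by positivity), div_mul_eq_mul_div, div_le_iff₀ (by positivity)]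
    have h1 := hH r hr0.le
    unfold Ham at h1
    obtain ⟨h2, h3⟩ := hbd r hr0.le
    have h4 := hvb r hr
    have h5 : p * v r ^ 2 * v r ^ 2 ≤ b * v r ^ 2 := by gcongr
    have h6 : p * u r ^ 2 * u r ^ 2 ≤ 6 * u r ^ 2 := by gcongr
    have h7 : q * v r ^ 2 ≤ 6 * q / p := by
      rw [le_div_iff₀ hp]; nlinarith
    have h8 : q * v r ^ 2 * u r ^ 2 ≤ 6 * q / p * u r ^ 2 := by gcongr
    nlinarith
  set M := (12 * q / p + 1) / a with hM
  have hM0 : 0 < M := by positivity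
  have hMa : M * a = 12 * q / p + 1 := by rw [hM]; field_simp
  set κ := c / (c + M) with hκ
  have hκ0 : 0 < κ := by positivity
  have hy : ∀ r, R ≤ r → (u r + M * v r) * Real.exp (κ * r) ≤ (u R + M * v R) * Real.exp (κ * R) := by
    intro r hr
    refine anti_of_deriv (φ := fun r => (u r + M * v r) * Real.exp (κ * r)) hr (by fun_prop)
      (fun x hx _ => ((h.du x (by linarith)).add ((h.dv x (by linarith)).const_mul M)).mul
        (((hasDerivAt_id x).const_mul κ).exp)) (fun x hx _ => ?_)
    have hx0 : 0 < x := by linarith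
    have hux := hu x hx0
    have hvx := hv x hx0.le
    simp only [id, mul_one, Pi.add_apply]
    have hke : κ * (u x + M * v x) ≤ u x := by
      rw [hκ, div_mul_eq_mul_div, div_le_iff₀ (by positivity)]
      have := mul_le_mul_of_nonneg_left (huc x hx.le) hM0.le
      linarith
    obtain ⟨b1, b2⟩ := hbd x hx0.le
    have huv : u x * v x ≤ 6 / p := by
      rw [le_div_iff₀ hp]
      nlinarith [sq_nonneg (u x - v x)]
    have t1 : 2 * q * u x * (u x * v x) ≤ 2 * q * u x * (6 / p) := by gcongr
    have t2 : v x * (p * v x ^ 2 - b) ≤ 0 :=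
      mul_nonpos_of_nonneg_of_nonpos hvx.le (by linarith [hvb x hx.le])
    have t3 : 0 ≤ u x / x := by positivity
    have t4 : 0 ≤ M * ((p * u x ^ 2 + 2 * q * v x ^ 2) * u x) := by positivity
    have t5 : M * (a * u x) = (12 * q / p + 1) * u x := by rw [← mul_assoc, hMa]
    have t6 : 2 * q * u x * (6 / p) = 12 * q / p * u x := by ring
    have key : ((2 * q * u x ^ 2 + p * v x ^ 2) * v x - b * v x - u x / x)
        + M * (-((p * u x ^ 2 + 2 * q * v x ^ 2) * u x) - a * u x) ≤ - (κ * (u x + M * v x)) := by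
      nlinarith
    have he := Real.exp_pos (κ * x)
    nlinarith
  set Y := (u R + M * v R) * Real.exp (κ * R) with hY
  refine ⟨Y ^ 2 * (1 + 1 / M ^ 2) + 12 / p * Real.exp (2 * κ * R), 2 * κ, by positivity,
    by positivity, ?_⟩
  intro r hr0
  have hvx := hv r hr0
  rcases le_total R r with hr | hr
  · have hux := hu r (by linarith)
    have h1 : u r + M * v r ≤ Y * Real.exp (-(κ * r)) := by
      rw [Real.exp_neg, ← div_eq_mul_inv, le_div_iff₀ (Real.exp_pos _)]
      exact hy r hr
    have h2 : u r ^ 2 ≤ (Y * Real.exp (-(κ * r))) ^ 2 := by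
      have : 0 < M * v r := by positivity
      gcongr
      linarith
    have h3 : (M * v r) ^ 2 ≤ (Y * Real.exp (-(κ * r))) ^ 2 := by
      have : 0 ≤ M * v r := by positivity
      exact pow_le_pow_left₀ this (by linarith) 2
    have e : (Y * Real.exp (-(κ * r))) ^ 2 = Y ^ 2 * Real.exp (-(2 * κ) * r) := by
      rw [mul_pow, ← Real.exp_nat_mul]
      congr 2
      push_cast
      ring
    rw [e] at h2 h3
    have h4 : v r ^ 2 ≤ Y ^ 2 * Real.exp (-(2 * κ) * r) * (1 / M ^ 2) := by
      rw [mul_one_div, le_div_iff₀ (by positivity)]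
      linarith
    have h5 : 0 ≤ 12 / p * Real.exp (2 * κ * R) * Real.exp (-(2 * κ) * r) := by positivity
    linarith
  · obtain ⟨b1, b2⟩ := hbd r hr0
    have h1 : u r ^ 2 + v r ^ 2 ≤ 12 / p := by
      rw [le_div_iff₀ hp]; linarith
    have h2 : 1 ≤ Real.exp (2 * κ * R) * Real.exp (-(2 * κ) * r) := by
      rw [← Real.exp_add]
      apply Real.one_le_exp
      nlinarith
    have h3 : 12 / p * 1 ≤ 12 / p * (Real.exp (2 * κ * R) * Real.exp (-(2 * κ) * r)) := by gcongr
    have h4 : 0 ≤ Y ^ 2 * (1 + 1 / M ^ 2) * Real.exp (-(2 * κ) * r) := by positivity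
    linarith

lemma Sol.no_zero {p q a b : ℝ} {u v : ℝ → ℝ} (h : Sol p q a b u v) (hp : 0 < p) (hq : 0 < q)
    (ha : 0 < a) (hb : 0 < b)
    (hbd : ∀ r, 0 ≤ r → p * u r ^ 2 ≤ 6 ∧ p * v r ^ 2 ≤ 6) {T : ℝ} (hT : 0 < T)
    (hv : 0 < v (T / 2)) (h1 : u T = 0) (h2 : v T = 0) : False := by
  have hcu := h.cu
  have hcv := h.cv
  set K := (24 * q / p + 12 + a + b) + 4 / T with hK
  have := anti_of_deriv (φ := fun r => -((u r ^ 2 + v r ^ 2) * Real.exp (K * r)))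
    (by linarith : T / 2 ≤ T) (by fun_prop)
    (fun x hx _ => ((((h.du x (by linarith)).pow 2).add ((h.dv x (by linarith)).pow 2)).mul
      (((hasDerivAt_id x).const_mul K).exp)).neg) (fun x hx _ => by
      have hx0 : 0 < x := by linarith
      obtain ⟨b1, b2⟩ := hbd x hx0.le
      have he := Real.exp_pos (K * x)
      simp only [id, mul_one, Pi.add_apply, Pi.pow_apply]
      have q1 : q * u x ^ 2 ≤ 6 * q / p := by rw [le_div_iff₀ hp]; nlinarith
      have q2 : q * v x ^ 2 ≤ 6 * q / p := by rw [le_div_iff₀ hp]; nlinarith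
      have q10 : 0 ≤ q * u x ^ 2 := by positivity
      have q20 : 0 ≤ q * v x ^ 2 := by positivity
      have p10 : 0 ≤ p * u x ^ 2 := by positivity
      have p20 : 0 ≤ p * v x ^ 2 := by positivity
      have hE : 0 ≤ u x ^ 2 + v x ^ 2 := by positivity
      have i1 : 1 / x ≤ 2 / T := by
        rw [div_le_div_iff₀ hx0 hT]; linarith
      have i2 : 2 * (u x ^ 2 * (1 / x)) ≤ 2 * ((u x ^ 2 + v x ^ 2) * (2 / T)) := by
        have : 0 ≤ 1 / x := by positivity
        gcongr
        nlinarith [sq_nonneg (v x)]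
      set Z := (2 * q * u x ^ 2 + p * v x ^ 2 - b) - (p * u x ^ 2 + 2 * q * v x ^ 2 + a) with hZ
      have hZ' : |Z| ≤ 24 * q / p + 12 + a + b := by
        have : 24 * q / p = 4 * (6 * q / p) := by ring
        rw [this, abs_le, hZ]
        constructor <;> linarith
      have huv : |2 * (u x * v x)| ≤ u x ^ 2 + v x ^ 2 := by
        rw [abs_le]
        constructor <;> nlinarith [sq_nonneg (u x + v x), sq_nonneg (u x - v x)]
      have hprod : |2 * (u x * v x) * Z| ≤ (u x ^ 2 + v x ^ 2) * (24 * q / p + 12 + a + b) := by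
        rw [abs_mul]; gcongr
      have hlow := (abs_le.mp hprod).1
      have key : 0 ≤ 2 * (u x * v x) * Z - 2 * (u x ^ 2 * (1 / x)) + K * (u x ^ 2 + v x ^ 2) := by
        have : K * (u x ^ 2 + v x ^ 2) = (u x ^ 2 + v x ^ 2) * (24 * q / p + 12 + a + b)
          + 2 * ((u x ^ 2 + v x ^ 2) * (2 / T)) := by rw [hK]; ring
        linarith
      have := mul_nonneg key he.le
      have e : ∀ A : ℝ, -A ≤ 0 ↔ 0 ≤ A := fun A => by constructor <;> intro <;> linarith
      rw [e]
      refine this.trans (le_of_eq ?_)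
      rw [hZ]
      push_cast
      ring)
  simp only [h1, h2] at this
  have h3 : 0 < (u (T / 2) ^ 2 + v (T / 2) ^ 2) * Real.exp (K * (T / 2)) := by positivity
  norm_num at this
  linarith

lemma Sol.dichotomy {p q a b : ℝ} {u v : ℝ → ℝ} (h : Sol p q a b u v) (hp : 0 < p) (hq : 0 < q)
    (ha : 0 < a) (hb : 0 < b) (hv0 : 0 < v 0)
    (hbd : ∀ r, 0 ≤ r → p * u r ^ 2 ≤ 6 ∧ p * v r ^ 2 ≤ 6)
    (hS : ¬ ∃ R, 0 ≤ R ∧ v R < 0 ∧ 0 < Ham p q a b (u R) (v R))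
    (hN : ¬ ∃ R, 0 ≤ R ∧ Ham p q a b (u R) (v R) < 0 ∧ ∀ r, 0 ≤ r → r ≤ R → 0 < v r) :
    (∀ r, 0 ≤ r → 0 < v r) ∧ ∀ r, 0 ≤ r → 0 ≤ Ham p q a b (u r) (v r) := by
  have hv : ∀ r, 0 ≤ r → 0 < v r := by
    intro r hr
    by_contra hc
    push Not at hc
    obtain ⟨T, hT0, -, hT, hbef⟩ := first_hit h.cv hr hv0 hc
    have hd := deriv_nonpos_of_hit hT0 hT hbef (h.dv T hT0)
    have hu0 : u T ≠ 0 := fun hu => h.no_zero hp hq ha hb hbd hT0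
      (hbef (T / 2) (by linarith) (by linarith)) hu hT
    have hH : 0 < Ham p q a b (u T) (v T) := by
      rw [hT]
      unfold Ham
      have : p / 4 * (u T ^ 4 + 0 ^ 4) + q * u T ^ 2 * 0 ^ 2 + a / 2 * u T ^ 2 - b / 2 * 0 ^ 2
        = p / 4 * u T ^ 4 + a / 2 * u T ^ 2 := by ring
      rw [this]
      positivity
    have hupos : 0 < u T := by
      by_contra hneg
      have hneg : u T < 0 := lt_of_le_of_ne (not_lt.mp hneg) hu0
      have : 0 < (p * u T ^ 2 + 2 * q * v T ^ 2 + a) * (- u T) :=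
        mul_pos (by positivity) (by linarith)
      linarith
    have hdneg : -((p * u T ^ 2 + 2 * q * v T ^ 2) * u T) - a * u T < 0 := by
      have : 0 < (p * u T ^ 2 + 2 * q * v T ^ 2 + a) * u T := by positivity
      linarith
    have hder := (h.dv T hT0).hasDerivWithinAt (s := Ioi T)
    rw [hasDerivWithinAt_iff_tendsto_slope' (by simp)] at hder
    have ev1 := hder.eventually_lt_const hdneg
    have ev2 : ∀ᶠ r in 𝓝[>] T, 0 < Ham p q a b (u r) (v r) :=
      ((h.cH.tendsto T).eventually_const_lt hH).filter_mono nhdsWithin_le_nhds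
    obtain ⟨r, ⟨hr1, hr2⟩, hr3⟩ := ((ev1.and ev2).and self_mem_nhdsWithin).exists
    have hr3 : T < r := hr3
    refine hS ⟨r, by linarith, ?_, hr2⟩
    rw [slope_def_field, hT, sub_zero, div_lt_iff₀ (by linarith)] at hr1
    linarith
  refine ⟨hv, fun r hr => ?_⟩
  by_contra hc
  push Not at hc
  exact hN ⟨r, hr, hc, fun s hs _ => hv s hs⟩

/-- Pohozaev functional -/
noncomputable def Po (p q a b : ℝ) (u v : ℝ → ℝ) (r : ℝ) : ℝ :=
  r ^ 2 * Ham p q a b (u r) (v r) - r * u r * v r / 2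

lemma Sol.dPo {p q a b : ℝ} {u v : ℝ → ℝ} (h : Sol p q a b u v) (r : ℝ) (hr : 0 < r) :
    HasDerivAt (Po p q a b u v) (r / 2 * (a * u r ^ 2 - b * v r ^ 2)) r := by
  have := (((hasDerivAt_id r).pow 2).mul (Ham_deriv (h.du r hr) (h.dv r hr))).sub
    ((((hasDerivAt_id r).mul (h.du r hr)).mul (h.dv r hr)).div_const 2)
  refine this.congr_deriv ?_
  simp only [id, Pi.pow_apply, Pi.mul_apply]
  unfold Ham
  push_cast
  field_simp
  ring

lemma Sol.cPo {p q a b : ℝ} {u v : ℝ → ℝ} (h : Sol p q a b u v) :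
    Continuous (Po p q a b u v) := by
  have := h.cu
  have := h.cv
  have := h.cH
  unfold Po
  fun_prop

lemma Ham_pos_of_Po {p q a b R : ℝ} {u v : ℝ → ℝ} (hR : 0 < R) (hP : 0 < Po p q a b u v R)
    (hu : 0 ≤ u R) (hv : 0 ≤ v R) : u R * v R / R < 2 * Ham p q a b (u R) (v R) ∧
      0 < Ham p q a b (u R) (v R) := by
  unfold Po at hP
  have h0 : 0 ≤ u R * v R := by positivity
  constructor
  · rw [div_lt_iff₀ hR]
    by_contra hc
    push Not at hc
    nlinarith
  · by_contra hc
    push Not at hc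
    have : 0 ≤ R * (u R * v R) := by positivity
    nlinarith [sq_nonneg R]

lemma Sol.trap {p q a b : ℝ} {u v : ℝ → ℝ} (h : Sol p q a b u v)
    (ha : 0 < a) (hb : 0 < b) {R R1 : ℝ} (hR : 0 < R) (hR1 : R ≤ R1)
    (hv : ∀ r, R ≤ r → r ≤ R1 → 0 < v r) (hP : 0 < Po p q a b u v R)
    (hg : √b * v R < √a * u R) : 0 < Ham p q a b (u R1) (v R1) := by
  have hcu := h.cu
  have hcv := h.cv
  have hcP := h.cPo
  have hsa : 0 < √a := Real.sqrt_pos.mpr ha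
  have hsb : 0 < √b := Real.sqrt_pos.mpr hb
  have hupos : ∀ r, 0 < v r → 0 ≤ √a * u r - √b * v r → 0 < u r := by
    intro r h1 h2
    have : 0 < √a * u r := by
      have : 0 < √b * v r := by positivity
      linarith
    exact pos_of_mul_pos_right this hsa.le
  suffices hpos : 0 < min (Po p q a b u v R1) (√a * u R1 - √b * v R1) by
    rw [lt_min_iff] at hpos
    have hv1 := hv R1 hR1 le_rfl
    exact (Ham_pos_of_Po (by linarith) hpos.1 (hupos R1 hv1 hpos.2.le).le hv1.le).2
  by_contra hcon
  push Not at hcon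
  obtain ⟨T, hT0, hT1, hT, hbef⟩ := first_hit
    (φ := fun r => min (Po p q a b u v r) (√a * u r - √b * v r)) (by fun_prop) hR1
    (lt_min hP (by linarith)) hcon
  have hTpos : 0 < T := by linarith
  have hPT : 0 < Po p q a b u v T := by
    have := anti_of_deriv (φ := fun r => -Po p q a b u v r) hT0.le (by fun_prop)
      (fun x hx _ => (h.dPo x (by linarith)).neg) (fun x hx hxT => by
        have h1 := hbef x hx.le hxT
        rw [lt_min_iff] at h1
        have h2 := hv x hx.le (by linarith)
        have h3 : (√b * v x) ^ 2 ≤ (√a * u x) ^ 2 := by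
          exact pow_le_pow_left₀ (by positivity) (by linarith [h1.2]) 2
        rw [mul_pow, mul_pow, Real.sq_sqrt ha.le, Real.sq_sqrt hb.le] at h3
        have : 0 ≤ x / 2 * (a * u x ^ 2 - b * v x ^ 2) := mul_nonneg (by linarith) (by linarith)
        linarith)
    linarith
  have hgT : √a * u T - √b * v T = 0 := by
    have hT : min (Po p q a b u v T) (√a * u T - √b * v T) = 0 := hT
    rcases min_choice (Po p q a b u v T) (√a * u T - √b * v T) with h1 | h1
    · linarith
    · linarith
  have hd := deriv_nonpos_of_hit (φ := fun r => √a * u r - √b * v r) hT0 hgT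
    (fun r h1 h2 => (lt_min_iff.mp (hbef r h1 h2)).2)
    (((h.du T hTpos).const_mul (√a)).sub ((h.dv T hTpos).const_mul (√b)))
  have hvT := hv T hT0.le hT1
  have huT := hupos T hvT hgT.ge
  obtain ⟨k1, k2⟩ := Ham_pos_of_Po hTpos hPT huT.le hvT.le
  have e1 : √b * v T = √a * u T := by linarith
  have hQ : a * u T ^ 2 = b * v T ^ 2 := by
    have := congrArg (fun x => x ^ 2) e1
    simp only [mul_pow, Real.sq_sqrt ha.le, Real.sq_sqrt hb.le] at this
    linarith
  set A := (2 * q * u T ^ 2 + p * v T ^ 2) * v T - b * v T - u T / T with hA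
  set D := -((p * u T ^ 2 + 2 * q * v T ^ 2) * u T) - a * u T with hD
  have e2 : v T * (√a * A - √b * D) = √a * (v T * A - u T * D) := by
    linear_combination (-D) * e1
  have e3 : v T * A - u T * D = 4 * Ham p q a b (u T) (v T) - u T * v T / T := by
    rw [hA, hD]; unfold Ham
    linear_combination (-1) * hQ
  have h5 : v T * (√a * A - √b * D) ≤ 0 := mul_nonpos_of_nonneg_of_nonpos hvT.le hd
  rw [e2, e3] at h5
  have : 0 < √a * (4 * Ham p q a b (u T) (v T) - u T * v T / T) := mul_pos hsa (by linarith)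
  linarith

end Dirac2D

namespace Dirac2D

open Set Filter Topology

noncomputable def Lam (p q a b r : ℝ) : ℝ :=
  a / (2 * (p / 2 + q)) * Real.log (1 + r ^ 2) + 2 * (a + b) / p * (1 + r ^ 2)⁻¹

lemma Lam_deriv {p q a b : ℝ} (r : ℝ) :
    HasDerivAt (Lam p q a b) (a / (2 * (p / 2 + q)) * (2 * r / (1 + r ^ 2)) +
      2 * (a + b) / p * (-(2 * r) / (1 + r ^ 2) ^ 2)) r := by
  have h0 : HasDerivAt (fun r : ℝ => 1 + r ^ 2) (2 * r) r := by
    have := ((hasDerivAt_id r).pow 2).const_add 1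
    refine this.congr_deriv ?_
    simp
  have hne : (1 + r ^ 2 : ℝ) ≠ 0 := by positivity
  exact ((h0.log hne).const_mul _).add ((h0.fun_inv hne).const_mul _)

lemma Lam_deriv_le {p q a b : ℝ} (hp : 0 < p) (hq : 0 < q) (ha : 0 < a) (hb : 0 < b) {r : ℝ}
    (hr : 0 < r) : a / (2 * (p / 2 + q)) * (2 * r / (1 + r ^ 2)) +
      2 * (a + b) / p * (-(2 * r) / (1 + r ^ 2) ^ 2) ≤
      r * (a * (r ^ 2 / Dn p q r) - b * (1 / Dn p q r)) := by
  have hD := Dn_pos hp hq r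
  have h1 : Dn p q r ≤ (p / 2 + q) * (1 + r ^ 2) ^ 2 := by
    unfold Dn
    have : 0 ≤ q * (1 - r ^ 2) ^ 2 + (p + 2 * q) * r ^ 2 := by positivity
    nlinarith [mul_nonneg hp.le (sq_nonneg r), mul_nonneg hq.le (sq_nonneg (1 - r ^ 2))]
  have h2 : p / 4 * (1 + r ^ 2) ^ 2 ≤ Dn p q r := by
    unfold Dn
    nlinarith [mul_nonneg hp.le (sq_nonneg (1 - r ^ 2)), mul_nonneg hq.le (sq_nonneg r)]
  have h3 : a * r * (1 + r ^ 2) / ((p / 2 + q) * (1 + r ^ 2) ^ 2) ≤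
      a * r * (1 + r ^ 2) / Dn p q r := by gcongr
  have h4 : r * (a + b) / Dn p q r ≤ r * (a + b) / (p / 4 * (1 + r ^ 2) ^ 2) := by gcongr
  have e1 : a * r * (1 + r ^ 2) / ((p / 2 + q) * (1 + r ^ 2) ^ 2) =
      a / (2 * (p / 2 + q)) * (2 * r / (1 + r ^ 2)) := by field_simp
  have e2 : r * (a + b) / (p / 4 * (1 + r ^ 2) ^ 2) =
      -(2 * (a + b) / p * (-(2 * r) / (1 + r ^ 2) ^ 2)) := by field_simp; ring
  have e3 : r * (a * (r ^ 2 / Dn p q r) - b * (1 / Dn p q r)) =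
      a * r * (1 + r ^ 2) / Dn p q r - r * (a + b) / Dn p q r := by field_simp; ring
  linarith

lemma Po_lower {p q a b e δ R : ℝ} {u v : ℝ → ℝ} (hp : 0 < p) (hq : 0 < q) (ha : 0 < a)
    (hb : 0 < b) (he : 0 < e) (hR : 0 < R) (h : Sol p q (e * a) (e * b) u v)
    (hd : ∀ r, 0 < r → r < R → a * (r ^ 2 / Dn p q r) - b * (1 / Dn p q r) - δ ≤
      a * u r ^ 2 - b * v r ^ 2) :
    e / 2 * (Lam p q a b R - Lam p q a b 0 - δ * R ^ 2 / 2) ≤ Po p q (e * a) (e * b) u v R := by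
  have hcP := h.cPo
  have hcL : Continuous (Lam p q a b) :=
    continuous_iff_continuousAt.mpr fun x => (Lam_deriv x).continuousAt
  have key := anti_of_deriv
    (φ := fun r => e / 2 * (Lam p q a b r - δ / 2 * r ^ 2) - Po p q (e * a) (e * b) u v r)
    hR.le (by fun_prop)
    (fun r h1 _ => (((Lam_deriv r).sub (((hasDerivAt_id r).pow 2).const_mul (δ / 2))).const_mul
      (e / 2)).sub (h.dPo r h1))
    (fun r h1 h2 => by
      have h3 := Lam_deriv_le hp hq ha hb h1
      have h4 := mul_le_mul_of_nonneg_left (hd r h1 h2) h1.le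
      have h5 := mul_le_mul_of_nonneg_left (h3.trans (b := _) (by linarith :
        r * (a * (r ^ 2 / Dn p q r) - b * (1 / Dn p q r)) ≤
          r * (a * u r ^ 2 - b * v r ^ 2) + r * δ)) (by positivity : 0 ≤ e / 2)
      simp only [id]
      push_cast
      nlinarith)
  have hP0 : Po p q (e * a) (e * b) u v 0 = 0 := by simp [Po]
  simp only [hP0] at key
  nlinarith

lemma ev_small (k : ℝ) {c : ℝ} (hc : 0 < c) : ∀ᶠ e in 𝓝[>] (0:ℝ), k * e < c := by
  have : Tendsto (fun e : ℝ => k * e) (𝓝[>] 0) (𝓝 (k * 0)) :=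
    (by fun_prop : Continuous fun e : ℝ => k * e).continuousAt.tendsto.mono_left inf_le_left
  rw [mul_zero] at this
  exact this.eventually (gt_mem_nhds hc)

lemma exists_R {p q a b : ℝ} (hp : 0 < p) (hq : 0 < q) (ha : 0 < a) (hb : 0 < b) :
    ∃ R, 0 < R ∧ b < a * R ^ 2 ∧ 1 ≤ Lam p q a b R - Lam p q a b 0 := by
  set c := p / 2 + q with hc
  have hcpos : 0 < c := by positivity
  set X := c / a * (2 * (a + b) / p + 1) + b / a with hX
  have hXpos : 0 < X := by positivity
  refine ⟨Real.exp X, Real.exp_pos _, ?_, ?_⟩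
  · have h1 : Real.exp X ^ 2 = Real.exp (2 * X) := by
      rw [← Real.exp_nat_mul]; push_cast; rfl
    have h2 := Real.add_one_le_exp (2 * X)
    have h3 : b / a < Real.exp X ^ 2 := by
      have : 0 < c / a * (2 * (a + b) / p + 1) := by positivity
      rw [h1]; linarith
    rw [div_lt_iff₀ ha] at h3
    linarith
  · unfold Lam
    have h1 : 2 * X ≤ Real.log (1 + Real.exp X ^ 2) := by
      rw [Real.le_log_iff_exp_le (by positivity)]
      have : Real.exp X ^ 2 = Real.exp (2 * X) := by
        rw [← Real.exp_nat_mul]; push_cast; rfl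
      linarith
    have h2 : a / (2 * c) * (2 * X) ≤ a / (2 * c) * Real.log (1 + Real.exp X ^ 2) := by gcongr
    have h3 : a / (2 * c) * (2 * X) = 2 * (a + b) / p + 1 + b / c := by
      rw [hX]; field_simp
    have h4 : 0 < b / c := by positivity
    have h5 : 0 < 2 * (a + b) / p * (1 + Real.exp X ^ 2)⁻¹ := by positivity
    simp only [← hc]
    norm_num
    linarith

lemma sq_close {B x y d : ℝ} (hx : |x| ≤ B) (hy : |y| ≤ B) (h : |x - y| ≤ d) :
    |x ^ 2 - y ^ 2| ≤ 2 * B * d := by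
  have : x ^ 2 - y ^ 2 = (x + y) * (x - y) := by ring
  rw [this, abs_mul]
  have h1 : |x + y| ≤ 2 * B := (abs_add_le x y).trans (by linarith)
  have := abs_nonneg x
  exact mul_le_mul h1 h (abs_nonneg _) (by linarith)

theorem shooting {p q a b : ℝ} (hp : 0 < p) (hq : 0 < q) (ha : 0 < a) (hb : 0 < b) :
    ∃ e > 0, ∃ u v : ℝ → ℝ, Sol p q (e * a) (e * b) u v ∧ v 0 = √(2 / p) ∧
      ContDiff ℝ (⊤ : ℕ∞) u ∧ ContDiff ℝ (⊤ : ℕ∞) v ∧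
      ∃ C κ : ℝ, 0 < C ∧ 0 < κ ∧ ∀ r, 0 ≤ r → u r ^ 2 + v r ^ 2 ≤ C * Real.exp (-κ * r) := by
  obtain ⟨U, V, C, K, hsol, hlip, hzero⟩ := family hp hq ha hb
  have hunif : ∀ R, 0 ≤ R → ∃ M, 0 < M ∧ ∀ e ∈ Icc 0 (2 / b), ∀ e' ∈ Icc 0 (2 / b), ∀ r, 0 ≤ r →
      r ≤ R → |U e r - U e' r| ≤ M * |e - e'| ∧ |V e r - V e' r| ≤ M * |e - e'| := by
    intro R hR
    refine ⟨(|C| + 1) * Real.exp (|K| * R), by positivity, fun e he e' he' r hr hrR => ?_⟩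
    have h1 : C * |e - e'| * Real.exp (K * r) ≤ (|C| + 1) * Real.exp (|K| * R) * |e - e'| := by
      have h2 : Real.exp (K * r) ≤ Real.exp (|K| * R) := by
        apply Real.exp_le_exp.mpr
        exact (mul_le_mul_of_nonneg_right (le_abs_self K) hr).trans
          (mul_le_mul_of_nonneg_left hrR (abs_nonneg K))
      have h3 : C ≤ |C| + 1 := by linarith [le_abs_self C]
      calc C * |e - e'| * Real.exp (K * r) ≤ (|C| + 1) * |e - e'| * Real.exp (|K| * R) := by
            gcongr
        _ = _ := by ring
    exact ⟨(hlip e he e' he' r hr).1.trans h1, (hlip e he e' he' r hr).2.trans h1⟩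
  have hb2 : 0 < 2 / b := by positivity
  have hsub : ∀ e, e ∈ Ioo 0 (2 / b) → e ∈ Icc 0 (2 / b) := fun e he => ⟨he.1.le, he.2.le⟩
  have hV0 : 0 < √(2 / p) := Real.sqrt_pos.mpr (by positivity)
  -- continuity in the parameter
  have hcont : ∀ r, 0 ≤ r → ContinuousOn (fun e => U e r) (Icc 0 (2 / b)) ∧
      ContinuousOn (fun e => V e r) (Icc 0 (2 / b)) := by
    intro r hr
    obtain ⟨M, hM, hMb⟩ := hunif r hr
    constructor
    · refine LipschitzOnWith.continuousOn (K := ⟨M, hM.le⟩) (LipschitzOnWith.of_dist_le_mul ?_)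
      intro x hx y hy
      rw [Real.dist_eq, Real.dist_eq]
      exact (hMb x hx y hy r hr le_rfl).1
    · refine LipschitzOnWith.continuousOn (K := ⟨M, hM.le⟩) (LipschitzOnWith.of_dist_le_mul ?_)
      intro x hx y hy
      rw [Real.dist_eq, Real.dist_eq]
      exact (hMb x hx y hy r hr le_rfl).2
  have hcA : ∀ r, 0 ≤ r → ∀ e ∈ Ioo 0 (2 / b), ContinuousAt (fun e => V e r) e ∧
      ContinuousAt (fun e => Ham p q (e * a) (e * b) (U e r) (V e r)) e := by
    intro r hr e he
    have hn : Icc 0 (2 / b) ∈ 𝓝 e := Icc_mem_nhds he.1 he.2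
    have h1 := (hcont r hr).1.continuousAt hn
    have h2 := (hcont r hr).2.continuousAt hn
    refine ⟨h2, ?_⟩
    unfold Ham
    fun_prop
  let PS : ℝ → Prop := fun e => ∃ R, 0 ≤ R ∧ V e R < 0 ∧ 0 < Ham p q (e * a) (e * b) (U e R) (V e R)
  let PN : ℝ → Prop := fun e => ∃ R, 0 ≤ R ∧ Ham p q (e * a) (e * b) (U e R) (V e R) < 0 ∧
    ∀ r, 0 ≤ r → r ≤ R → 0 < V e r
  suffices hex : ∃ e ∈ Ioo 0 (2 / b), ¬ PS e ∧ ¬ PN e by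
    obtain ⟨e, he, h1, h2⟩ := hex
    obtain ⟨hs, hv0, hcu, hcv, hbd⟩ := hsol e (hsub e he)
    have hea : 0 < e * a := mul_pos he.1 ha
    have heb : 0 < e * b := mul_pos he.1 hb
    obtain ⟨hv, hH⟩ := hs.dichotomy hp hq hea heb (by rw [hv0]; exact hV0) hbd h1 h2
    exact ⟨e, he.1, U e, V e, hs, hv0, hcu, hcv, hs.decay hp hq hea heb hbd hv hH⟩
  by_contra hcon
  push Not at hcon
  have hoS : IsOpen {e | e ∈ Ioo 0 (2 / b) ∧ PS e} := by
    rw [isOpen_iff_mem_nhds]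
    rintro e ⟨he, R, hR, h1, h2⟩
    filter_upwards [Ioo_mem_nhds he.1 he.2, (hcA R hR e he).1.eventually (gt_mem_nhds h1),
      (hcA R hR e he).2.eventually (lt_mem_nhds h2)] with x hx h3 h4
    exact ⟨hx, R, hR, h3, h4⟩
  have hoN : IsOpen {e | e ∈ Ioo 0 (2 / b) ∧ PN e} := by
    rw [isOpen_iff_mem_nhds]
    rintro e ⟨he, R, hR, h1, h2⟩
    obtain ⟨M, hM, hMb⟩ := hunif R hR
    obtain ⟨t, ht, hmin⟩ := isCompact_Icc.exists_isMinOn (nonempty_Icc.mpr hR)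
      (hsol e (hsub e he)).1.cv.continuousOn
    have hpos := h2 t ht.1 ht.2
    have hcc : ContinuousAt (fun x => M * |x - e|) e := by fun_prop
    have hev : ∀ᶠ x in 𝓝 e, M * |x - e| < V e t := hcc.eventually (gt_mem_nhds (by simpa using hpos))
    filter_upwards [Ioo_mem_nhds he.1 he.2, (hcA R hR e he).2.eventually (gt_mem_nhds h1),
      hev] with x hx h3 h4
    refine ⟨hx, R, hR, h3, fun r hr hrR => ?_⟩
    have h5 := (abs_le.mp (hMb x (hsub x hx) e (hsub e he) r hr hrR).2).1
    have h6 : V e t ≤ V e r := hmin ⟨hr, hrR⟩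
    linarith
  have hneN : (Ioo 0 (2 / b) ∩ {e | e ∈ Ioo 0 (2 / b) ∧ PN e}).Nonempty := by
    have hmem : 3 / (2 * b) ∈ Ioo 0 (2 / b) := by
      refine ⟨by positivity, ?_⟩
      rw [div_lt_div_iff₀ (by positivity) hb]
      linarith
    obtain ⟨hs, hv0, -⟩ := hsol _ (hsub _ hmem)
    refine ⟨_, hmem, hmem, 0, le_rfl, ?_, fun r h1 h2 => ?_⟩
    · rw [hs.u0, hv0]
      unfold Ham
      have e1 : √(2 / p) ^ 2 = 2 / p := Real.sq_sqrt (by positivity)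
      have e2 : √(2 / p) ^ 4 = (2 / p) ^ 2 := by
        rw [show (4:ℕ) = 2 * 2 from rfl, pow_mul, e1]
      rw [e1, e2]
      have : p / 4 * (0 ^ 4 + (2 / p) ^ 2) + q * 0 ^ 2 * (2 / p) + 3 / (2 * b) * a / 2 * 0 ^ 2 -
        3 / (2 * b) * b / 2 * (2 / p) = -(1 / (2 * p)) := by field_simp; ring
      rw [this]
      have : 0 < 1 / (2 * p) := by positivity
      linarith
    · have : r = 0 := le_antisymm h2 h1
      rw [this, hv0]; exact hV0
  have hneS : (Ioo 0 (2 / b) ∩ {e | e ∈ Ioo 0 (2 / b) ∧ PS e}).Nonempty := by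
    obtain ⟨R, hR, hRb, hRL⟩ := exists_R hp hq ha hb
    obtain ⟨M, hM, hMb⟩ := hunif R hR.le
    have hDR := Real.sqrt_pos.mpr (Dn_pos hp hq R)
    set B := √(6 / p) with hB
    have hB6 : p * B ^ 2 = 6 := by
      rw [hB, Real.sq_sqrt (by positivity)]; field_simp
    have hB0 : 0 ≤ B := Real.sqrt_nonneg _
    have hVR : 0 < V 0 R := by rw [(hzero R).2]; positivity
    have hUR : 0 < U 0 R := by rw [(hzero R).1]; positivity
    have hg0 : 0 < √a * U 0 R - √b * V 0 R := by
      rw [(hzero R).1, (hzero R).2]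
      have h1 : √b < √a * R := by
        rw [Real.sqrt_lt' (by positivity), mul_pow, Real.sq_sqrt ha.le]
        exact hRb
      have : √a * (R / √(Dn p q R)) - √b * (1 / √(Dn p q R)) = (√a * R - √b) / √(Dn p q R) := by
        ring
      rw [this]
      exact div_pos (by linarith) hDR
    obtain ⟨e, hebd, he1, he2, he3, he4⟩ := ((ev_small 1 hb2).and ((ev_small M hVR).and
      ((ev_small ((√a + √b) * M) hg0).and ((ev_small ((a + b) * B * M * R ^ 2) one_pos).and
      self_mem_nhdsWithin)))).exists
    have he4 : 0 < e := he4
    have hei : e ∈ Ioo 0 (2 / b) := ⟨he4, by linarith⟩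
    have h0i : (0:ℝ) ∈ Icc 0 (2 / b) := ⟨le_rfl, hb2.le⟩
    have hea : 0 < e * a := mul_pos he4 ha
    have heb : 0 < e * b := mul_pos he4 hb
    obtain ⟨hs, hv0, -, -, hbd⟩ := hsol e (hsub e hei)
    obtain ⟨hs0, -, -, -, hbd0⟩ := hsol 0 h0i
    have hcl : ∀ r, 0 ≤ r → r ≤ R → |U e r - U 0 r| ≤ M * e ∧ |V e r - V 0 r| ≤ M * e := by
      intro r h1 h2
      have := hMb e (hsub e hei) 0 h0i r h1 h2
      rwa [sub_zero, abs_of_pos he4] at this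
    have hP : 0 < Po p q (e * a) (e * b) (U e) (V e) R := by
      have := Po_lower (δ := 2 * (a + b) * B * (M * e)) hp hq ha hb he4 hR hs (by
        intro r hr hrR
        obtain ⟨c1, c2⟩ := hcl r hr.le hrR.le
        have d1 := sq_close (abs_le_of_sq hp hB0 hB6 (hbd r hr.le).1)
          (abs_le_of_sq hp hB0 hB6 (hbd0 r hr.le).1) c1
        have d2 := sq_close (abs_le_of_sq hp hB0 hB6 (hbd r hr.le).2)
          (abs_le_of_sq hp hB0 hB6 (hbd0 r hr.le).2) c2
        have e1 : U 0 r ^ 2 = r ^ 2 / Dn p q r := by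
          rw [(hzero r).1, div_pow, Real.sq_sqrt (Dn_pos hp hq r).le]
        have e2 : V 0 r ^ 2 = 1 / Dn p q r := by
          rw [(hzero r).2, div_pow, Real.sq_sqrt (Dn_pos hp hq r).le, one_pow]
        rw [← e1, ← e2]
        have f1 := mul_le_mul_of_nonneg_left (abs_le.mp d1).1 ha.le
        have f2 := mul_le_mul_of_nonneg_left (abs_le.mp d2).2 hb.le
        linarith)
      refine lt_of_lt_of_le (mul_pos (by positivity) ?_) this
      linarith
    obtain ⟨c1, c2⟩ := hcl R hR.le le_rfl
    have hvR : 0 < V e R := by linarith [(abs_le.mp c2).1]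
    have hsa : 0 < √a := Real.sqrt_pos.mpr ha
    have hsb : 0 < √b := Real.sqrt_pos.mpr hb
    have hse : 0 < √e := Real.sqrt_pos.mpr he4
    have hg1 : √b * V e R < √a * U e R := by
      have f1 := mul_le_mul_of_nonneg_left (abs_le.mp c1).1 hsa.le
      have f2 := mul_le_mul_of_nonneg_left (abs_le.mp c2).2 hsb.le
      linarith
    have hg : √(e * b) * V e R < √(e * a) * U e R := by
      rw [Real.sqrt_mul he4.le, Real.sqrt_mul he4.le, mul_assoc, mul_assoc]
      exact mul_lt_mul_of_pos_left hg1 hse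
    have huR : 0 < U e R := by
      have : 0 < √b * V e R := by positivity
      exact pos_of_mul_pos_right (this.trans hg1) hsa.le
    have hnN : ¬ PN e := by
      rintro ⟨R1, hR1, hH, hv⟩
      rcases le_total R R1 with hle | hle
      · have := hs.trap hea heb hR hle (fun r h1 h2 => hv r (by linarith) h2) hP hg
        linarith
      · have h1 := hs.anti hp hq hea.le hR1 hle
        have h2 := (Ham_pos_of_Po hR hP huR.le hvR.le).2
        linarith
    refine ⟨e, hei, hei, ?_⟩
    by_contra hnS
    exact hnN (hcon e hei hnS)
  obtain ⟨e, he, ⟨-, R, hR, h1, h2⟩, -, R1, hR1, h3, h4⟩ :=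
    (isPreconnected_Ioo (a := (0:ℝ)) (b := 2 / b)) _ _ hoS hoN (fun e he => by
      by_cases h : PS e
      · exact Or.inl ⟨he, h⟩
      · exact Or.inr ⟨he, hcon e he h⟩) hneS hneN
  have hlt : R1 ≤ R := by
    by_contra hc
    push Not at hc
    linarith [h4 R hR hc.le]
  have := (hsol e (hsub e he)).1.anti hp hq (mul_pos he.1 ha).le hR1 hlt
  linarith

end Dirac2D

/-- for `0 < β₂ ≤ β₁`, `m > 0`, `ω ∈ (−m, m)`, the massive radial
system `u' + u/r = (2β₂u² + β₁v²)v − (m − ω)v`, `v' = −(β₁u² + 2β₂v²)u − (m + ω)u`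
admits, for some `λ ≠ 0`, a global smooth solution with `u(0) = 0`, `v(0) = λ`,
tending to `(0,0)` at infinity and decaying exponentially. -/
theorem massive_case_exponential_solution (β₁ β₂ m ω : ℝ) (hβ₂ : 0 < β₂) (hββ : β₂ ≤ β₁)
    (hm : 0 < m) (hω : ω ∈ Set.Ioo (-m) m) :
    ∃ lam : ℝ, lam ≠ 0 ∧ ∃ u v : ℝ → ℝ,
      u 0 = 0 ∧ v 0 = lam ∧
      ContDiffOn ℝ (⊤ : ℕ∞) u (Set.Ici 0) ∧ ContDiffOn ℝ (⊤ : ℕ∞) v (Set.Ici 0) ∧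
      (∀ r : ℝ, 0 < r →
        HasDerivAt u
          ((2 * β₂ * (u r) ^ 2 + β₁ * (v r) ^ 2) * v r - (m - ω) * v r - u r / r) r ∧
        HasDerivAt v
          (-((β₁ * (u r) ^ 2 + 2 * β₂ * (v r) ^ 2) * u r) - (m + ω) * u r) r) ∧
      Filter.Tendsto (fun r => (u r, v r)) Filter.atTop (nhds ((0 : ℝ), (0 : ℝ))) ∧
      ∃ C a : ℝ, 0 < C ∧ 0 < a ∧
        ∀ r : ℝ, 0 ≤ r → (u r) ^ 2 + (v r) ^ 2 ≤ C * Real.exp (-a * r) := by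
  have hp : 0 < β₁ := by linarith
  have ha : 0 < m + ω := by linarith [hω.1]
  have hb : 0 < m - ω := by linarith [hω.2]
  obtain ⟨e, he, u, v, hs, hv0, hcu, hcv, C, κ, hC, hκ, hdec⟩ :=
    Dirac2D.shooting hp hβ₂ ha hb
  obtain ⟨μ, hμ, hμe⟩ : ∃ μ : ℝ, 0 < μ ∧ μ ^ 2 * e = 1 := by
    refine ⟨√(1 / e), Real.sqrt_pos.mpr (by positivity), ?_⟩
    rw [Real.sq_sqrt (by positivity)]
    field_simp
  have hdil : ∀ r : ℝ, HasDerivAt (fun r : ℝ => μ ^ 2 * r) (μ ^ 2) r := fun r => by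
    simpa using (hasDerivAt_id r).const_mul (μ ^ 2)
  have hbound : ∀ r : ℝ, 0 ≤ r → (μ * u (μ ^ 2 * r)) ^ 2 + (μ * v (μ ^ 2 * r)) ^ 2 ≤
      (C * μ ^ 2) * Real.exp (-(κ * μ ^ 2) * r) := by
    intro r hr
    have h1 := mul_le_mul_of_nonneg_left (hdec (μ ^ 2 * r) (by positivity)) (sq_nonneg μ)
    have h2 : -κ * (μ ^ 2 * r) = -(κ * μ ^ 2) * r := by ring
    rw [h2] at h1
    linarith
  have hlim : Filter.Tendsto (fun r : ℝ => (C * μ ^ 2) * Real.exp (-(κ * μ ^ 2) * r)) Filter.atTop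
      (nhds 0) := by
    have h1 : Filter.Tendsto (fun r : ℝ => (κ * μ ^ 2) * r) Filter.atTop Filter.atTop :=
      Filter.tendsto_id.const_mul_atTop (by positivity)
    have h2 := (Real.tendsto_exp_neg_atTop_nhds_zero.comp h1).const_mul (C * μ ^ 2)
    rw [mul_zero] at h2
    refine h2.congr fun r => ?_
    simp only [Function.comp, neg_mul]
  have hsq : ∀ w : ℝ → ℝ, (∀ r : ℝ, 0 ≤ r → w r ^ 2 ≤
      (C * μ ^ 2) * Real.exp (-(κ * μ ^ 2) * r)) → Filter.Tendsto w Filter.atTop (nhds 0) := by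
    intro w hw
    have h1 : Filter.Tendsto (fun r => w r ^ 2) Filter.atTop (nhds 0) := by
      refine squeeze_zero' (Filter.Eventually.of_forall fun r => sq_nonneg _) ?_ hlim
      filter_upwards [Filter.eventually_ge_atTop 0] with r hr
      exact hw r hr
    have h2 := h1.sqrt
    simp only [Real.sqrt_sq_eq_abs, Real.sqrt_zero] at h2
    exact (tendsto_zero_iff_abs_tendsto_zero _).mpr h2
  refine ⟨μ * √(2 / β₁), by positivity, fun r => μ * u (μ ^ 2 * r), fun r => μ * v (μ ^ 2 * r),
    ?_, ?_, ?_, ?_, ?_, ?_, C * μ ^ 2, κ * μ ^ 2, by positivity, by positivity, hbound⟩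
  · simp [hs.u0]
  · simp [hv0]
  · exact (contDiff_const.mul (hcu.comp (contDiff_const.mul contDiff_id))).contDiffOn
  · exact (contDiff_const.mul (hcv.comp (contDiff_const.mul contDiff_id))).contDiffOn
  · intro r hr
    have hr2 : 0 < μ ^ 2 * r := by positivity
    have h3 : e = 1 / μ ^ 2 := by field_simp; linarith
    constructor
    · refine (((hs.du _ hr2).comp r (hdil r)).const_mul μ).congr_deriv ?_
      rw [h3]
      field_simp
    · refine (((hs.dv _ hr2).comp r (hdil r)).const_mul μ).congr_deriv ?_
      rw [h3]
      field_simp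
  · refine Filter.Tendsto.prodMk_nhds (hsq _ fun r hr => ?_) (hsq _ fun r hr => ?_)
    · exact le_trans (by linarith [sq_nonneg (μ * v (μ ^ 2 * r))]) (hbound r hr)
    · exact le_trans (by linarith [sq_nonneg (μ * u (μ ^ 2 * r))]) (hbound r hr)
end
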